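/- Let [0,1)^7 + T be a cube tiling of ℝ^7. If there exist x ∈ ℝ^7 and i ∈ {1,…,7} such that the set L(T,x,i) has exactly 5 elements, then the tiling contains a twin pair, i.e. there are t, s ∈ T and j ∈ {1,…,7} with |t_j − s_j| = 1 and t_i = s_i for every i ≠ j. -/

import Mathlib

/-- The half-open cube `[0,1)^7 + t`. -/
def Cube (t : Fin 7 → ℝ) : Set (Fin 7 → ℝ) :=
  {y | ∀ i, t i ≤ y i ∧ y i < t i + 1}

/-- `T` determines a cube tiling of `ℝ^7`: the cubes `[0,1)^7 + t`, `t ∈ T`,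
are pairwise disjoint and cover `ℝ^7`. -/
def IsCubeTiling (T : Set (Fin 7 → ℝ)) : Prop :=
  (T.Pairwise fun t s => Disjoint (Cube t) (Cube s)) ∧
    (⋃ t ∈ T, Cube t) = Set.univ

/-- `L(T,x,i)`: the set of `i`-th coordinates `t i` of vectors `t ∈ T` whose cube
meets the cube of `x` and with `t i ≤ x i`. -/
def LSet (T : Set (Fin 7 → ℝ)) (x : Fin 7 → ℝ) (i : Fin 7) : Set ℝ :=
  {r | ∃ t ∈ T, (Cube t ∩ Cube x).Nonempty ∧ t i ≤ x i ∧ r = t i}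

/-- The tiling contains a twin pair. -/
def HasTwinPair (T : Set (Fin 7 → ℝ)) : Prop :=
  ∃ t ∈ T, ∃ s ∈ T, ∃ j, |t j - s j| = 1 ∧ ∀ i, i ≠ j → t i = s i

namespace Polybox

open scoped Classical

variable {ι C : Type*}

section

/-- The letter opposite to `s`: same class, other bit. -/
def flp (s : C × Bool) : C × Bool := (s.1, !s.2)

@[simp] theorem flp_flp (s : C × Bool) : flp (flp s) = s := by simp [flp]
@[simp] theorem flp_fst (s : C × Bool) : (flp s).1 = s.1 := rfl
@[simp] theorem flp_snd (s : C × Bool) : (flp s).2 = !s.2 := rfl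
theorem flp_ne (s : C × Bool) : flp s ≠ s := by
  rcases s with ⟨c, b⟩; cases b <;> simp [flp]
theorem flp_inj {s t : C × Bool} : flp s = flp t ↔ s = t :=
  ⟨fun h => by simpa using congrArg flp h, fun h => by rw [h]⟩
theorem eq_or_eq_flp {s t : C × Bool} (h : s.1 = t.1) : s = t ∨ s = flp t := by
  rcases s with ⟨c, b⟩; rcases t with ⟨d, b'⟩
  simp only at h; subst h
  cases b <;> cases b' <;> simp [flp]

/-- The point `y` lies in the box of the word `w`, coordinates in `K` being ignored. -/
def Cov (K : Set ι) (w : ι → C × Bool) (y : ι → C → Bool) : Prop :=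
  ∀ i ∉ K, y i (w i).1 = (w i).2

/-- Two words agree off `K`. -/
def Agr (K : Set ι) (w v : ι → C × Bool) : Prop := ∀ i ∉ K, w i = v i

/-- Two words are dichotomous off `K`. -/
def Dich (K : Set ι) (w v : ι → C × Bool) : Prop := ∃ i ∉ K, v i = flp (w i)

/-- Two words form a twin pair off `K`. -/
def Twin (K : Set ι) (w v : ι → C × Bool) : Prop :=
  ∃ l ∉ K, v l = flp (w l) ∧ Agr (insert l K) w v

/-- Move the point `y` into the half-space of the letter `s` at coordinate `l`. -/
noncomputable def upd (y : ι → C → Bool) (l : ι) (s : C × Bool) : ι → C → Bool :=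
  fun i c => if i = l ∧ c = s.1 then s.2 else y i c

variable {K : Set ι} {w v u t : ι → C × Bool} {y : ι → C → Bool}

theorem Agr.symm (h : Agr K w v) : Agr K v w := fun i hi => (h i hi).symm
theorem Agr.trans (h : Agr K w v) (h' : Agr K v u) : Agr K w u :=
  fun i hi => (h i hi).trans (h' i hi)
theorem Agr.refl (w : ι → C × Bool) : Agr K w w := fun _ _ => rfl
theorem Agr.mono {K' : Set ι} (h : Agr K w v) (hK : K ⊆ K') : Agr K' w v :=
  fun i hi => h i (fun hk => hi (hK hk))
theorem Agr.cov (h : Agr K w v) (hc : Cov K w y) : Cov K v y :=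
  fun i hi => by rw [← h i hi]; exact hc i hi
theorem Dich.symm (h : Dich K w v) : Dich K v w := by
  obtain ⟨i, hi, h⟩ := h
  exact ⟨i, hi, by rw [h, flp_flp]⟩
theorem Cov.mono {K' : Set ι} (h : Cov K w y) (hK : K ⊆ K') : Cov K' w y :=
  fun i hi => h i (fun hk => hi (hK hk))
theorem Dich.mono {K' : Set ι} (h : Dich K' w v) (hK : K ⊆ K') : Dich K w v := by
  obtain ⟨i, hi, h⟩ := h
  exact ⟨i, fun hk => hi (hK hk), h⟩

theorem Cov.not_dich (h : Cov K w y) (h' : Cov K v y) : ¬ Dich K w v := by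
  rintro ⟨i, hi, e⟩
  have h1 := h i hi
  have h2 := h' i hi
  rw [e] at h2
  simp only [flp_fst, flp_snd] at h2
  rw [h1] at h2
  cases hb : (w i).2 <;> simp [hb] at h2

theorem Agr.not_dich (h : Agr K w v) : ¬ Dich K w v := by
  rintro ⟨i, hi, e⟩
  exact flp_ne (w i) (by rw [← e, h i hi])

theorem exists_cov (w : ι → C × Bool) (K : Set ι) : ∃ y, Cov K w y :=
  ⟨fun i _ => (w i).2, fun _ _ => rfl⟩

theorem exists_cov_of_not_dich (h : ¬ Dich K w v) : ∃ y, Cov K w y ∧ Cov K v y := by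
  refine ⟨fun i c => if c = (w i).1 then (w i).2 else (v i).2, fun i _ => by simp, ?_⟩
  intro i hi
  by_cases hc : (v i).1 = (w i).1
  · rcases eq_or_eq_flp hc with e | e
    · simp [e]
    · exact absurd ⟨i, hi, e⟩ h
  · simp [hc]

theorem cov_upd {l : ι} {s : C × Bool} :
    Cov K w (upd y l s) ↔ Cov (insert l K) w y ∧
      (l ∈ K ∨ (if (w l).1 = s.1 then (w l).2 = s.2 else y l (w l).1 = (w l).2)) := by
  constructor
  · intro h
    refine ⟨fun i hi => ?_, ?_⟩
    · have h1 : i ≠ l := fun e => hi (by simp [e])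
      have := h i (fun hk => hi (by simp [hk]))
      simpa [upd, h1] using this
    · by_cases hl : l ∈ K
      · exact Or.inl hl
      · right
        have := h l hl
        by_cases hc : (w l).1 = s.1
        · simp [upd, hc] at this ⊢; exact this.symm
        · simpa [upd, hc] using this
  · rintro ⟨h, h'⟩ i hi
    by_cases hil : i = l
    · subst hil
      rcases h' with h' | h'
      · exact absurd h' hi
      · by_cases hc : (w i).1 = s.1
        · simp [hc] at h'; simp [upd, hc, h']
        · simp [hc] at h'; simp [upd, hc, h']
    · have := h i (by simp [hil, hi])
      simpa [upd, hil] using this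

theorem cov_insert_of_cov {l : ι} (h : Cov K w y) : Cov (insert l K) w y :=
  h.mono (Set.subset_insert _ _)

theorem cov_iff_insert {l : ι} (hl : l ∉ K) :
    Cov K w y ↔ Cov (insert l K) w y ∧ y l (w l).1 = (w l).2 := by
  constructor
  · intro h; exact ⟨cov_insert_of_cov h, h l hl⟩
  · rintro ⟨h, h'⟩ i hi
    by_cases e : i = l
    · subst e; exact h'
    · exact h i (by simp [e, hi])

/-- Updating at a class different from that of `w l` does not matter. -/
theorem cov_upd_of_ne {l : ι} {s : C × Bool} (h : (w l).1 ≠ s.1) :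
    Cov K w (upd y l s) ↔ Cov K w y := by
  by_cases hl : l ∈ K
  · rw [cov_upd]; simp [hl]
  · rw [cov_upd, cov_iff_insert hl]; simp [hl, h]

theorem cov_upd_self {l : ι} {s : C × Bool} (hl : l ∉ K) (h : w l = s) :
    Cov K w (upd y l s) ↔ Cov (insert l K) w y := by
  rw [cov_upd]; simp [hl, h]

theorem not_cov_upd {l : ι} {s : C × Bool} (hl : l ∉ K) (h : w l = flp s) :
    ¬ Cov K w (upd y l s) := by
  rw [cov_upd]; simp [hl, h]

theorem cov_upd_mem {l : ι} {s : C × Bool} (hl : l ∈ K) :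
    Cov K w (upd y l s) ↔ Cov K w y := by
  rw [cov_upd]; simp [hl]

/-- If a point in the half-space of `s` is covered by `w` then so is the updated point. -/
theorem Cov.upd {l : ι} {s : C × Bool} (h : Cov K w y) (hs : w l ≠ flp s) :
    Cov K w (upd y l s) := by
  by_cases hc : (w l).1 = s.1
  · rcases eq_or_eq_flp hc with e | e
    · by_cases hl : l ∈ K
      · rwa [cov_upd_mem hl]
      · rw [cov_upd_self hl e]; exact cov_insert_of_cov h
    · exact absurd e hs
  · rwa [cov_upd_of_ne hc]

theorem agr_of_cov_imp (h : ∀ y, Cov K w y → Cov K v y) : Agr K w v := by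
  intro i hi
  by_contra hne
  obtain ⟨y, hy⟩ := exists_cov w K
  have hy' := hy.upd (l := i) (s := flp (v i)) (by rw [flp_flp]; exact hne)
  exact not_cov_upd (s := flp (v i)) hi (by simp) (h _ hy')

/-- Two words having the same nonempty trace on the box of `u` agree. -/
theorem agr_of_trace_eq {t₁ t₂ : ι → C × Bool} (h₁ : ¬ Dich K t₁ u) 
    (h : ∀ y, Cov K u y → (Cov K t₁ y ↔ Cov K t₂ y)) : Agr K t₁ t₂ := by
  obtain ⟨y, hy1, hyu⟩ := exists_cov_of_not_dich h₁
  have hy2 := (h y hyu).1 hy1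
  intro i hi
  by_contra hne
  by_cases hu : t₂ i = u i
  · -- then `t₁ i ≠ u i`
    have h1 : t₁ i ≠ u i := fun e => hne (e.trans hu.symm)
    have := (h _ (hyu.upd (l := i) (s := flp (t₁ i)) (by rw [flp_flp]; exact h1.symm))).2
      (hy2.upd (by rw [flp_flp]; exact Ne.symm hne))
    exact not_cov_upd (s := flp (t₁ i)) hi (by simp) this
  · have := (h _ (hyu.upd (l := i) (s := flp (t₂ i)) (by rw [flp_flp]; exact Ne.symm hu))).1
      (hy1.upd (by rw [flp_flp]; exact hne))
    exact not_cov_upd (s := flp (t₂ i)) hi (by simp) this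

/-- Pairwise dichotomous off `K`. -/
def Code (K : Set ι) (A : Finset (ι → C × Bool)) : Prop :=
  ∀ w ∈ A, ∀ v ∈ A, w ≠ v → Dich K w v

/-- No twin pairs off `K`. -/
def TwinFree (K : Set ι) (A : Finset (ι → C × Bool)) : Prop :=
  ∀ w ∈ A, ∀ v ∈ A, ¬ Twin K w v

theorem Code.eq_of_cov {A : Finset (ι → C × Bool)} (h : Code K A) (hw : w ∈ A) (hv : v ∈ A)
    (h1 : Cov K w y) (h2 : Cov K v y) : w = v := by
  by_contra hne
  exact h1.not_dich h2 (h w hw v hv hne)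

theorem Code.mono {A B : Finset (ι → C × Bool)} (h : Code K A) (hB : B ⊆ A) : Code K B :=
  fun w hw v hv => h w (hB hw) v (hB hv)

theorem TwinFree.mono {A B : Finset (ι → C × Bool)} (h : TwinFree K A) (hB : B ⊆ A) :
    TwinFree K B :=
  fun w hw v hv => h w (hB hw) v (hB hv)

/-- Words sharing a letter at `l` stay a code when `l` is ignored. -/
theorem Code.insert_of_const {A : Finset (ι → C × Bool)} (h : Code K A) {l : ι} {s : C × Bool}
    (hA : ∀ w ∈ A, w l = s) : Code (insert l K) A := by
  intro w hw v hv hne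
  obtain ⟨i, hi, e⟩ := h w hw v hv hne
  refine ⟨i, ?_, e⟩
  intro hk
  rcases hk with rfl | hk
  · rw [hA w hw, hA v hv] at e; exact flp_ne s e.symm
  · exact hi hk

theorem TwinFree.insert_of_const {A : Finset (ι → C × Bool)} (h : TwinFree K A) {l : ι}
    {s : C × Bool} (hA : ∀ w ∈ A, w l = s) : TwinFree (insert l K) A := by
  rintro w hw v hv ⟨i, hi, e, ha⟩
  refine h w hw v hv ⟨i, fun hk => hi (by simp [hk]), e, fun m hm => ?_⟩
  by_cases hml : m = l
  · subst hml; rw [hA w hw, hA v hv]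
  · refine ha m ?_
    simp only [Set.mem_insert_iff, not_or] at hm ⊢
    exact ⟨hm.1, hml, hm.2⟩

end

section

variable {K : Set ι} {w v u t t₁ t₂ : ι → C × Bool} {y : ι → C → Bool}
  {A B : Finset (ι → C × Bool)}

theorem upd_upd_insert {l : ι} {s : C × Bool} : Cov (insert l K) w (upd y l s) ↔
    Cov (insert l K) w y := cov_upd_mem (by simp)

theorem ne_flp_of_fst_ne {s t : C × Bool} (h : s.1 ≠ t.1) : s ≠ flp t := by
  rintro rfl; exact h rfl

theorem fst_ne_of_flp {l : ι} (hl : l ∉ K) (h₁ : ¬ Dich K t₁ u) (h₂ : ¬ Dich K t₂ u)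
    (h : t₂ l = flp (t₁ l)) : (u l).1 ≠ (t₁ l).1 := by
  intro e
  rcases eq_or_eq_flp e with e | e
  · exact h₂ ⟨l, hl, by rw [h, e, flp_flp]⟩
  · exact h₁ ⟨l, hl, e⟩

/-- A box is not, inside another box, the disjoint union of two boxes which are not twins. -/
theorem twin_of_union (h₁ : ¬ Dich K t₁ u) (h₂ : ¬ Dich K t₂ u) (hd : Dich K t₁ t₂)
    (h : ∀ y, Cov K u y → (Cov K t y ↔ Cov K t₁ y ∨ Cov K t₂ y)) : Twin K t₁ t₂ := by
  obtain ⟨m, hm, e⟩ := hd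
  have hu : (u m).1 ≠ (t₁ m).1 := fst_ne_of_flp hm h₁ h₂ e
  obtain ⟨y1, hy1, hy1u⟩ := exists_cov_of_not_dich h₁
  obtain ⟨y2, hy2, hy2u⟩ := exists_cov_of_not_dich h₂
  have c1 := (h _ hy1u).2 (Or.inl hy1)
  have c2 := (h _ hy2u).2 (Or.inr hy2)
  have ht : (t m).1 ≠ (t₁ m).1 := by
    intro et
    have a1 := c1 m hm
    have a2 := c2 m hm
    have b1 := hy1 m hm
    have b2 := hy2 m hm
    rw [e] at b2
    simp only [flp_fst, flp_snd] at b2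
    rw [et] at a1 a2
    rw [a1] at b1; rw [a2, b1] at b2
    cases hb : (t₁ m).2 <;> simp [hb] at b2
  have key : ∀ y, Cov K u y →
      (Cov (insert m K) t₁ y ↔ Cov (insert m K) t₂ y) := by
    intro y hy
    have hyp : ∀ s : C × Bool, s.1 = (t₁ m).1 → Cov K u (upd y m s) := fun s hs =>
      (cov_upd_of_ne (by rw [hs]; exact hu)).2 hy
    have htp : ∀ s : C × Bool, s.1 = (t₁ m).1 → (Cov K t (upd y m s) ↔ Cov K t y) :=
      fun s hs => cov_upd_of_ne (by rw [hs]; exact ht)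
    have e1 : Cov K t y ↔ Cov (insert m K) t₁ y := by
      rw [← htp (t₁ m) rfl, h _ (hyp (t₁ m) rfl), cov_upd_self hm rfl]
      simp [not_cov_upd hm e]
    have e2 : Cov K t y ↔ Cov (insert m K) t₂ y := by
      rw [← htp (flp (t₁ m)) rfl, h _ (hyp (flp (t₁ m)) rfl), cov_upd_self hm e]
      simp [not_cov_upd (w := t₁) (s := flp (t₁ m)) hm (by simp)]
    rw [← e1, e2]
  refine ⟨m, hm, e, agr_of_trace_eq (u := u) ?_ ?_⟩
  · exact fun h => h₁ (h.mono (Set.subset_insert _ _))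
  · intro y hy
    have := key (upd y m (u m)) ((cov_upd_self hm rfl).2 hy)
    rwa [upd_upd_insert, upd_upd_insert] at this

/-- Two twin-free codes without common words, with the same nonempty trace on a box which
all their words meet, have together at least four words. -/
theorem four_le_card_add (hA : Code K A) (hB : Code K B) (tA : TwinFree K A)
    (tB : TwinFree K B) (mA : ∀ a ∈ A, ¬ Dich K a u) (mB : ∀ b ∈ B, ¬ Dich K b u)
    (hno : ∀ a ∈ A, ∀ b ∈ B, ¬ Agr K a b)
    (htr : ∀ y, Cov K u y → ((∃ a ∈ A, Cov K a y) ↔ ∃ b ∈ B, Cov K b y))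
    (hne : A.Nonempty) : 4 ≤ A.card + B.card := by
  have hneB : B.Nonempty := by
    obtain ⟨a, ha⟩ := hne
    obtain ⟨y, hy, hyu⟩ := exists_cov_of_not_dich (mA a ha)
    obtain ⟨b, hb, -⟩ := (htr y hyu).1 ⟨a, ha, hy⟩
    exact ⟨b, hb⟩
  have aux : ∀ A B : Finset (ι → C × Bool), A.card = 1 → B.card = 2 → Code K B →
      TwinFree K B → (∀ b ∈ B, ¬ Dich K b u) →
      (∀ y, Cov K u y → ((∃ a ∈ A, Cov K a y) ↔ ∃ b ∈ B, Cov K b y)) → False := by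
    intro A B h1 h2 hB tB mB htr
    obtain ⟨t, rfl⟩ := Finset.card_eq_one.1 h1
    obtain ⟨t₁, t₂, h12, rfl⟩ := Finset.card_eq_two.1 h2
    exact tB t₁ (by simp) t₂ (by simp) (twin_of_union (t := t) (mB t₁ (by simp))
      (mB t₂ (by simp)) (hB t₁ (by simp) t₂ (by simp) h12) (by simpa using htr))
  by_contra hlt
  have p1 := hne.card_pos
  have p2 := hneB.card_pos
  have : (A.card = 1 ∧ B.card = 1) ∨ (A.card = 1 ∧ B.card = 2) ∨ (A.card = 2 ∧ B.card = 1) := by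
    omega
  rcases this with ⟨h1, h2⟩ | ⟨h1, h2⟩ | ⟨h1, h2⟩
  · obtain ⟨t, rfl⟩ := Finset.card_eq_one.1 h1
    obtain ⟨t', rfl⟩ := Finset.card_eq_one.1 h2
    exact hno t (by simp) t' (by simp) (agr_of_trace_eq (mA t (by simp)) (by simpa using htr))
  · exact aux A B h1 h2 hB tB mB htr
  · exact aux B A h2 h1 hA tA mA (fun y hy => (htr y hy).symm)

/-- The words with a given letter at `l`. -/
noncomputable def fib (A : Finset (ι → C × Bool)) (l : ι) (s : C × Bool) :
    Finset (ι → C × Bool) := A.filter (fun w => w l = s)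

/-- The words with a given class at `l`. -/
noncomputable def cls (A : Finset (ι → C × Bool)) (l : ι) (c : C) :
    Finset (ι → C × Bool) := A.filter (fun w => (w l).1 = c)

@[simp] theorem mem_fib {l : ι} {s : C × Bool} : w ∈ fib A l s ↔ w ∈ A ∧ w l = s := by
  simp [fib]
@[simp] theorem mem_cls {l : ι} {c : C} : w ∈ cls A l c ↔ w ∈ A ∧ (w l).1 = c := by
  simp [cls]
theorem fib_subset {l : ι} {s : C × Bool} : fib A l s ⊆ A := Finset.filter_subset _ _
theorem cls_subset {l : ι} {c : C} : cls A l c ⊆ A := Finset.filter_subset _ _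

theorem cls_eq_union {l : ι} {s : C × Bool} :
    cls A l s.1 = fib A l s ∪ fib A l (flp s) := by
  ext w
  simp only [mem_cls, mem_fib, Finset.mem_union]
  constructor
  · rintro ⟨h, e⟩
    rcases eq_or_eq_flp e with e | e
    · exact Or.inl ⟨h, e⟩
    · exact Or.inr ⟨h, e⟩
  · rintro (⟨h, e⟩ | ⟨h, e⟩)
    · exact ⟨h, by rw [e]⟩
    · exact ⟨h, by rw [e]; rfl⟩

theorem fib_disjoint {l : ι} {s t : C × Bool} (h : s ≠ t) :
    Disjoint (fib A l s) (fib A l t) := by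
  rw [Finset.disjoint_left]
  intro w hw hw'
  simp only [mem_fib] at hw hw'
  exact h (hw.2.symm.trans hw'.2)

theorem cls_disjoint {l : ι} {c d : C} (h : c ≠ d) :
    Disjoint (cls A l c) (cls A l d) := by
  rw [Finset.disjoint_left]
  intro w hw hw'
  simp only [mem_cls] at hw hw'
  exact h (hw.2.symm.trans hw'.2)

theorem card_cls {l : ι} {s : C × Bool} :
    (cls A l s.1).card = (fib A l s).card + (fib A l (flp s)).card := by
  rw [cls_eq_union, Finset.card_union_of_disjoint (fib_disjoint (flp_ne s).symm)]

theorem Code.fib (h : Code K A) (l : ι) (s : C × Bool) : Code (insert l K) (fib A l s) :=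
  (h.mono fib_subset).insert_of_const (fun _ hw => (mem_fib.1 hw).2)

theorem TwinFree.fib (h : TwinFree K A) (l : ι) (s : C × Bool) :
    TwinFree (insert l K) (fib A l s) :=
  (h.mono fib_subset).insert_of_const (fun _ hw => (mem_fib.1 hw).2)

/-- `A` covers the box `u` off `K`. -/
def Covers (K : Set ι) (A : Finset (ι → C × Bool)) (u : ι → C × Bool) : Prop :=
  ∀ y, Cov K u y → ∃ a ∈ A, Cov K a y

/-- In a code, opposite fibres have the same trace on a covered box, off the coordinate. -/
theorem fib_trace (hA : Code K A) {l : ι} (hl : l ∉ K) {s : C × Bool}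
    (hu : (u l).1 ≠ s.1) (hc : Covers K A u) (y : ι → C → Bool) (hy : Cov (insert l K) u y) :
    (∃ a ∈ fib A l s, Cov (insert l K) a y) → ∃ a ∈ fib A l (flp s), Cov (insert l K) a y := by
  rintro ⟨a, ha, hay⟩
  obtain ⟨haA, has⟩ := mem_fib.1 ha
  set y' := upd y l (u l) with hy'
  have hyu : Cov K u y' := (cov_upd_self hl rfl).2 hy
  have hyf : Cov K u (upd y' l (flp s)) := by
    rw [cov_upd_of_ne]
    · exact hyu
    · simpa using hu
  obtain ⟨b, hb, hby⟩ := hc _ hyf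
  have hay' : Cov K a (upd y' l s) := by
    rw [cov_upd_self hl has, upd_upd_insert]; exact hay
  refine ⟨b, mem_fib.2 ⟨hb, ?_⟩, ?_⟩
  · by_contra hne
    by_cases hc' : (b l).1 = s.1
    · rcases eq_or_eq_flp hc' with e | e
      · exact not_cov_upd (w := b) (s := flp s) hl (by rw [e, flp_flp]) hby
      · exact hne e
    · have h1 : Cov K b y' := (cov_upd_of_ne (by simpa using hc')).1 hby
      have h2 : Cov K b (upd y' l s) := (cov_upd_of_ne hc').2 h1
      have := hA.eq_of_cov haA hb hay' h2
      exact hc' (by rw [← this, has])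
  · have := cov_insert_of_cov (l := l) hby
    rwa [upd_upd_insert, upd_upd_insert] at this

theorem fib_trace_iff (hA : Code K A) {l : ι} (hl : l ∉ K) {s : C × Bool}
    (hu : (u l).1 ≠ s.1) (hc : Covers K A u) (y : ι → C → Bool) (hy : Cov (insert l K) u y) :
    (∃ a ∈ fib A l s, Cov (insert l K) a y) ↔ ∃ a ∈ fib A l (flp s), Cov (insert l K) a y :=
  ⟨fib_trace hA hl hu hc y hy, fun h => by
    simpa using fib_trace hA hl (s := flp s) (by simpa using hu) hc y hy h⟩

theorem not_dich_insert {l : ι} (h : ¬ Dich K w v) : ¬ Dich (insert l K) w v :=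
  fun h' => h (h'.mono (Set.subset_insert _ _))

theorem fib_no_agr (tA : TwinFree K A) {l : ι} (hl : l ∉ K) (s : C × Bool) :
    ∀ a ∈ fib A l s, ∀ b ∈ fib A l (flp s), ¬ Agr (insert l K) a b := by
  intro a ha b hb hab
  rw [mem_fib] at ha hb
  exact tA a ha.1 b hb.1 ⟨l, hl, by rw [ha.2, hb.2], hab⟩

/-- A class occurring in a twin-free code covering a box, and foreign to the box, occurs at
least four times. -/
theorem four_le_card_cls (hA : Code K A) (tA : TwinFree K A) (mA : ∀ a ∈ A, ¬ Dich K a u)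
    (hc : Covers K A u) {l : ι} (hl : l ∉ K) (ht : t ∈ A) (hu : (t l).1 ≠ (u l).1) :
    4 ≤ (cls A l (t l).1).card := by
  rw [card_cls]
  exact four_le_card_add (hA.fib l _) (hA.fib l _) (tA.fib l _) (tA.fib l _)
    (fun a ha => not_dich_insert (mA a (fib_subset ha)))
    (fun a ha => not_dich_insert (mA a (fib_subset ha)))
    (fib_no_agr tA hl _) (fib_trace_iff hA hl hu.symm hc) ⟨t, by simp [ht]⟩

/-- The words of `A` meeting the box `u`. -/
noncomputable def meet (K : Set ι) (A : Finset (ι → C × Bool)) (u : ι → C × Bool) :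
    Finset (ι → C × Bool) := A.filter (fun w => ¬ Dich K w u)

@[simp] theorem mem_meet : w ∈ meet K A u ↔ w ∈ A ∧ ¬ Dich K w u := by simp [meet]
theorem meet_subset : meet K A u ⊆ A := Finset.filter_subset _ _

theorem Covers.meet (h : Covers K A u) : Covers K (meet K A u) u := by
  intro y hy
  obtain ⟨a, ha, hay⟩ := h y hy
  exact ⟨a, mem_meet.2 ⟨ha, hay.not_dich hy⟩, hay⟩

theorem Covers.nonempty (h : Covers K A u) : A.Nonempty := by
  obtain ⟨y, hy⟩ := exists_cov u K
  obtain ⟨a, ha, -⟩ := h y hy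
  exact ⟨a, ha⟩

theorem agr_iff_upd (w : ι → C × Bool) : Agr K w u ∨ ∃ l ∉ K, w l ≠ u l := by
  by_cases h : Agr K w u
  · exact Or.inl h
  · right; simp only [Agr, not_forall] at h; obtain ⟨l, hl, h⟩ := h; exact ⟨l, hl, h⟩

theorem fst_ne_of_not_dich {l : ι} (hl : l ∉ K) (h : ¬ Dich K w u) (hne : w l ≠ u l) :
    (w l).1 ≠ (u l).1 := by
  intro e
  rcases eq_or_eq_flp e with e | e
  · exact hne e
  · exact h ⟨l, hl, by rw [e, flp_flp]⟩

/-- A fibre covers, off its coordinate, when all words have the same class there. -/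
theorem Covers.fib (h : Covers K A u) {l : ι} (hl : l ∉ K) {s : C × Bool} (hs : s.1 ≠ (u l).1)
    (hall : ∀ a ∈ A, (a l).1 = s.1) : Covers (insert l K) (fib A l s) u := by
  intro y hy
  have hyu : Cov K u (upd y l (u l)) := (cov_upd_self hl rfl).2 hy
  have hyf : Cov K u (upd (upd y l (u l)) l s) := (cov_upd_of_ne hs.symm).2 hyu
  obtain ⟨a, ha, hay⟩ := h _ hyf
  refine ⟨a, mem_fib.2 ⟨ha, ?_⟩, ?_⟩
  · rcases eq_or_eq_flp (hall a ha) with e | e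
    · exact e
    · exact absurd hay (not_cov_upd hl e)
  · have := cov_insert_of_cov (l := l) hay
    rwa [upd_upd_insert, upd_upd_insert] at this

theorem exists_agr_of_card_le (n : ℕ) : ∀ (K : Set ι) (A : Finset (ι → C × Bool)),
    A.card = n → n ≤ 4 → Code K A → TwinFree K A → Covers K A u → ∃ a ∈ A, Agr K a u := by
  induction n using Nat.strong_induction_on with
  | _ n ih =>
  intro K A hn hn4 hA tA hc
  by_contra hno
  push Not at hno
  by_cases hm : meet K A u = A
  swap
  · have hlt : (meet K A u).card < A.card :=
      Finset.card_lt_card (Finset.ssubset_iff_subset_ne.2 ⟨meet_subset, hm⟩)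
    obtain ⟨a, ha, haa⟩ := ih _ (hn ▸ hlt) K _ rfl (by omega) (hA.mono meet_subset)
      (tA.mono meet_subset) hc.meet
    exact hno a (meet_subset ha) haa
  have mA : ∀ a ∈ A, ¬ Dich K a u := fun a ha => (mem_meet.1 (hm.symm ▸ ha)).2
  obtain ⟨t, ht⟩ := hc.nonempty
  obtain ⟨l, hl, hne⟩ := (agr_iff_upd (K := K) (u := u) t).resolve_left (hno t ht)
  have hcl := fst_ne_of_not_dich hl (mA t ht) hne
  have h4 := four_le_card_cls hA tA mA hc hl ht hcl
  have hall : cls A l (t l).1 = A :=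
    Finset.eq_of_subset_of_card_le cls_subset (by omega)
  have hall' : ∀ a ∈ A, (a l).1 = (t l).1 := fun a ha => (mem_cls.1 (hall.symm ▸ ha)).2
  have c1 := hc.fib hl (s := t l) hcl hall'
  have c2 := hc.fib hl (s := flp (t l)) hcl hall'
  have hcard : A.card = (fib A l (t l)).card + (fib A l (flp (t l))).card := by
    rw [← card_cls, hall]
  have p1 := c1.nonempty.card_pos
  have p2 := c2.nonempty.card_pos
  obtain ⟨a, ha, haa⟩ := ih _ (by omega) _ _ rfl (by omega) (hA.fib l (t l)) (tA.fib l _) c1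
  obtain ⟨b, hb, hbb⟩ := ih _ (by omega) _ _ rfl (by omega) (hA.fib l (flp (t l))) (tA.fib l _) c2
  exact fib_no_agr tA hl _ a ha b hb (haa.trans hbb.symm)

/-- A twin-free code covering a box, with no word agreeing with it, has at least five words
meeting it. -/
theorem five_le_card_meet (hA : Code K A) (tA : TwinFree K A) (hc : Covers K A u)
    (hno : ∀ a ∈ A, ¬ Agr K a u) : 5 ≤ (meet K A u).card := by
  by_contra hlt
  obtain ⟨a, ha, haa⟩ := exists_agr_of_card_le _ K _ rfl (by omega) (hA.mono meet_subset)
    (tA.mono meet_subset) hc.meet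
  exact hno a (meet_subset ha) haa

/-- If moreover all words avoid the class of `u` at some coordinate, there are six. -/
theorem six_le_card_meet (hA : Code K A) (tA : TwinFree K A) (hc : Covers K A u) {l : ι}
    (hl : l ∉ K) (hno : ∀ a ∈ meet K A u, (a l).1 ≠ (u l).1) : 6 ≤ (meet K A u).card := by
  set M := meet K A u with hM
  have hA' := hA.mono (meet_subset (K := K) (A := A) (u := u))
  have tA' := tA.mono (meet_subset (K := K) (A := A) (u := u))
  have mA : ∀ a ∈ M, ¬ Dich K a u := fun a ha => (mem_meet.1 ha).2
  have hc' := hc.meet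
  rw [← hM] at hA' tA' hc'
  obtain ⟨t, ht⟩ := hc'.nonempty
  have h1 := four_le_card_cls hA' tA' mA hc' hl ht (hno t ht)
  by_cases hall : ∀ a ∈ M, (a l).1 = (t l).1
  · have c1 := hc'.fib hl (s := t l) (hno t ht) hall
    have c2 := hc'.fib hl (s := flp (t l)) (hno t ht) hall
    have hcard : M.card = (fib M l (t l)).card + (fib M l (flp (t l))).card := by
      rw [← card_cls]
      congr 1
      ext a; simp only [mem_cls]; exact ⟨fun h => ⟨h, hall a h⟩, fun h => h.1⟩
    have p1 := c1.nonempty.card_pos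
    have p2 := c2.nonempty.card_pos
    by_contra hlt
    by_cases h5 : (fib M l (t l)).card ≤ 4
    · by_cases h6 : (fib M l (flp (t l))).card ≤ 4
      · obtain ⟨a, ha, haa⟩ := exists_agr_of_card_le _ _ _ rfl h5 (hA'.fib l (t l)) (tA'.fib l _) c1
        obtain ⟨b, hb, hbb⟩ := exists_agr_of_card_le _ _ _ rfl h6 (hA'.fib l _) (tA'.fib l _) c2
        exact fib_no_agr tA' hl _ a ha b hb (haa.trans hbb.symm)
      · omega
    · omega
  · push Not at hall
    obtain ⟨r, hr, hrt⟩ := hall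
    have h2 := four_le_card_cls hA' tA' mA hc' hl hr (hno r hr)
    have := Finset.card_le_card (Finset.union_subset
      (cls_subset (A := M) (l := l) (c := (t l).1)) (cls_subset (A := M) (l := l) (c := (r l).1)))
    rw [Finset.card_union_of_disjoint (cls_disjoint hrt.symm)] at this
    omega

end

section

variable {K : Set ι} {w v u t t₁ t₂ : ι → C × Bool} {y : ι → C → Bool}
  {A B U : Finset (ι → C × Bool)} {σ τ : (ι → C × Bool) → ℤ}

/-- A linear relation between the indicators of the boxes of `U` off `K`. -/
def Rel (K : Set ι) (U : Finset (ι → C × Bool)) (σ : (ι → C × Bool) → ℤ) : Prop :=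
  ∀ y, ∑ w ∈ U, (if Cov K w y then σ w else 0) = 0

/-- The coefficients are signs. -/
def Sgn (U : Finset (ι → C × Bool)) (σ : (ι → C × Bool) → ℤ) : Prop :=
  ∀ w ∈ U, σ w = 1 ∨ σ w = -1

/-- Words which agree off `K` have equal signs. -/
def Red (K : Set ι) (U : Finset (ι → C × Bool)) (σ : (ι → C × Bool) → ℤ) : Prop :=
  ∀ w ∈ U, ∀ v ∈ U, Agr K w v → σ w = σ v

/-- The sign of a letter. -/
def bit (s : C × Bool) : ℤ := if s.2 then 1 else -1

theorem bit_flp (s : C × Bool) : bit (flp s) = - bit s := by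
  rcases s with ⟨c, b⟩; cases b <;> simp [bit, flp]
theorem bit_eq (s : C × Bool) : bit s = 1 ∨ bit s = -1 := by
  rcases s with ⟨c, b⟩; cases b <;> simp [bit]

/-- The relation obtained by differentiating in the class `c` at `l`. -/
def dsgn (σ : (ι → C × Bool) → ℤ) (l : ι) : (ι → C × Bool) → ℤ := fun w => σ w * bit (w l)

theorem Sgn.mono (h : Sgn U σ) (hA : A ⊆ U) : Sgn A σ := fun w hw => h w (hA hw)
theorem Sgn.dsgn (h : Sgn U σ) (l : ι) : Sgn U (dsgn σ l) := by
  intro w hw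
  rcases h w hw with e | e <;> rcases bit_eq (w l) with e' | e' <;> simp [Polybox.dsgn, e, e']

theorem Rel.split (h : Rel K U σ) {l : ι} (hl : l ∉ K) (c : C) :
    Rel (insert l K) (cls U l c) (dsgn σ l) := by
  intro y
  have h1 := h (upd y l (c, true))
  have h2 := h (upd y l (c, false))
  rw [cls, Finset.sum_filter]
  have : ∑ w ∈ U, ((if Cov K w (upd y l (c, true)) then σ w else 0) -
      (if Cov K w (upd y l (c, false)) then σ w else 0)) = 0 := by
    rw [Finset.sum_sub_distrib, h1, h2, sub_zero]
  refine Eq.trans (Finset.sum_congr rfl fun w _ => ?_) this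
  by_cases hc : (w l).1 = c
  · rw [if_pos hc]
    rcases hb : (w l).2 with _ | _
    · have e : w l = (c, false) := Prod.ext hc hb
      have n := not_cov_upd (K := K) (w := w) (y := y) (s := (c, true)) hl (by rw [e]; rfl)
      have p := cov_upd_self (K := K) (w := w) (y := y) hl e
      rw [if_neg n]
      simp only [p, dsgn, bit, hb, Bool.false_eq_true, if_false]
      split_ifs <;> simp
    · have e : w l = (c, true) := Prod.ext hc hb
      have n := not_cov_upd (K := K) (w := w) (y := y) (s := (c, false)) hl (by rw [e]; rfl)
      have p := cov_upd_self (K := K) (w := w) (y := y) hl e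
      rw [if_neg n]
      simp only [p, dsgn, bit, hb, if_true]
      split_ifs <;> simp
  · rw [if_neg hc, cov_upd_of_ne (s := (c, true)) hc, cov_upd_of_ne (s := (c, false)) hc, sub_self]

theorem Rel.merge (h : Rel K U σ) (l : ι) : Rel (insert l K) U σ := by
  intro y
  by_cases hl : l ∈ K
  · rw [Set.insert_eq_of_mem hl]; exact h y
  set y' : ι → C → Bool := fun i c => if i = l then !(y i c) else y i c with hy'
  have : ∑ w ∈ U, ((if Cov K w y then σ w else 0) + (if Cov K w y' then σ w else 0)) = 0 := by
    rw [Finset.sum_add_distrib, h y, h y', add_zero]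
  refine Eq.trans (Finset.sum_congr rfl fun w _ => ?_) this
  have hi : Cov (insert l K) w y' ↔ Cov (insert l K) w y := by
    refine forall₂_congr fun i hi => ?_
    have : i ≠ l := fun e => hi (by simp [e])
    simp [hy', this]
  rw [cov_iff_insert (y := y) hl, cov_iff_insert (y := y') hl, hi]
  by_cases hc : Cov (insert l K) w y
  · simp only [hc, true_and, if_true, hy']
    cases y l (w l).1 <;> cases (w l).2 <;> simp
  · simp [hc]

theorem Rel.sum_eq_zero [Finite ι] (h : Rel K U σ) : ∑ w ∈ U, σ w = 0 := by
  have := Fintype.ofFinite ι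
  have key : ∀ s : Finset ι, Rel (K ∪ ↑s) U σ := by
    intro s
    induction s using Finset.induction_on with
    | empty => simpa using h
    | insert a s _ ih =>
      have := ih.merge a
      rwa [Finset.coe_insert, Set.union_insert]
  have := key Finset.univ (fun _ _ => true)
  have hc : ∀ w : ι → C × Bool, Cov (K ∪ ↑(Finset.univ : Finset ι)) w (fun _ _ => true) :=
    fun w i hi => absurd (by simp) hi
  simpa only [hc, if_true] using this

theorem Sgn.sum_parity (h : Sgn U σ) : (2 : ℤ) ∣ (∑ w ∈ U, σ w) - U.card := by
  have : (∑ w ∈ U, σ w) - U.card = ∑ w ∈ U, (σ w - 1) := by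
    rw [Finset.sum_sub_distrib]; simp
  rw [this]
  refine Finset.dvd_sum fun w hw => ?_
  rcases h w hw with e | e <;> simp [e]

theorem Rel.even [Finite ι] (h : Rel K U σ) (hs : Sgn U σ) : Even U.card := by
  have h1 := hs.sum_parity
  rw [h.sum_eq_zero] at h1
  rw [Nat.even_iff]
  omega

theorem Rel.even_cls [Finite ι] (h : Rel K U σ) (hs : Sgn U σ) {l : ι} (hl : l ∉ K) (c : C) :
    Even (cls U l c).card :=
  (h.split hl c).even ((hs.dsgn l).mono cls_subset)

/-- A reduced nonempty relation has two classes at some coordinate. -/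
theorem Rel.exists_ne (h : Rel K U σ) (hs : Sgn U σ) (hr : Red K U σ) (hne : U.Nonempty) :
    ∃ l ∉ K, ∃ w ∈ U, ∃ v ∈ U, (w l).1 ≠ (v l).1 := by
  by_contra hcon
  push Not at hcon
  obtain ⟨w₀, hw₀⟩ := hne
  set y : ι → C → Bool := fun i _ => (w₀ i).2 with hy
  have hagr : ∀ w ∈ U, Cov K w y → Agr K w w₀ := by
    intro w hw hc i hi
    have := hc i hi
    exact Prod.ext (hcon i hi w hw w₀ hw₀) (by simpa [hy] using this.symm)
  have := h y
  have e : ∑ w ∈ U, (if Cov K w y then σ w else 0) =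
      ∑ w ∈ U, (if Cov K w y then σ w₀ else 0) := by
    refine Finset.sum_congr rfl fun w hw => ?_
    split_ifs with hc
    · exact hr w hw w₀ hw₀ (hagr w hw hc)
    · rfl
  rw [e, ← Finset.sum_filter, Finset.sum_const, nsmul_eq_mul, mul_eq_zero] at this
  rcases this with h0 | h0
  · have : w₀ ∈ U.filter (fun w => Cov K w y) := by
      simp only [Finset.mem_filter]; exact ⟨hw₀, fun i _ => by simp [hy]⟩
    rw [Nat.cast_eq_zero, Finset.card_eq_zero] at h0
    rw [h0] at this; simp at this
  · rcases hs w₀ hw₀ with e | e <;> simp [e] at h0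

theorem Rel.pair {a b : ι → C × Bool} (hab : a ≠ b) (h : Rel K {a, b} σ)
    (hs : Sgn {a, b} σ) : Agr K a b ∧ σ b = - σ a := by
  have ha := hs a (by simp)
  have hb := hs b (by simp)
  have h' : ∀ y, (if Cov K a y then σ a else 0) + (if Cov K b y then σ b else 0) = 0 := by
    intro y; have := h y; rwa [Finset.sum_pair hab] at this
  have imp : ∀ y, Cov K a y → Cov K b y := by
    intro y hy
    by_contra hn
    have := h' y
    simp only [hy, hn, if_true, if_false] at this
    omega
  refine ⟨agr_of_cov_imp imp, ?_⟩
  obtain ⟨y, hy⟩ := exists_cov a K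
  have := h' y
  simp only [hy, imp y hy, if_true] at this
  omega

/-- A class with two words in a reduced relation. -/
theorem Rel.cls_pair {l : ι} {c : C} {a : ι → C × Bool} (h : Rel K U σ) (hs : Sgn U σ)
    (hr : Red K U σ) (hl : l ∉ K) (h2 : (cls U l c).card = 2) (ha : a ∈ cls U l c) :
    ∃ b, a ≠ b ∧ cls U l c = {a, b} ∧ b l = flp (a l) ∧ σ b = σ a ∧ Agr (insert l K) a b := by
  obtain ⟨a', b', hab, e⟩ := Finset.card_eq_two.1 h2
  obtain ⟨b, hab, e⟩ : ∃ b, a ≠ b ∧ cls U l c = {a, b} := by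
    rw [e, Finset.mem_insert, Finset.mem_singleton] at ha
    rcases ha with rfl | rfl
    · exact ⟨b', hab, e⟩
    · exact ⟨a', hab.symm, by rw [e, Finset.pair_comm]⟩
  have hsp := h.split hl c
  have hss := (hs.dsgn l).mono (cls_subset (l := l) (c := c))
  rw [e] at hsp hss
  obtain ⟨hagr, hσ⟩ := hsp.pair hab hss
  have hb : b ∈ cls U l c := by rw [e]; simp
  simp only [mem_cls] at ha hb
  refine ⟨b, hab, e, ?_⟩
  have hcl : (b l).1 = (a l).1 := by rw [ha.2, hb.2]
  rcases eq_or_eq_flp hcl with e | e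
  · exfalso
    have hA : Agr K a b := fun i hi => by
      by_cases hil : i = l
      · rw [hil, e]
      · exact hagr i (by simp [hil, hi])
    have := hr a ha.1 b hb.1 hA
    simp only [dsgn, e, this] at hσ
    rcases hs b hb.1 with e1 | e1 <;> rcases bit_eq (a l) with e2 | e2 <;> simp [e1, e2] at hσ
  · refine ⟨e, ?_, hagr⟩
    simp only [dsgn, e, bit_flp] at hσ
    rcases bit_eq (a l) with e2 | e2 <;> simp [e2] at hσ <;> omega

theorem cls_card_le_of_ne {l : ι} {c d : C} (h : c ≠ d) :
    (cls U l c).card + (cls U l d).card ≤ U.card := by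
  rw [← Finset.card_union_of_disjoint (cls_disjoint h)]
  exact Finset.card_le_card (Finset.union_subset cls_subset cls_subset)

theorem mem_cls_self {l : ι} (h : w ∈ U) : w ∈ cls U l (w l).1 := mem_cls.2 ⟨h, rfl⟩

theorem Rel.two_le [Finite ι] (h : Rel K U σ) (hs : Sgn U σ) {l : ι} (hl : l ∉ K)
    (hw : w ∈ U) : 2 ≤ (cls U l (w l).1).card := by
  have := h.even_cls hs hl (w l).1
  have p : 0 < (cls U l (w l).1).card := Finset.card_pos.2 ⟨w, mem_cls_self hw⟩
  rw [Nat.even_iff] at this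
  omega

theorem Rel.exists_ne' (h : Rel K U σ) (hs : Sgn U σ) (hr : Red K U σ) (ha : w ∈ U) :
    ∃ l ∉ K, ∃ v ∈ U, (v l).1 ≠ (w l).1 := by
  obtain ⟨l, hl, x, hx, y, hy, hxy⟩ := h.exists_ne hs hr ⟨w, ha⟩
  by_cases e : (x l).1 = (w l).1
  · exact ⟨l, hl, y, hy, fun e' => hxy (by rw [e, e'])⟩
  · exact ⟨l, hl, x, hx, e⟩

/-- The shape of a reduced relation with four words. -/
structure Quad (K : Set ι) (σ : (ι → C × Bool) → ℤ) (m : ι) (a b c d : ι → C × Bool) : Prop where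
  hm : m ∉ K
  sb : σ b = σ a
  sc : σ c = - σ a
  sd : σ d = - σ a
  ab : Agr (insert m K) a b
  ac : Agr (insert m K) a c
  ad : Agr (insert m K) a d
  mb : b m = flp (a m)
  md : d m = flp (c m)
  ne : (c m).1 ≠ (a m).1

theorem Rel.quad [Finite ι] (h : Rel K U σ) (hs : Sgn U σ) (hr : Red K U σ) (h4 : U.card = 4)
    {a : ι → C × Bool} (ha : a ∈ U) :
    ∃ m b c d, U = {a, b, c, d} ∧ a ≠ b ∧ c ≠ d ∧ cls U m (a m).1 = {a, b} ∧
      cls U m (c m).1 = {c, d} ∧ Quad K σ m a b c d := by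
  obtain ⟨m, hm, c, hc, hca⟩ := h.exists_ne' hs hr ha
  have h1 := h.two_le hs hm ha
  have h2 := h.two_le hs hm hc
  have h3 := cls_card_le_of_ne (U := U) (l := m) hca
  obtain ⟨b, hab, eab, mb, sb, gab⟩ := h.cls_pair hs hr hm (by omega) (mem_cls_self (l := m) ha)
  obtain ⟨d, hcd, ecd, md, sd, gcd⟩ := h.cls_pair hs hr hm (by omega) (mem_cls_self (l := m) hc)
  have hU : U = {a, b, c, d} := by
    have : cls U m (a m).1 ∪ cls U m (c m).1 = U := by
      refine Finset.eq_of_subset_of_card_le (Finset.union_subset cls_subset cls_subset) ?_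
      rw [Finset.card_union_of_disjoint (cls_disjoint hca.symm)]
      omega
    rw [eab, ecd] at this
    rw [← this]
    ext x; simp only [Finset.mem_union, Finset.mem_insert, Finset.mem_singleton]; tauto
  refine ⟨m, b, c, d, hU, hab, hcd, eab, ecd, ?_⟩
  have hsa := hs a ha
  have hsc := hs c hc
  have hsum : ∀ f : (ι → C × Bool) → ℤ, ∑ w ∈ U, f w = f a + f b + (f c + f d) := by
    intro f
    have : U = cls U m (a m).1 ∪ cls U m (c m).1 := by
      rw [eab, ecd, hU]
      ext x; simp only [Finset.mem_union, Finset.mem_insert, Finset.mem_singleton]; tauto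
    rw [this, Finset.sum_union (cls_disjoint hca.symm), eab, ecd, Finset.sum_pair hab,
      Finset.sum_pair hcd]
  have hrel : ∀ y, (if Cov (insert m K) a y then σ a else 0) +
      (if Cov (insert m K) c y then σ c else 0) = 0 := by
    intro y
    have := h.merge m y
    rw [hsum] at this
    have e1 : Cov (insert m K) b y ↔ Cov (insert m K) a y :=
      ⟨gab.symm.cov, gab.cov⟩
    have e2 : Cov (insert m K) d y ↔ Cov (insert m K) c y :=
      ⟨gcd.symm.cov, gcd.cov⟩
    simp only [e1, e2, sb, sd] at this
    omega
  have imp : ∀ y, Cov (insert m K) a y → Cov (insert m K) c y := by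
    intro y hy
    by_contra hn
    have := hrel y
    simp only [hy, hn, if_true, if_false] at this
    omega
  have gac := agr_of_cov_imp imp
  have hσ : σ c = - σ a := by
    obtain ⟨y, hy⟩ := exists_cov a (insert m K)
    have := hrel y
    simp only [hy, imp y hy, if_true] at this
    omega
  exact ⟨hm, sb, hσ, by rw [sd, hσ], gab, gac, gac.trans gcd, mb, md, hca⟩

end

section

variable {K : Set ι} {w v u t t₁ t₂ : ι → C × Bool} {y : ι → C → Bool}
  {A B U : Finset (ι → C × Bool)} {σ τ : (ι → C × Bool) → ℤ}

/-- The shape of a reduced relation with six words. -/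
structure Hexa (K : Set ι) (σ : (ι → C × Bool) → ℤ) (m l : ι)
    (w₁ w₂ w₃ w₄ w₅ w₆ : ι → C × Bool) : Prop where
  hm : m ∉ K
  hl : l ∉ K
  hml : m ≠ l
  s2 : σ w₂ = σ w₁
  s3 : σ w₃ = σ w₁
  s4 : σ w₄ = - σ w₁
  s5 : σ w₅ = - σ w₁
  s6 : σ w₆ = - σ w₁
  a2 : Agr (insert m (insert l K)) w₁ w₂
  a3 : Agr (insert m (insert l K)) w₁ w₃
  a4 : Agr (insert m (insert l K)) w₁ w₄
  a5 : Agr (insert m (insert l K)) w₁ w₅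
  a6 : Agr (insert m (insert l K)) w₁ w₆
  m2 : w₂ m = w₁ m
  m3 : w₃ m = flp (w₁ m)
  m5 : w₅ m = flp (w₄ m)
  m6 : w₆ m = w₁ m
  m4 : (w₄ m).1 ≠ (w₁ m).1
  l2 : w₂ l = flp (w₁ l)
  l3 : (w₃ l).1 ≠ (w₁ l).1
  l4 : w₄ l = w₃ l
  l5 : w₅ l = w₃ l
  l6 : w₆ l = flp (w₃ l)

theorem agr_of_insert {l : ι} (h : Agr (insert l K) w v) (hl : w l = v l) : Agr K w v :=
  fun i hi => by
    by_cases e : i = l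
    · rw [e, hl]
    · exact h i (by simp [e, hi])

theorem Rel.hexa_aux [Finite ι] (h : Rel K U σ) (hs : Sgn U σ) (hr : Red K U σ)
    (h6 : U.card = 6) : ∃ l ∉ K, ∃ w₁ ∈ U, ∃ v ∈ U, (v l).1 ≠ (w₁ l).1 ∧
      (cls U l (w₁ l).1).card = 2 ∧ (cls U l (v l).1).card = 4 := by
  have hne : U.Nonempty := Finset.card_pos.1 (by omega)
  obtain ⟨l, hl, x, hx, y, hy, hxy⟩ := h.exists_ne hs hr hne
  obtain ⟨w₁, hw₁, v, hv, hvw, h2⟩ : ∃ w₁ ∈ U, ∃ v ∈ U, (v l).1 ≠ (w₁ l).1 ∧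
      (cls U l (w₁ l).1).card = 2 := by
    have e1 := h.two_le hs hl hx
    have e2 := h.two_le hs hl hy
    have p1 := Nat.even_iff.1 (h.even_cls hs hl (x l).1)
    have p2 := Nat.even_iff.1 (h.even_cls hs hl (y l).1)
    have e3 := cls_card_le_of_ne (U := U) (l := l) hxy
    by_cases hc : (cls U l (x l).1).card = 2
    · exact ⟨x, hx, y, hy, hxy.symm, hc⟩
    · exact ⟨y, hy, x, hx, hxy, by omega⟩
  refine ⟨l, hl, w₁, hw₁, v, hv, hvw, h2, ?_⟩
  by_contra hv4
  have e2 := h.two_le hs hl hv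
  have p2 := Nat.even_iff.1 (h.even_cls hs hl (v l).1)
  have e3 := cls_card_le_of_ne (U := U) (l := l) hvw
  have hv2 : (cls U l (v l).1).card = 2 := by omega
  obtain ⟨z, hz, hz1, hz2⟩ : ∃ z ∈ U, (z l).1 ≠ (w₁ l).1 ∧ (z l).1 ≠ (v l).1 := by
    by_contra hcon
    push Not at hcon
    have : U ⊆ cls U l (w₁ l).1 ∪ cls U l (v l).1 := by
      intro z hz
      simp only [Finset.mem_union, mem_cls]
      by_cases e : (z l).1 = (w₁ l).1
      · exact Or.inl ⟨hz, e⟩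
      · exact Or.inr ⟨hz, hcon z hz e⟩
    have := Finset.card_le_card this
    have := Finset.card_union_le (cls U l (w₁ l).1) (cls U l (v l).1)
    omega
  have hz2' := h.two_le hs hl hz
  have hdis : Disjoint (cls U l (w₁ l).1 ∪ cls U l (v l).1) (cls U l (z l).1) := by
    rw [Finset.disjoint_union_left]
    exact ⟨cls_disjoint hz1.symm, cls_disjoint hz2.symm⟩
  have hU : (cls U l (w₁ l).1 ∪ cls U l (v l).1) ∪ cls U l (z l).1 = U := by
    refine Finset.eq_of_subset_of_card_le (Finset.union_subset (Finset.union_subset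
      cls_subset cls_subset) cls_subset) ?_
    rw [Finset.card_union_of_disjoint hdis, Finset.card_union_of_disjoint (cls_disjoint hvw.symm)]
    omega
  have hz3 : (cls U l (z l).1).card = 2 := by
    have := congrArg Finset.card hU
    rw [Finset.card_union_of_disjoint hdis,
      Finset.card_union_of_disjoint (cls_disjoint hvw.symm)] at this
    omega
  have hsum := h.sum_eq_zero
  rw [← hU, Finset.sum_union hdis, Finset.sum_union (cls_disjoint hvw.symm)] at hsum
  have aux : ∀ x ∈ U, (cls U l (x l).1).card = 2 → ∑ w ∈ cls U l (x l).1, σ w = 2 * σ x := by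
    intro x hx hx2
    obtain ⟨b, hab, e, -, sb, -⟩ := h.cls_pair hs hr hl hx2 (mem_cls_self hx)
    rw [e, Finset.sum_pair hab, sb]; ring
  rw [aux _ hw₁ h2, aux _ hv hv2, aux _ hz hz3] at hsum
  rcases hs w₁ hw₁ with a | a <;> rcases hs v hv with b | b <;> rcases hs z hz with c | c <;>
    simp [a, b, c] at hsum

theorem Rel.hexa [Finite ι] (h : Rel K U σ) (hs : Sgn U σ) (hr : Red K U σ) (h6 : U.card = 6) :
    ∃ m l w₁ w₂ w₃ w₄ w₅ w₆, U = {w₁, w₂, w₃, w₄, w₅, w₆} ∧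
      Hexa K σ m l w₁ w₂ w₃ w₄ w₅ w₆ := by
  obtain ⟨l, hl, w₁, hw₁, v, hv, hvw, h2, h4⟩ := h.hexa_aux hs hr h6
  obtain ⟨w₂, h12, e12, l2, s2, g2⟩ := h.cls_pair hs hr hl h2 (mem_cls_self hw₁)
  have hw₂ : w₂ ∈ U := cls_subset (l := l) (c := (w₁ l).1) (by rw [e12]; simp)
  have hU : cls U l (w₁ l).1 ∪ cls U l (v l).1 = U := by
    refine Finset.eq_of_subset_of_card_le (Finset.union_subset cls_subset cls_subset) ?_
    rw [Finset.card_union_of_disjoint (cls_disjoint hvw.symm)]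
    omega
  have hcase : ∀ w ∈ U, w = w₁ ∨ w = w₂ ∨ (w l).1 = (v l).1 := by
    intro w hw
    rw [← hU, e12] at hw
    simp only [Finset.mem_union, Finset.mem_insert, Finset.mem_singleton, mem_cls] at hw
    tauto
  -- half of the relation
  have half : ∀ s : C × Bool, s.1 = (v l).1 → Rel (insert l K) (insert w₁ (fib U l s)) σ := by
    intro s hsv y
    have hf : insert w₁ (fib U l s) = U.filter (fun w => w = w₁ ∨ w l = s) := by
      ext w
      simp only [Finset.mem_insert, mem_fib, Finset.mem_filter]
      constructor
      · rintro (rfl | ⟨a, b⟩)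
        · exact ⟨hw₁, Or.inl rfl⟩
        · exact ⟨a, Or.inr b⟩
      · rintro ⟨a, b | b⟩
        · exact Or.inl b
        · exact Or.inr ⟨a, b⟩
    rw [hf, Finset.sum_filter]
    refine Eq.trans (Finset.sum_congr rfl fun w hw => ?_) (h (upd (upd y l (w₁ l)) l s))
    rcases hcase w hw with rfl | rfl | hc
    · have : Cov K w (upd (upd y l (w l)) l s) ↔ Cov (insert l K) w y := by
        rw [cov_upd_of_ne (by rw [hsv]; exact hvw.symm), cov_upd_self hl rfl]
      simp [this]
    · have : ¬ Cov K w (upd (upd y l (w₁ l)) l s) := by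
        rw [cov_upd_of_ne (by rw [l2, hsv]; exact hvw.symm)]
        exact not_cov_upd hl l2
      have n1 : w l ≠ s := by
        intro e; rw [← e, l2] at hsv; exact hvw hsv.symm
      simp [this, h12.symm, n1]
    · have n1 : w ≠ w₁ := by rintro rfl; exact hvw hc.symm
      rcases eq_or_eq_flp (hc.trans hsv.symm) with e | e
      · have : Cov K w (upd (upd y l (w₁ l)) l s) ↔ Cov (insert l K) w y := by
          rw [cov_upd_self hl e, upd_upd_insert]
        simp [this, e]
      · have : ¬ Cov K w (upd (upd y l (w₁ l)) l s) := not_cov_upd hl e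
        have n2 : w l ≠ s := by rw [e]; exact flp_ne s
        simp [this, n1, n2]
  have hnot : ∀ s : C × Bool, s.1 = (v l).1 → w₁ ∉ fib U l s := by
    intro s hsv hm
    rw [mem_fib] at hm
    rw [← hm.2] at hsv; exact hvw hsv.symm
  have hsg : ∀ s : C × Bool, Sgn (insert w₁ (fib U l s)) σ := fun s =>
    hs.mono (Finset.insert_subset hw₁ fib_subset)
  have par : ∀ s : C × Bool, s.1 = (v l).1 → (fib U l s).card % 2 = 1 := by
    intro s hsv
    have := Nat.even_iff.1 ((half s hsv).even (hsg s))
    rw [Finset.card_insert_of_notMem (hnot s hsv)] at this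
    omega
  obtain ⟨s, hsv, hs3, hs1⟩ : ∃ s : C × Bool, s.1 = (v l).1 ∧ (fib U l s).card = 3 ∧
      (fib U l (flp s)).card = 1 := by
    have p1 := par (v l) rfl
    have p2 := par (flp (v l)) rfl
    have p3 := card_cls (A := U) (l := l) (s := v l)
    rw [h4] at p3
    by_cases e : (fib U l (v l)).card = 3
    · exact ⟨v l, rfl, e, by omega⟩
    · exact ⟨flp (v l), rfl, by omega, by rw [flp_flp]; omega⟩
  obtain ⟨w₆, e6⟩ := Finset.card_eq_one.1 hs1
  have hw₆ : w₆ ∈ fib U l (flp s) := by rw [e6]; simp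
  have h16 : w₁ ≠ w₆ := by rintro rfl; exact hnot (flp s) hsv hw₆
  have r6 := half (flp s) hsv
  have sg6 := hsg (flp s)
  rw [e6] at r6 sg6
  obtain ⟨g6, s6⟩ := r6.pair h16 sg6
  have inner : ∀ a ∈ fib U l s, ∀ b ∈ fib U l s, Agr (insert l K) a b → σ a = σ b := by
    intro a ha b hb hab
    rw [mem_fib] at ha hb
    exact hr a ha.1 b hb.1 (agr_of_insert hab (by rw [ha.2, hb.2]))
  have cross : ∀ b ∈ fib U l s, Agr (insert l K) w₁ b → σ b = σ w₁ := by
    intro b hb hab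
    by_contra hne
    have hσb : σ b = - σ w₁ := by
      rcases hs w₁ hw₁ with e | e <;> rcases hs b (fib_subset hb) with e' | e' <;>
        simp [e, e'] at hne ⊢
    have hc2 : ((fib U l s).erase b).card = 2 := by rw [Finset.card_erase_of_mem hb, hs3]
    obtain ⟨p, q, hpq, epq⟩ := Finset.card_eq_two.1 hc2
    have hp : p ∈ fib U l s := Finset.mem_of_mem_erase (a := b) (by rw [epq]; simp)
    have hq : q ∈ fib U l s := Finset.mem_of_mem_erase (a := b) (by rw [epq]; simp)
    have rel2 : Rel (insert l K) {p, q} σ := by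
      intro y
      have := half s hsv y
      rw [Finset.sum_insert (hnot s hsv), ← Finset.add_sum_erase _ _ hb, epq] at this
      have e : Cov (insert l K) b y ↔ Cov (insert l K) w₁ y := ⟨hab.symm.cov, hab.cov⟩
      simp only [e, hσb] at this
      by_cases hc : Cov (insert l K) w₁ y <;> simp only [hc, if_true, if_false] at this <;> omega
    have sg2 : Sgn {p, q} σ := by
      rw [← epq]; exact hs.mono ((Finset.erase_subset _ _).trans fib_subset)
    obtain ⟨gpq, hσ⟩ := rel2.pair hpq sg2
    have := inner p hp q hq gpq
    rcases hs p (fib_subset hp) with e | e <;> omega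
  have red : Red (insert l K) (insert w₁ (fib U l s)) σ := by
    intro a ha b hb hab
    rw [Finset.mem_insert] at ha hb
    rcases ha with rfl | ha <;> rcases hb with rfl | hb
    · rfl
    · exact (cross b hb hab).symm
    · exact cross a ha hab.symm
    · exact inner a ha b hb hab
  obtain ⟨m, w₃, w₄, w₅, eU, h13, h45, -, -, Q⟩ := (half s hsv).quad (hsg s) red
    (by rw [Finset.card_insert_of_notMem (hnot s hsv), hs3]) (a := w₁) (by simp)
  have hml : m ≠ l := fun e => Q.hm (by simp [e])
  have hmK : m ∉ K := fun e => Q.hm (by simp [e])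
  have n4 : w₄ ≠ w₁ := by rintro rfl; exact Q.ne rfl
  have n5 : w₅ ≠ w₁ := by rintro rfl; exact Q.ne (by rw [Q.md]; rfl)
  have mem' : ∀ x, x ≠ w₁ → x ∈ ({w₁, w₃, w₄, w₅} : Finset (ι → C × Bool)) → x ∈ fib U l s := by
    intro x hx hx'
    rw [← eU, Finset.mem_insert] at hx'
    exact hx'.resolve_left hx
  have i3 := mem_fib.1 (mem' w₃ h13.symm (by simp))
  have i4 := mem_fib.1 (mem' w₄ n4 (by simp))
  have i5 := mem_fib.1 (mem' w₅ n5 (by simp))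
  have i6 := mem_fib.1 hw₆
  refine ⟨m, l, w₁, w₂, w₃, w₄, w₅, w₆, ?_, ?_⟩
  · ext x
    constructor
    · intro hx
      rcases hcase x hx with e | e | e
      · simp [e]
      · simp [e]
      · rcases eq_or_eq_flp (e.trans hsv.symm) with e | e
        · have : x ∈ insert w₁ (fib U l s) := by simp [hx, e]
          rw [eU] at this
          simp only [Finset.mem_insert, Finset.mem_singleton] at this ⊢
          tauto
        · have : x ∈ fib U l (flp s) := mem_fib.2 ⟨hx, e⟩
          rw [e6, Finset.mem_singleton] at this
          simp [this]
    · simp only [Finset.mem_insert, Finset.mem_singleton]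
      rintro (rfl | rfl | rfl | rfl | rfl | rfl)
      exacts [hw₁, hw₂, i3.1, i4.1, i5.1, i6.1]
  · have sub : insert l K ⊆ insert m (insert l K) := Set.subset_insert _ _
    have hmi : m ∉ insert l K := Q.hm
    exact
      { hm := hmK, hl := hl, hml := hml, s2 := s2, s3 := Q.sb, s4 := Q.sc, s5 := Q.sd, s6 := s6
        a2 := g2.mono sub, a3 := Q.ab, a4 := Q.ac, a5 := Q.ad, a6 := g6.mono sub
        m2 := (g2 m hmi).symm, m3 := Q.mb, m5 := Q.md, m6 := (g6 m hmi).symm, m4 := Q.ne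
        l2 := l2, l3 := by rw [i3.2, hsv]; exact hvw
        l4 := by rw [i3.2, i4.2], l5 := by rw [i3.2, i5.2], l6 := by rw [i3.2, i6.2] }

end

section

variable {K : Set ι} {w v u t t₁ t₂ : ι → C × Bool} {y : ι → C → Bool}
  {A B U V W : Finset (ι → C × Bool)} {σ τ : (ι → C × Bool) → ℤ}

/-- Two twin-free codes without common words covering the same set, off `K`. -/
structure St (K : Set ι) (V W : Finset (ι → C × Bool)) : Prop where
  cV : Code K V
  cW : Code K W
  tV : TwinFree K V
  tW : TwinFree K W
  no : ∀ v ∈ V, ∀ w ∈ W, ¬ Agr K v w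
  cov : ∀ y, (∃ v ∈ V, Cov K v y) ↔ ∃ w ∈ W, Cov K w y

theorem St.symm (h : St K V W) : St K W V :=
  ⟨h.cW, h.cV, h.tW, h.tV, fun w hw v hv e => h.no v hv w hw e.symm, fun y => (h.cov y).symm⟩

/-- The sign distinguishing `V` from its complement. -/
noncomputable def sg (V : Finset (ι → C × Bool)) : (ι → C × Bool) → ℤ :=
  fun w => if w ∈ V then 1 else -1

theorem sgn_sg : Sgn U (sg V) := fun w _ => by
  unfold sg; split_ifs <;> simp

theorem Code.sum_cov (h : Code K A) (y : ι → C → Bool) :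
    ∑ w ∈ A, (if Cov K w y then (1 : ℤ) else 0) = if ∃ w ∈ A, Cov K w y then 1 else 0 := by
  split_ifs with hex
  · obtain ⟨w, hw, hwy⟩ := hex
    rw [Finset.sum_eq_single_of_mem w hw, if_pos hwy]
    intro v hv hne
    rw [if_neg]
    exact fun hvy => hne (h.eq_of_cov hv hw hvy hwy)
  · push Not at hex
    exact Finset.sum_eq_zero fun w hw => if_neg (hex w hw)

theorem St.disjoint (h : St K V W) : Disjoint V W := by
  rw [Finset.disjoint_left]
  exact fun w hv hw => h.no w hv w hw (Agr.refl w)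

theorem St.not_mem (h : St K V W) (hw : w ∈ W) : w ∉ V :=
  fun hv => h.no w hv w hw (Agr.refl w)

theorem St.rel (h : St K V W) : Rel K (V ∪ W) (sg V) := by
  intro y
  rw [Finset.sum_union h.disjoint]
  have e1 : ∑ w ∈ V, (if Cov K w y then sg V w else 0) =
      ∑ w ∈ V, (if Cov K w y then (1 : ℤ) else 0) :=
    Finset.sum_congr rfl fun w hw => by simp [sg, hw]
  have e2 : ∑ w ∈ W, (if Cov K w y then sg V w else 0) =
      - ∑ w ∈ W, (if Cov K w y then (1 : ℤ) else 0) := by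
    rw [← Finset.sum_neg_distrib]
    refine Finset.sum_congr rfl fun w hw => ?_
    have := h.not_mem hw
    split_ifs <;> simp [sg, this]
  rw [e1, e2, h.cV.sum_cov, h.cW.sum_cov]
  simp only [h.cov y, add_neg_cancel]

theorem card_eq_of_rel_sum (h : Disjoint V W) (hs : ∑ w ∈ V ∪ W, sg V w = 0) :
    V.card = W.card := by
  rw [Finset.sum_union h] at hs
  have e1 : ∑ w ∈ V, sg V w = V.card := by
    rw [Finset.sum_congr rfl (g := fun _ => (1 : ℤ)) (fun w hw => by simp [sg, hw])]; simp
  have e2 : ∑ w ∈ W, sg V w = - W.card := by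
    rw [Finset.sum_congr rfl (g := fun _ => (-1 : ℤ))
      (fun w hw => by simp [sg, Finset.disjoint_right.1 h hw])]; simp
  omega

theorem St.card_eq [Finite ι] (h : St K V W) : V.card = W.card :=
  card_eq_of_rel_sum h.disjoint h.rel.sum_eq_zero

/-- The words of `V ∪ W` having class `c` at `j`. -/
noncomputable def blk (V W : Finset (ι → C × Bool)) (j : ι) (c : C) : Finset (ι → C × Bool) :=
  cls (V ∪ W) j c

theorem mem_blk {j : ι} {c : C} : w ∈ blk V W j c ↔ (w ∈ V ∨ w ∈ W) ∧ (w j).1 = c := by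
  simp [blk]

theorem blk_eq {j : ι} {c : C} : blk V W j c = cls V j c ∪ cls W j c := by
  ext w; simp only [mem_blk, Finset.mem_union, mem_cls]; tauto

theorem St.blk_rel (h : St K V W) {j : ι} (hj : j ∉ K) (c : C) :
    Rel (insert j K) (blk V W j c) (dsgn (sg V) j) := h.rel.split hj c

/-- Half of the size of the block of the class of `s` at `j`. -/
noncomputable def hb (V W : Finset (ι → C × Bool)) (j : ι) (s : C × Bool) : ℕ :=
  (fib V j (flp s)).card + (fib W j s).card

theorem St.hb_flp [Finite ι] (h : St K V W) {j : ι} (hj : j ∉ K) (s : C × Bool) :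
    hb V W j (flp s) = hb V W j s := by
  have hsum := (h.blk_rel hj s.1).sum_eq_zero
  rw [blk_eq, Finset.sum_union (h.disjoint.mono cls_subset cls_subset), cls_eq_union, cls_eq_union,
    Finset.sum_union (fib_disjoint (flp_ne s).symm),
    Finset.sum_union (fib_disjoint (flp_ne s).symm)] at hsum
  have e1 : ∀ t, ∑ w ∈ fib V j t, dsgn (sg V) j w = bit t * (fib V j t).card := by
    intro t
    rw [Finset.sum_congr rfl (g := fun _ => bit t)]
    · simp [mul_comm]
    · intro w hw
      rw [mem_fib] at hw
      simp [dsgn, sg, hw.1, hw.2]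
  have e2 : ∀ t, ∑ w ∈ fib W j t, dsgn (sg V) j w = - bit t * (fib W j t).card := by
    intro t
    rw [Finset.sum_congr rfl (g := fun _ => - bit t)]
    · simp [mul_comm]
    · intro w hw
      rw [mem_fib] at hw
      simp [dsgn, sg, h.not_mem hw.1, hw.2]
  rw [e1, e1, e2, e2, bit_flp] at hsum
  unfold hb
  rw [flp_flp]
  rcases bit_eq s with e | e <;> rw [e] at hsum <;> omega

theorem St.card_blk [Finite ι] (h : St K V W) {j : ι} (hj : j ∉ K) (s : C × Bool) :
    (blk V W j s.1).card = 2 * hb V W j s := by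
  have := h.hb_flp hj s
  rw [blk_eq, Finset.card_union_of_disjoint (h.disjoint.mono cls_subset cls_subset), card_cls,
    card_cls]
  unfold hb at this ⊢
  rw [flp_flp] at this
  omega

theorem St.card_union [Finite ι] (h : St K V W) : (V ∪ W).card = 2 * V.card := by
  rw [Finset.card_union_of_disjoint h.disjoint, ← h.card_eq]; ring

theorem St.hb_add_le [Finite ι] (h : St K V W) {j : ι} (hj : j ∉ K) {s r : C × Bool}
    (hsr : s.1 ≠ r.1) : hb V W j s + hb V W j r ≤ V.card := by
  have := cls_card_le_of_ne (U := V ∪ W) (l := j) hsr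
  have h1 := h.card_blk hj s
  have h2 := h.card_blk hj r
  unfold blk at h1 h2
  rw [h1, h2, h.card_union] at this
  omega

/-- A word of `V` and a word of `W` flipped in exactly the two coordinates `j`, `k`. -/
structure DT (K : Set ι) (V W : Finset (ι → C × Bool)) (v w : ι → C × Bool) (j k : ι) :
    Prop where
  hj : j ∉ K
  hk : k ∉ K
  jk : j ≠ k
  mv : v ∈ V
  mw : w ∈ W
  wj : w j = flp (v j)
  wk : w k = flp (v k)
  agr : Agr (insert k (insert j K)) v w

theorem DT.symm {j k : ι} (h : DT K V W v w j k) : DT K W V w v j k :=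
  ⟨h.hj, h.hk, h.jk, h.mw, h.mv, by rw [h.wj, flp_flp], by rw [h.wk, flp_flp], h.agr.symm⟩

theorem DT.swap {j k : ι} (h : DT K V W v w j k) : DT K V W v w k j :=
  ⟨h.hk, h.hj, h.jk.symm, h.mv, h.mw, h.wk, h.wj, by rw [Set.insert_comm]; exact h.agr⟩

theorem TwinFree.not_flp (hA : TwinFree K A) (ha : w ∈ A) (hb : v ∈ A) {l : ι} (hl : l ∉ K)
    (h : Agr (insert l K) w v) : v l ≠ flp (w l) := fun e => hA w ha v hb ⟨l, hl, e, h⟩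

/-- Blocks are reduced. -/
theorem St.blk_red (h : St K V W) {j : ι} (hj : j ∉ K) (c : C) :
    Red (insert j K) (blk V W j c) (dsgn (sg V) j) := by
  intro a ha b hb hab
  rw [mem_blk] at ha hb
  obtain ⟨ha, hac⟩ := ha
  obtain ⟨hb, hbc⟩ := hb
  have key : ∀ {a b : ι → C × Bool}, a ∈ V → b ∈ W → Agr (insert j K) a b →
      (b j).1 = (a j).1 → dsgn (sg V) j a = dsgn (sg V) j b := by
    intro a b ha hb hab hc
    rcases eq_or_eq_flp hc with e | e
    · exact absurd (agr_of_insert hab e.symm) (h.no a ha b hb)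
    · simp [dsgn, sg, ha, h.not_mem hb, e, bit_flp]
  rcases eq_or_eq_flp (hbc.trans hac.symm) with e | e
  · have e' := agr_of_insert hab e.symm
    rcases ha with ha | ha <;> rcases hb with hb | hb
    · simp [dsgn, sg, ha, hb, e]
    · exact absurd e' (h.no a ha b hb)
    · exact absurd e'.symm (h.no b hb a ha)
    · simp [dsgn, sg, h.not_mem ha, h.not_mem hb, e]
  · rcases ha with ha | ha <;> rcases hb with hb | hb
    · exact absurd e (h.tV.not_flp ha hb hj hab)
    · exact key ha hb hab (hbc.trans hac.symm)
    · exact (key hb ha hab.symm (hac.trans hbc.symm)).symm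
    · exact absurd e (h.tW.not_flp ha hb hj hab)

/-- No double twin in the block, through the second coordinate `k`. -/
def NoDT (K : Set ι) (V W : Finset (ι → C × Bool)) (j k : ι) (c d : C) : Prop :=
  ∀ v w, DT K V W v w j k → (v j).1 = c → (v k).1 ≠ d

/-- Blocks without double twins are reduced after a second splitting. -/
theorem St.blk_red₂ (h : St K V W) {j k : ι} (hj : j ∉ K) (hk : k ∉ insert j K) {c d : C}
    (hn : NoDT K V W j k c d) :
    Red (insert k (insert j K)) (cls (blk V W j c) k d) (dsgn (dsgn (sg V) j) k) := by
  have hkj : j ≠ k := fun e => hk (by simp [e])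
  have hkK : k ∉ K := fun e => hk (by simp [e])
  intro a ha b hb hab
  rw [mem_cls, mem_blk] at ha hb
  obtain ⟨⟨ha, hac⟩, had⟩ := ha
  obtain ⟨⟨hb, hbc⟩, hbd⟩ := hb
  have hrd := h.blk_red hj c
  rcases eq_or_eq_flp (hbd.trans had.symm) with e | e
  · have := hrd a (mem_blk.2 ⟨ha, hac⟩) b (mem_blk.2 ⟨hb, hbc⟩) (agr_of_insert hab e.symm)
    simp only [dsgn] at this ⊢
    rw [this, e]
  have key : ∀ {a b : ι → C × Bool}, a ∈ V → b ∈ W → Agr (insert k (insert j K)) a b →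
      b k = flp (a k) → (a j).1 = c → (a k).1 = d → (b j).1 = c →
      dsgn (dsgn (sg V) j) k a = dsgn (dsgn (sg V) j) k b := by
    intro a b ha hb hab e hac had hbc
    rcases eq_or_eq_flp (hbc.trans hac.symm) with e' | e'
    · simp [dsgn, sg, ha, h.not_mem hb, e, e', bit_flp]
    · exact absurd had (hn a b ⟨hj, hkK, hkj, ha, hb, e', e, hab⟩ hac)
  have key2 : b j = a j ∨ b j = flp (a j) := eq_or_eq_flp (hbc.trans hac.symm)
  have hab' : b j = a j → Agr (insert k K) a b := fun e' => by
    refine agr_of_insert (l := j) ?_ e'.symm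
    rw [Set.insert_comm]; exact hab
  rcases ha with ha | ha <;> rcases hb with hb | hb
  · rcases key2 with e' | e'
    · exact absurd e (h.tV.not_flp ha hb hkK (hab' e'))
    · simp [dsgn, sg, ha, hb, e, e', bit_flp]
  · exact key ha hb hab e hac had hbc
  · exact (key hb ha hab.symm (by rw [e, flp_flp]) hbc hbd hac).symm
  · rcases key2 with e' | e'
    · exact absurd e (h.tW.not_flp ha hb hkK (hab' e'))
    · simp [dsgn, sg, h.not_mem ha, h.not_mem hb, e, e', bit_flp]

theorem St.blk_rel₂ (h : St K V W) {j k : ι} (hj : j ∉ K) (hk : k ∉ insert j K) (c d : C) :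
    Rel (insert k (insert j K)) (cls (blk V W j c) k d) (dsgn (dsgn (sg V) j) k) :=
  (h.blk_rel hj c).split hk d

theorem sgn_blk₂ {j k : ι} : Sgn U (dsgn (dsgn (sg V) j) k) := (sgn_sg.dsgn j).dsgn k

/-- In a block without double twins, subblocks have at least four words. -/
theorem St.four_le_cls [Finite ι] (h : St K V W) {j k : ι} (hj : j ∉ K) (hk : k ∉ insert j K)
    {c d : C} (hn : NoDT K V W j k c d) (ht : t ∈ blk V W j c) (htd : (t k).1 = d) :
    4 ≤ (cls (blk V W j c) k d).card := by
  have h1 := (h.blk_rel hj c).two_le (sgn_sg.dsgn j) hk ht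
  have h2 := Nat.even_iff.1 ((h.blk_rel hj c).even_cls (sgn_sg.dsgn j) hk d)
  rw [htd] at h1
  by_contra hlt
  have hc2 : (cls (blk V W j c) k d).card = 2 := by omega
  obtain ⟨a, b, hab, e⟩ := Finset.card_eq_two.1 hc2
  have hr := h.blk_rel₂ hj hk c d
  have hd := h.blk_red₂ hj hk hn
  rw [e] at hr hd
  obtain ⟨g, hσ⟩ := hr.pair hab sgn_blk₂
  have := hd a (by simp) b (by simp) g
  rcases sgn_blk₂ (U := {a, b}) (V := V) (j := j) (k := k) a (by simp) with e | e <;> omega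

end

section

variable {K : Set ι} {w v u t t₁ t₂ : ι → C × Bool} {y : ι → C → Bool}
  {A B U V W : Finset (ι → C × Bool)} {σ τ : (ι → C × Bool) → ℤ} {j k : ι}

/-- The point `y` moved into prescribed half-spaces at `j` and `k`. -/
noncomputable def pt (y : ι → C → Bool) (j k : ι) (s t : C × Bool) : ι → C → Bool :=
  upd (upd y j s) k t

theorem upd_comm (hjk : j ≠ k) {s t : C × Bool} :
    upd (upd y j s) k t = upd (upd y k t) j s := by
  funext i c
  simp only [upd]
  by_cases h1 : i = j
  · subst h1; simp [hjk]
  · simp [h1]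

theorem cov_mv (hj : j ∉ K) (hk : k ∉ K) (hjk : j ≠ k) :
    Cov K w (pt y j k (w j) (w k)) ↔ Cov (insert k (insert j K)) w y := by
  unfold pt
  rw [cov_upd_self hk rfl, Set.insert_comm, cov_upd_self (by simp [hjk, hj]) rfl]

theorem Cov.mv {s t : C × Bool} (h : Cov K w y) (hs : w j ≠ flp s) (ht : w k ≠ flp t) :
    Cov K w (pt y j k s t) := (h.upd hs).upd ht

theorem Cov.mv_left {s s' t : C × Bool} (hjk : j ≠ k) (h : Cov K w (pt y j k s t))
    (hs : (w j).1 ≠ s.1) (hs' : (w j).1 ≠ s'.1) : Cov K w (pt y j k s' t) := by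
  unfold pt at h ⊢
  rw [upd_comm hjk, cov_upd_of_ne (by assumption)] at h ⊢
  exact h

theorem Cov.mv_right {s t t' : C × Bool} (h : Cov K w (pt y j k s t))
    (hs : (w k).1 ≠ t.1) (hs' : (w k).1 ≠ t'.1) : Cov K w (pt y j k s t') := by
  unfold pt at h ⊢
  rw [cov_upd_of_ne (by assumption)] at h ⊢
  exact h

theorem mv_swap (hjk : j ≠ k) {s t : C × Bool} : pt y j k s t = pt y k j t s := upd_comm hjk

/-- The letter of a word of a code covering a point whose reflection is covered by a
word with that letter. -/
theorem Code.letter_eq (hA : Code K A) {a r : ι → C × Bool} (ha : a ∈ A) (hr : r ∈ A) {l : ι}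
    (hl : l ∉ K) {s : C × Bool} (has : a l = flp s) (hay : Cov K a (upd y l (flp s)))
    (hry : Cov K r (upd y l s)) : r l = s := by
  by_cases hc : (r l).1 = s.1
  · rcases eq_or_eq_flp hc with e | e
    · exact e
    · exact absurd hry (not_cov_upd hl e)
  · have h1 := (cov_upd_of_ne hc).1 hry
    have h2 : Cov K r (upd y l (flp s)) := (cov_upd_of_ne (s := flp s) hc).2 h1
    have := hA.eq_of_cov ha hr hay h2
    rw [← this, has] at hc
    exact absurd rfl hc

theorem Code.letter_eq_left (hA : Code K A) {a r : ι → C × Bool} (ha : a ∈ A) (hr : r ∈ A)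
    (hj : j ∉ K) (hjk : j ≠ k) {s t : C × Bool} (has : a j = flp s)
    (hay : Cov K a (pt y j k (flp s) t)) (hry : Cov K r (pt y j k s t)) : r j = s := by
  rw [mv_swap hjk] at hay hry
  exact hA.letter_eq ha hr hj has hay hry

theorem Code.letter_eq_right (hA : Code K A) {a r : ι → C × Bool} (ha : a ∈ A) (hr : r ∈ A)
    (hk : k ∉ K) {s t : C × Bool} (has : a k = flp t)
    (hay : Cov K a (pt y j k s (flp t))) (hry : Cov K r (pt y j k s t)) : r k = t :=
  hA.letter_eq ha hr hk has hay hry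

theorem letter_of_cov_mv {s t : C × Bool} (hk : k ∉ K) (h : Cov K w (pt y j k s t))
    (hc : (w k).1 = t.1) : w k = t := by
  rcases eq_or_eq_flp hc with e | e
  · exact e
  · exact absurd h (not_cov_upd hk e)

/-- Words of `V` meeting `w` and having its letters at `j` and `k`. -/
noncomputable def X1 (K : Set ι) (V : Finset (ι → C × Bool)) (w : ι → C × Bool) (j k : ι) :
    Finset (ι → C × Bool) := (meet K V w).filter (fun z => z j = w j ∧ z k = w k)

/-- Words of `V` meeting `w`, having its letter at `k` but not its class at `j`. -/
noncomputable def X2 (K : Set ι) (V : Finset (ι → C × Bool)) (w : ι → C × Bool) (j k : ι) :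
    Finset (ι → C × Bool) := (meet K V w).filter (fun z => z k = w k ∧ (z j).1 ≠ (w j).1)

/-- Words of `V` with prescribed letters at `j` and `k`. -/
noncomputable def Cn (V : Finset (ι → C × Bool)) (j k : ι) (s t : C × Bool) :
    Finset (ι → C × Bool) := V.filter (fun z => z j = s ∧ z k = t)

theorem mem_X1 {z : ι → C × Bool} : z ∈ X1 K V w j k ↔ (z ∈ V ∧ ¬ Dich K z w) ∧ z j = w j ∧
    z k = w k := by simp [X1]
theorem mem_X2 {z : ι → C × Bool} : z ∈ X2 K V w j k ↔ (z ∈ V ∧ ¬ Dich K z w) ∧ z k = w k ∧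
    (z j).1 ≠ (w j).1 := by simp [X2]
theorem mem_Cn {z : ι → C × Bool} {s t : C × Bool} : z ∈ Cn V j k s t ↔ z ∈ V ∧ z j = s ∧
    z k = t := by simp [Cn]

theorem X1_comm : X1 K V w j k = X1 K V w k j := by ext z; rw [mem_X1, mem_X1]; tauto
theorem Cn_comm {s t : C × Bool} : Cn V j k s t = Cn V k j t s := by
  ext z; rw [mem_Cn, mem_Cn]; tauto

theorem St.covers_left (h : St K V W) (hw : w ∈ W) : Covers K V w := fun y hy =>
  (h.cov y).2 ⟨w, hw, hy⟩
theorem St.covers_right (h : St K V W) (hv : v ∈ V) : Covers K W v := h.symm.covers_left hv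

theorem DT.meet_cases (h : St K V W) (D : DT K V W v w j k) {z : ι → C × Bool}
    (hz : z ∈ V) (hzw : ¬ Dich K z w) : z ∈ X1 K V w j k ∨ z ∈ X2 K V w j k ∨
      z ∈ X2 K V w k j := by
  have hne : z ≠ v := by
    rintro rfl; exact hzw ⟨j, D.hj, D.wj⟩
  have cj : z j = w j ∨ (z j).1 ≠ (w j).1 := by
    by_cases e : z j = w j
    · exact Or.inl e
    · exact Or.inr (fst_ne_of_not_dich D.hj hzw e)
  have ck : z k = w k ∨ (z k).1 ≠ (w k).1 := by
    by_cases e : z k = w k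
    · exact Or.inl e
    · exact Or.inr (fst_ne_of_not_dich D.hk hzw e)
  obtain ⟨i, hi, e⟩ := h.cV z hz v D.mv hne
  have key : z j = w j ∨ z k = w k := by
    by_cases hij : i = j
    · subst hij; left; rw [D.wj, e, flp_flp]
    by_cases hik : i = k
    · subst hik; right; rw [D.wk, e, flp_flp]
    exact absurd ⟨i, hi, by rw [← e, D.agr i (by simp [hij, hik, hi])]⟩ hzw
  rw [mem_X1, mem_X2, mem_X2]
  tauto

theorem X1_X2_disjoint : Disjoint (X1 K V w j k) (X2 K V w j k) := by
  rw [Finset.disjoint_left]; intro z h1 h2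
  rw [mem_X1] at h1; rw [mem_X2] at h2
  exact h2.2.2 (by rw [h1.2.1])

theorem X2_X2_disjoint : Disjoint (X2 K V w j k) (X2 K V w k j) := by
  rw [Finset.disjoint_left]; intro z h1 h2
  rw [mem_X2] at h1 h2
  exact h2.2.2 (by rw [h1.2.1])

theorem DT.meet_eq (h : St K V W) (D : DT K V W v w j k) :
    meet K V w = (X1 K V w j k ∪ X2 K V w j k) ∪ X2 K V w k j := by
  ext z
  simp only [Finset.mem_union, mem_meet]
  constructor
  · rintro ⟨h1, h2⟩
    have := D.meet_cases h h1 h2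
    tauto
  · rintro ((h | h) | h)
    exacts [(mem_X1.1 h).1, (mem_X2.1 h).1, (mem_X2.1 h).1]

theorem DT.card_meet (h : St K V W) (D : DT K V W v w j k) :
    (meet K V w).card = (X1 K V w j k).card + (X2 K V w j k).card + (X2 K V w k j).card := by
  rw [D.meet_eq h, Finset.card_union_of_disjoint, Finset.card_union_of_disjoint X1_X2_disjoint]
  rw [Finset.disjoint_union_left]
  exact ⟨by rw [X1_comm]; exact X1_X2_disjoint, X2_X2_disjoint⟩

theorem DT.five_le (h : St K V W) (D : DT K V W v w j k) :
    5 ≤ (X1 K V w j k).card + (X2 K V w j k).card + (X2 K V w k j).card := by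
  rw [← D.card_meet h]
  exact five_le_card_meet h.cV h.tV (h.covers_left D.mw) (fun a ha => h.no a ha w D.mw)

theorem DT.six_le (h : St K V W) (D : DT K V W v w j k) (h1 : (X1 K V w j k).card = 0)
    (h3 : (X2 K V w k j).card = 0) : 6 ≤ (X2 K V w j k).card := by
  have hm := D.card_meet h
  rw [h1, h3] at hm
  have : 6 ≤ (meet K V w).card := by
    refine six_le_card_meet h.cV h.tV (h.covers_left D.mw) D.hj fun a ha => ?_
    rw [Finset.card_eq_zero] at h1 h3
    rw [D.meet_eq h, h1, h3] at ha
    simp only [Finset.empty_union, Finset.union_empty] at ha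
    exact (mem_X2.1 ha).2.2
  omega

theorem DT.four_le_X2 (h : St K V W) (D : DT K V W v w j k) (h2 : 0 < (X2 K V w j k).card) :
    4 ≤ (X2 K V w j k).card := by
  obtain ⟨t, ht⟩ := Finset.card_pos.1 h2
  have ht' := mem_X2.1 ht
  have := four_le_card_cls (h.cV.mono meet_subset) (h.tV.mono meet_subset)
    (fun a ha => (mem_meet.1 ha).2) (h.covers_left D.mw).meet D.hj
    (mem_meet.2 ht'.1) ht'.2.2
  refine this.trans (Finset.card_le_card fun z hz => ?_)
  rw [mem_cls] at hz
  have hne : (z j).1 ≠ (w j).1 := by rw [hz.2]; exact ht'.2.2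
  have hz' := mem_meet.1 hz.1
  rcases D.meet_cases h hz'.1 hz'.2 with e | e | e
  · exact absurd (by rw [(mem_X1.1 e).2.1]) hne
  · exact e
  · exact absurd (by rw [(mem_X2.1 e).2.1]) hne

theorem DT.cov_v (D : DT K V W v w j k) (hy : Cov (insert k (insert j K)) w y) :
    Cov K v (pt y j k (v j) (v k)) := (cov_mv D.hj D.hk D.jk).2 (D.agr.symm.cov hy)
theorem DT.cov_w (D : DT K V W v w j k) (hy : Cov (insert k (insert j K)) w y) :
    Cov K w (pt y j k (w j) (w k)) := (cov_mv D.hj D.hk D.jk).2 hy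
theorem DT.vj (D : DT K V W v w j k) : v j = flp (w j) := by rw [D.wj, flp_flp]
theorem DT.vk (D : DT K V W v w j k) : v k = flp (w k) := by rw [D.wk, flp_flp]
theorem DT.cj (D : DT K V W v w j k) : (v j).1 = (w j).1 := by rw [D.wj]; rfl
theorem DT.ck (D : DT K V W v w j k) : (v k).1 = (w k).1 := by rw [D.wk]; rfl

theorem DT.corner (h : St K V W) (D : DT K V W v w j k)
    (hy : Cov (insert k (insert j K)) w y) {z : ι → C × Bool} (hz : z ∈ V)
    (hzy : Cov K z (pt y j k (w j) (w k))) (hzj : (z j).1 ≠ (w j).1) :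
    ∃ r ∈ W, Cov K r (pt y j k (v j) (w k)) ∧ (r ∈ X2 K W v k j ∨ r ∈ Cn W j k (v j) (w k)) := by
  have h1 : Cov K z (pt y j k (v j) (w k)) := hzy.mv_left D.jk hzj (by rw [D.cj]; exact hzj)
  obtain ⟨r, hr, hry⟩ := (h.cov _).1 ⟨z, hz, h1⟩
  have rj : r j = v j := h.cW.letter_eq_left D.mw hr D.hj D.jk (k := k) (t := w k) D.wj
    (by rw [← D.wj]; exact D.cov_w hy) hry
  refine ⟨r, hr, hry, ?_⟩
  by_cases hc : (r k).1 = (w k).1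
  · right
    exact mem_Cn.2 ⟨hr, rj, letter_of_cov_mv D.hk hry hc⟩
  · left
    have h2 : Cov K r (pt y j k (v j) (v k)) := hry.mv_right hc (by rw [D.ck]; exact hc)
    exact mem_X2.2 ⟨⟨hr, h2.not_dich (D.cov_v hy)⟩, rj, by rw [D.ck]; exact hc⟩

theorem DT.extra (h : St K V W) (D : DT K V W v w j k) (h2 : 0 < (X2 K V w j k).card) :
    0 < (X2 K W v k j).card ∨ 0 < (Cn W j k (v j) (w k)).card := by
  obtain ⟨z, hz⟩ := Finset.card_pos.1 h2
  have hz' := mem_X2.1 hz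
  obtain ⟨y, hzy, hwy⟩ := exists_cov_of_not_dich hz'.1.2
  obtain ⟨r, -, -, e | e⟩ := D.corner h (y := y)
    (hwy.mono ((Set.subset_insert _ _).trans (Set.subset_insert _ _))) hz'.1.1
    (hzy.mv (ne_flp_of_fst_ne hz'.2.2) (by rw [hz'.2.1]; exact (flp_ne _).symm)) hz'.2.2
  · exact Or.inl (Finset.card_pos.2 ⟨r, e⟩)
  · exact Or.inr (Finset.card_pos.2 ⟨r, e⟩)

theorem exists_meet (h : Covers K A u) (hy : Cov K u y) : ∃ a ∈ A, Cov K a y ∧ ¬ Dich K a u := by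
  obtain ⟨a, ha, hay⟩ := h y hy
  exact ⟨a, ha, hay, hay.not_dich hy⟩

theorem DT.two_le (h : St K V W) (D : DT K V W v w j k) (h3 : (X2 K V w k j).card = 0)
    (h3' : (X2 K W v k j).card = 0) :
    2 ≤ (X1 K V w j k).card + (Cn W j k (v j) (w k)).card := by
  rw [Finset.card_eq_zero] at h3 h3'
  have hc : ∀ y, Cov (insert k (insert j K)) w y →
      ∃ p ∈ X1 K V w j k ∪ Cn W j k (v j) (w k), Cov (insert k (insert j K)) p y := by
    intro y hy
    have drop : ∀ {p : ι → C × Bool} {s t}, Cov K p (pt y j k s t) →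
        Cov (insert k (insert j K)) p y := by
      intro p s t hp
      have := hp.mono ((Set.subset_insert j K).trans (Set.subset_insert k _))
      rw [pt, upd_upd_insert, cov_upd_mem (by simp)] at this
      exact this
    obtain ⟨z, hz, hzy, hzd⟩ := exists_meet (h.covers_left D.mw) (D.cov_w hy)
    rcases D.meet_cases h hz hzd with e | e | e
    · exact ⟨z, Finset.mem_union_left _ e, drop hzy⟩
    · obtain ⟨r, hr, hry, e | e⟩ := D.corner h hy hz hzy (mem_X2.1 e).2.2
      · rw [h3'] at e; simp at e
      · exact ⟨r, Finset.mem_union_right _ e, drop hry⟩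
    · rw [h3] at e; simp at e
  by_contra hlt
  have hle := Finset.card_union_le (X1 K V w j k) (Cn W j k (v j) (w k))
  have hne : (X1 K V w j k ∪ Cn W j k (v j) (w k)).Nonempty := Covers.nonempty hc
  have h1 : (X1 K V w j k ∪ Cn W j k (v j) (w k)).card = 1 := by
    have := hne.card_pos
    omega
  obtain ⟨p, hp⟩ := Finset.card_eq_one.1 h1
  rw [hp] at hc
  have hag : Agr (insert k (insert j K)) w p := agr_of_cov_imp (by simpa using hc)
  have hpm : p ∈ X1 K V w j k ∪ Cn W j k (v j) (w k) := by rw [hp]; simp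
  rcases Finset.mem_union.1 hpm with e | e
  · obtain ⟨e1, e2, e3⟩ := mem_X1.1 e
    exact h.no p e1.1 w D.mw (agr_of_insert (agr_of_insert hag e3.symm) e2.symm).symm
  · obtain ⟨e1, e2, e3⟩ := mem_Cn.1 e
    refine h.tW w D.mw p e1 ⟨j, D.hj, by rw [e2, D.vj], agr_of_insert hag e3.symm⟩

theorem DT.four_le_add (h : St K V W) (D : DT K V W v w j k) (h2 : (X2 K V w j k).card = 0)
    (h1' : (X1 K W v j k).card = 0) (h3' : (X2 K W v k j).card = 0)
    (h1 : 0 < (X1 K V w j k).card) :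
    4 ≤ (X1 K V w j k).card + (Cn V j k (w j) (v k)).card := by
  rw [Finset.card_eq_zero] at h2 h1' h3'
  set K₂ : Set ι := insert k (insert j K) with hK₂
  set B := (Cn V j k (w j) (v k)).filter (fun z => ¬ Dich K₂ z w) with hB
  have hBc : B.card ≤ (Cn V j k (w j) (v k)).card := Finset.card_le_card (Finset.filter_subset _ _)
  have memB : ∀ {z}, z ∈ B ↔ (z ∈ V ∧ z j = w j ∧ z k = v k) ∧ ¬ Dich K₂ z w := by
    intro z; rw [hB, Finset.mem_filter, mem_Cn]
  have hK : K ⊆ K₂ := (Set.subset_insert _ _).trans (Set.subset_insert _ _)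
  have drop : ∀ {y} {p : ι → C × Bool} {s t}, Cov K p (pt y j k s t) → Cov K₂ p y := by
    intro y p s t hp
    have := hp.mono hK
    rw [pt, upd_upd_insert, cov_upd_mem (by simp)] at this
    exact this
  have cA : ∀ {A : Finset (ι → C × Bool)} {s t}, A ⊆ V → (∀ a ∈ A, a j = s ∧ a k = t) →
      Code K₂ A ∧ TwinFree K₂ A := fun hA hst =>
    ⟨((h.cV.mono hA).insert_of_const (fun a ha => (hst a ha).1)).insert_of_const
      (fun a ha => (hst a ha).2), ((h.tV.mono hA).insert_of_const
      (fun a ha => (hst a ha).1)).insert_of_const (fun a ha => (hst a ha).2)⟩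
  have c1 := cA (A := X1 K V w j k) (fun a ha => (mem_X1.1 ha).1.1) (fun a ha => (mem_X1.1 ha).2)
  have c2 := cA (A := B) (fun a ha => (memB.1 ha).1.1) (fun a ha => (memB.1 ha).1.2)
  refine le_trans (four_le_card_add (u := w) c1.1 c2.1 c1.2 c2.2 ?_ ?_ ?_ ?_
    (Finset.card_pos.1 h1)) (Nat.add_le_add_left hBc _)
  · exact fun a ha hd => (mem_X1.1 ha).1.2 (hd.mono hK)
  · exact fun a ha => (memB.1 ha).2
  · intro a ha b hb hab
    obtain ⟨a1, a2, a3⟩ := mem_X1.1 ha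
    obtain ⟨⟨b1, b2, b3⟩, -⟩ := memB.1 hb
    refine h.tV a a1.1 b b1 ⟨k, D.hk, by rw [b3, a3, D.vk], ?_⟩
    rw [hK₂, Set.insert_comm] at hab
    exact agr_of_insert hab (by rw [a2, b2])
  · intro y hy
    constructor
    · rintro ⟨a, ha, hay⟩
      obtain ⟨a1, a2, a3⟩ := mem_X1.1 ha
      have hay' : Cov K a (pt y j k (w j) (w k)) := by
        rw [← a2, ← a3]; exact (cov_mv D.hj D.hk D.jk).2 hay
      obtain ⟨r, hr, hry, hrd⟩ := exists_meet (h.covers_right D.mv) (D.cov_v hy)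
      have hr2 : r ∈ X2 K W v j k := by
        rcases D.symm.meet_cases h.symm hr hrd with e | e | e
        · rw [h1'] at e; simp at e
        · exact e
        · rw [h3'] at e; simp at e
      have hrj := (mem_X2.1 hr2).2.2
      have hry' : Cov K r (pt y j k (w j) (v k)) := hry.mv_left D.jk hrj (by rw [← D.cj]; exact hrj)
      obtain ⟨q, hq, hqy⟩ := (h.cov _).2 ⟨r, hr, hry'⟩
      have qj : q j = w j := h.cV.letter_eq_left D.mv hq D.hj D.jk (k := k) (t := v k) D.vj
        (by rw [← D.vj]; exact D.cov_v hy) hqy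
      have qk : q k = v k := h.cV.letter_eq_right a1.1 hq D.hk (a3.trans D.wk)
        (by rw [← D.wk]; exact hay') hqy
      exact ⟨q, memB.2 ⟨⟨hq, qj, qk⟩, (drop hqy).not_dich hy⟩, drop hqy⟩
    · rintro ⟨q, hq, hqy⟩
      obtain ⟨⟨q1, q2, q3⟩, -⟩ := memB.1 hq
      have hqy' : Cov K q (pt y j k (w j) (v k)) := by
        rw [← q2, ← q3]; exact (cov_mv D.hj D.hk D.jk).2 hqy
      obtain ⟨x, hx, hxy, hxd⟩ := exists_meet (h.covers_left D.mw) (D.cov_w hy)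
      have xk : x k = w k := h.cV.letter_eq_right q1 hx D.hk (q3.trans D.vk)
        (by rw [← D.vk]; exact hqy') hxy
      refine ⟨x, ?_, drop hxy⟩
      rcases D.meet_cases h hx hxd with e | e | e
      · exact e
      · rw [h2] at e; simp at e
      · exact absurd (by rw [xk]) (mem_X2.1 e).2.2

theorem DT.hb_ge (D : DT K V W v w j k) :
    (X1 K V w j k).card + (X2 K V w k j).card + (X1 K W v j k).card + (X2 K W v k j).card +
      (Cn W j k (v j) (w k)).card + (Cn V j k (w j) (v k)).card ≤ hb V W j (v j) := by
  have aux : ∀ (V : Finset (ι → C × Bool)) (w : ι → C × Bool) (t : C × Bool), t = flp (w k) →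
      (X1 K V w j k).card + (X2 K V w k j).card + (Cn V j k (w j) t).card ≤
        (fib V j (w j)).card := by
    intro V w t ht
    have d1 : Disjoint (X1 K V w j k) (X2 K V w k j) := by rw [X1_comm]; exact X1_X2_disjoint
    have d2 : Disjoint (X1 K V w j k ∪ X2 K V w k j) (Cn V j k (w j) t) := by
      rw [Finset.disjoint_left]
      intro z hz hz'
      have e := (mem_Cn.1 hz').2.2
      rcases Finset.mem_union.1 hz with hz | hz
      · have := (mem_X1.1 hz).2.2
        rw [e, ht] at this; exact flp_ne _ this
      · exact (mem_X2.1 hz).2.2 (by rw [e, ht]; rfl)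
    rw [← Finset.card_union_of_disjoint d1, ← Finset.card_union_of_disjoint d2]
    refine Finset.card_le_card fun z hz => ?_
    simp only [Finset.mem_union] at hz
    rw [mem_fib]
    rcases hz with (hz | hz) | hz
    · exact ⟨(mem_X1.1 hz).1.1, (mem_X1.1 hz).2.1⟩
    · exact ⟨(mem_X2.1 hz).1.1, (mem_X2.1 hz).2.1⟩
    · exact ⟨(mem_Cn.1 hz).1, (mem_Cn.1 hz).2.1⟩
  have e1 := aux V w (v k) D.vk
  have e2 := aux W v (w k) D.wk
  unfold hb
  rw [← D.wj]
  omega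

theorem DT.four_le_hb (h : St K V W) (D : DT K V W v w j k) : 4 ≤ hb V W j (v j) := by
  have h1 := D.hb_ge
  have h2 := D.swap.four_le_X2 h
  have h3 := D.swap.symm.four_le_X2 h.symm
  by_cases e : (X2 K V w k j).card = 0
  · by_cases e' : (X2 K W v k j).card = 0
    · have := D.two_le h e e'
      have := D.symm.two_le h.symm e' e
      omega
    · omega
  · omega

/-- Nonempty blocks have at least eight words. -/
theorem St.four_le_hb [Finite ι] (h : St K V W) (hj : j ∉ K) (ht : t ∈ V ∪ W) :
    4 ≤ hb V W j (t j) := by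
  have htb : t ∈ blk V W j (t j).1 := mem_cls_self ht
  have hcard := h.card_blk hj (t j)
  by_cases hD : ∃ v w k, DT K V W v w j k ∧ (v j).1 = (t j).1
  · obtain ⟨v, w, k, D, e⟩ := hD
    have h4 := D.four_le_hb h
    have := h.card_blk hj (v j)
    rw [e] at this
    omega
  · push Not at hD
    obtain ⟨k, hk, x, hx, hxt⟩ := (h.blk_rel hj (t j).1).exists_ne' (sgn_sg.dsgn j)
      (h.blk_red hj (t j).1) htb
    have hn : ∀ d, NoDT K V W j k (t j).1 d := fun d v w D e => absurd e (hD v w k D)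
    have h1 := h.four_le_cls hj hk (hn _) hx rfl
    have h2 := h.four_le_cls hj hk (hn _) htb rfl
    have := cls_card_le_of_ne (U := blk V W j (t j).1) (l := k) hxt
    omega

end

section

variable {K : Set ι} {w v u t t₁ t₂ : ι → C × Bool} {y : ι → C → Bool}
  {A B U V W : Finset (ι → C × Bool)} {σ τ : (ι → C × Bool) → ℤ} {j k l : ι}

theorem Covers.drop (h : Covers K A u) (hl : l ∉ K) {s : C × Bool} (hs : (u l).1 ≠ s.1)
    (hB : ∀ a ∈ A, a l ≠ flp s → a ∈ B) : Covers (insert l K) B u := by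
  intro y hy
  have h1 : Cov K u (upd (upd y l (u l)) l s) :=
    (cov_upd_of_ne hs).2 ((cov_upd_self hl rfl).2 hy)
  obtain ⟨a, ha, hay⟩ := h _ h1
  refine ⟨a, hB a ha fun e => not_cov_upd hl e hay, ?_⟩
  have h2 := cov_insert_of_cov (l := l) hay
  rwa [upd_upd_insert, upd_upd_insert] at h2

theorem Covers.agr (h : Covers K A u) (ht : ∀ a ∈ A, a = t) : Agr K u t := by
  refine agr_of_cov_imp fun y hy => ?_
  obtain ⟨a, ha, hay⟩ := h y hy
  rwa [ht a ha] at hay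

/-- Two dichotomous words covering `u`. -/
theorem Covers.pair {b : ι → C × Bool} (h : Covers K {t, b} u) (hd : Dich K t b)
    (ht : ¬ Dich K t u) (hb : ¬ Dich K b u) :
    ∃ m ∉ K, b m = flp (t m) ∧ (u m).1 ≠ (t m).1 ∧ Agr (insert m K) u t ∧
      Agr (insert m K) u b := by
  obtain ⟨m, hm, e⟩ := hd
  have hne := fst_ne_of_flp hm ht hb e
  refine ⟨m, hm, e, hne, ?_, ?_⟩
  · refine (h.drop (B := {t}) hm hne fun a ha hna => ?_).agr (by simp)
    simp only [Finset.mem_insert, Finset.mem_singleton] at ha ⊢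
    rcases ha with rfl | rfl
    · rfl
    · exact absurd e hna
  · have hne' : (u m).1 ≠ (b m).1 := by rw [e]; exact hne
    refine (h.drop (B := {b}) hm hne' fun a ha hna => ?_).agr (by simp)
    simp only [Finset.mem_insert, Finset.mem_singleton] at ha ⊢
    rcases ha with rfl | rfl
    · exact absurd (by rw [e, flp_flp]) hna
    · rfl

theorem Covers.triple_aux {b : ι → C × Bool} (h : Covers K {b, t₁, t₂} u)
    (h2 : Dich K b t₂) (hb : ¬ Dich K b u)
    (m2 : ¬ Dich K t₂ u) (hl : l ∉ K) (e : t₂ l = flp (t₁ l)) (hne : (u l).1 ≠ (t₁ l).1)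
    (eb : b l = t₂ l) : ∃ l₁ ∉ K, ∃ l₂ ∉ K, l₁ ≠ l₂ ∧ (u l₁).1 ≠ (b l₁).1 ∧
      (u l₂).1 ≠ (b l₂).1 ∧ Agr (insert l₂ (insert l₁ K)) u b ∧
      Agr (insert l₁ K) u t₁ ∧ t₁ l₁ = flp (b l₁) ∧
      Agr (insert l₂ (insert l₁ K)) u t₂ ∧ t₂ l₁ = b l₁ ∧ t₂ l₂ = flp (b l₂) := by
  have a1 : Agr (insert l K) u t₁ := by
    refine (h.drop (B := {t₁}) hl hne fun a ha hna => ?_).agr (by simp)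
    simp only [Finset.mem_insert, Finset.mem_singleton] at ha ⊢
    rcases ha with rfl | rfl | rfl
    · exact absurd (eb.trans e) hna
    · rfl
    · exact absurd e hna
  have hne2 : (u l).1 ≠ (t₂ l).1 := by rw [e]; exact hne
  have hc : Covers (insert l K) {b, t₂} u := by
    refine h.drop hl hne2 fun a ha hna => ?_
    simp only [Finset.mem_insert, Finset.mem_singleton] at ha ⊢
    rcases ha with rfl | rfl | rfl
    · exact Or.inl rfl
    · exact absurd (by rw [e, flp_flp]) hna
    · exact Or.inr rfl
  have hd : Dich (insert l K) b t₂ := by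
    obtain ⟨i, hi, hie⟩ := h2
    refine ⟨i, ?_, hie⟩
    simp only [Set.mem_insert_iff, not_or]
    refine ⟨?_, hi⟩
    rintro rfl
    rw [eb] at hie
    exact flp_ne _ hie.symm
  obtain ⟨m, hm, em, hnm, am, am'⟩ := hc.pair hd (not_dich_insert hb) (not_dich_insert m2)
  have hml : m ≠ l := fun e => hm (by simp [e])
  refine ⟨l, hl, m, fun hk => hm (by simp [hk]), hml.symm, by rw [eb]; exact hne2, hnm, am, a1,
    by rw [eb, e, flp_flp], am', eb.symm, em⟩

/-- Three pairwise dichotomous words covering `u`, the last two not forming a twin pair. -/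
theorem Covers.triple {b : ι → C × Bool} (h : Covers K {b, t₁, t₂} u) (h1 : Dich K b t₁)
    (h2 : Dich K b t₂) (h12 : Dich K t₁ t₂) (hb : ¬ Dich K b u) (m1 : ¬ Dich K t₁ u)
    (m2 : ¬ Dich K t₂ u) (ht : ¬ Twin K t₁ t₂) :
    ∃ l₁ ∉ K, ∃ l₂ ∉ K, l₁ ≠ l₂ ∧ (u l₁).1 ≠ (b l₁).1 ∧
      (u l₂).1 ≠ (b l₂).1 ∧ Agr (insert l₂ (insert l₁ K)) u b ∧
      ∃ t t', ((t = t₁ ∧ t' = t₂) ∨ (t = t₂ ∧ t' = t₁)) ∧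
      Agr (insert l₁ K) u t ∧ t l₁ = flp (b l₁) ∧
      Agr (insert l₂ (insert l₁ K)) u t' ∧ t' l₁ = b l₁ ∧ t' l₂ = flp (b l₂) := by
  obtain ⟨l, hl, e⟩ := h12
  have hne := fst_ne_of_flp hl m1 m2 e
  by_cases c2 : b l = t₂ l
  · obtain ⟨l₁, a1, l₂, a2, a3, a4, a5, a6, a7⟩ := h.triple_aux h2 hb m2 hl e hne c2
    exact ⟨l₁, a1, l₂, a2, a3, a4, a5, a6, t₁, t₂, Or.inl ⟨rfl, rfl⟩, a7⟩
  have e' : t₁ l = flp (t₂ l) := by rw [e, flp_flp]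
  have hne' : (u l).1 ≠ (t₂ l).1 := by rw [e]; exact hne
  by_cases c1 : b l = t₁ l
  · have h' : Covers K {b, t₂, t₁} u := by
      rwa [show ({b, t₂, t₁} : Finset (ι → C × Bool)) = {b, t₁, t₂} by
        ext; simp only [Finset.mem_insert, Finset.mem_singleton]; tauto]
    obtain ⟨l₁, a1, l₂, a2, a3, a4, a5, a6, a7⟩ := h'.triple_aux h1 hb m1 hl e' hne' c1
    exact ⟨l₁, a1, l₂, a2, a3, a4, a5, a6, t₂, t₁, Or.inr ⟨rfl, rfl⟩, a7⟩
  exfalso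
  have push : ∀ {z : ι → C × Bool}, b l ≠ z l → b l ≠ flp (z l) → Dich K b z →
      Dich (insert l K) b z := by
    rintro z h1 h2 ⟨i, hi, hie⟩
    refine ⟨i, ?_, hie⟩
    simp only [Set.mem_insert_iff, not_or]
    refine ⟨?_, hi⟩
    rintro rfl
    rw [hie, flp_flp] at h2
    exact h2 rfl
  have H1 : Covers (insert l K) {b, t₁} u := by
    refine h.drop hl hne fun a ha hna => ?_
    simp only [Finset.mem_insert, Finset.mem_singleton] at ha ⊢
    rcases ha with rfl | rfl | rfl
    · exact Or.inl rfl
    · exact Or.inr rfl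
    · exact absurd e hna
  have H2 : Covers (insert l K) {b, t₂} u := by
    refine h.drop hl hne' fun a ha hna => ?_
    simp only [Finset.mem_insert, Finset.mem_singleton] at ha ⊢
    rcases ha with rfl | rfl | rfl
    · exact Or.inl rfl
    · exact absurd e' hna
    · exact Or.inr rfl
  obtain ⟨m, hm, em, hnm, am, am'⟩ := H1.pair (push c1 (by rwa [← e]) h1)
    (not_dich_insert hb) (not_dich_insert m1)
  obtain ⟨m', hm', em', hnm', an, an'⟩ := H2.pair (push c2 (by rwa [← e']) h2)
    (not_dich_insert hb) (not_dich_insert m2)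
  have hmm : m = m' := by
    by_contra hne
    have : m ∉ insert m' (insert l K) := by simp only [Set.mem_insert_iff, not_or]; exact
      ⟨hne, by simpa using hm⟩
    rw [an m this] at hnm
    exact hnm rfl
  subst hmm
  refine ht ⟨l, hl, e, fun i hi => ?_⟩
  by_cases him : i = m
  · rw [him, em, em']
  · rw [← am' i (by simp only [Set.mem_insert_iff, not_or]; exact ⟨him, by simpa using hi⟩),
      ← an' i (by simp only [Set.mem_insert_iff, not_or]; exact ⟨him, by simpa using hi⟩)]

/-- A structure with at most twelve words on each side, of minimal size. -/
structure MSt (K : Set ι) (V W : Finset (ι → C × Bool)) : Prop extends St K V W where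
  le : V.card ≤ 12
  min : ∀ (K' : Set ι) (V' W' : Finset (ι → C × Bool)), St K' V' W' → V'.Nonempty →
    V.card ≤ V'.card

theorem MSt.symm [Finite ι] (h : MSt K V W) : MSt K W V :=
  ⟨h.toSt.symm, by rw [← h.toSt.card_eq]; exact h.le, by rw [← h.toSt.card_eq]; exact h.min⟩

theorem cov_insert_fib {s : C × Bool} (hl : l ∉ K) : (∃ a ∈ fib A l s, Cov (insert l K) a y) ↔
    ∃ a ∈ fib A l s, Cov K a (upd y l s) := by
  constructor
  · rintro ⟨a, ha, hay⟩; exact ⟨a, ha, (cov_upd_self hl (mem_fib.1 ha).2).2 hay⟩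
  · rintro ⟨a, ha, hay⟩; exact ⟨a, ha, (cov_upd_self hl (mem_fib.1 ha).2).1 hay⟩

theorem St.fib_of_const (h : St K V W) (hl : l ∉ K) {s : C × Bool}
    (hc : ∀ t ∈ V ∪ W, (t l).1 = s.1) : St (insert l K) (fib V l s) (fib W l s) := by
  refine ⟨h.cV.fib l s, h.cW.fib l s, h.tV.fib l s, h.tW.fib l s, ?_, ?_⟩
  · intro v hv w hw e
    rw [mem_fib] at hv hw
    exact h.no v hv.1 w hw.1 (agr_of_insert e (hv.2.trans hw.2.symm))
  · intro y
    rw [cov_insert_fib hl, cov_insert_fib hl]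
    have aux : ∀ A : Finset (ι → C × Bool), (∀ t ∈ A, (t l).1 = s.1) →
        ((∃ a ∈ Polybox.fib A l s, Cov K a (upd y l s)) ↔ ∃ a ∈ A, Cov K a (upd y l s)) := by
      intro A hA
      constructor
      · rintro ⟨a, ha, hay⟩; exact ⟨a, fib_subset ha, hay⟩
      · rintro ⟨a, ha, hay⟩
        refine ⟨a, mem_fib.2 ⟨ha, ?_⟩, hay⟩
        rcases eq_or_eq_flp (hA a ha) with e | e
        · exact e
        · exact absurd hay (not_cov_upd hl e)
    rw [aux V fun t ht => hc t (Finset.mem_union_left _ ht),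
      aux W fun t ht => hc t (Finset.mem_union_right _ ht)]
    exact h.cov _

theorem st_fib_flp (cA : Code K A) (tA : TwinFree K A) (hl : l ∉ K) {s : C × Bool}
    (h : ∀ y, (∃ a ∈ fib A l s, Cov (insert l K) a y) ↔
      ∃ a ∈ fib A l (flp s), Cov (insert l K) a y) :
    St (insert l K) (fib A l s) (fib A l (flp s)) :=
  ⟨cA.fib l s, cA.fib l _, tA.fib l s, tA.fib l _, fib_no_agr tA hl s, h⟩

/-- In a minimal structure a coordinate with a single class has a single letter. -/
theorem MSt.letter_const [Finite ι] (h : MSt K V W) (hl : l ∉ K) {s : C × Bool}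
    (hc : ∀ t ∈ V ∪ W, (t l).1 = s.1) (hs : ∃ t ∈ V ∪ W, t l = s) : ∀ t ∈ V ∪ W, t l = s := by
  have key : ∀ {V W : Finset (ι → C × Bool)}, MSt K V W → (∀ t ∈ V ∪ W, (t l).1 = s.1) →
      (∃ t ∈ V, t l = s) → ∀ t ∈ V ∪ W, t l = s := by
    rintro V W h hc ⟨t₀, ht₀, e₀⟩
    have hst := h.toSt.fib_of_const hl hc
    have hne : (fib V l s).Nonempty := ⟨t₀, mem_fib.2 ⟨ht₀, e₀⟩⟩
    have h1 := h.min _ _ _ hst hne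
    have hV : fib V l s = V := Finset.eq_of_subset_of_card_le fib_subset h1
    have hW : fib W l s = W := by
      refine Finset.eq_of_subset_of_card_le fib_subset ?_
      rw [← hst.card_eq, ← h.toSt.card_eq]
      exact h1
    intro t ht
    rcases Finset.mem_union.1 ht with ht | ht
    · rw [← hV] at ht; exact (mem_fib.1 ht).2
    · rw [← hW] at ht; exact (mem_fib.1 ht).2
  obtain ⟨t, ht, e⟩ := hs
  rcases Finset.mem_union.1 ht with ht | ht
  · exact key h hc ⟨t, ht, e⟩
  · rw [Finset.union_comm] at hc ⊢
    exact key h.symm hc ⟨t, ht, e⟩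

theorem MSt.hb_le_eight [Finite ι] (h : MSt K V W) (hl : l ∉ K) (h1 : v ∈ V ∪ W)
    (h2 : w ∈ V ∪ W) (hne : v l ≠ w l) (s : C × Bool) : hb V W l s ≤ 8 := by
  by_contra hlt
  have hc : ∀ t ∈ V ∪ W, (t l).1 = s.1 := by
    intro t ht
    by_contra hn
    have a1 := h.toSt.hb_add_le hl hn
    have a2 := h.toSt.four_le_hb hl ht
    have := h.le
    omega
  exact hne ((h.letter_const hl (fun t ht => (hc t ht).trans (hc w h2).symm) ⟨w, h2, rfl⟩ v h1))

theorem DT.bounds [Finite ι] (h : MSt K V W) (D : DT K V W v w j k) :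
    6 ≤ hb V W j (v j) ∧ 6 ≤ hb V W k (v k) ∧ (hb V W j (v j) = 6 → hb V W k (v k) = 6 →
      ((X2 K V w j k).card = 0 ∧ (((X1 K V w j k).card = 0 ∧ (X2 K V w k j).card = 6) ∨
        ((X1 K V w j k).card = 1 ∧ (X2 K V w k j).card = 4 ∧
          (Cn V j k (w j) (v k)).card = 0))) ∨
      ((X2 K V w k j).card = 0 ∧ (((X1 K V w k j).card = 0 ∧ (X2 K V w j k).card = 6) ∨
        ((X1 K V w k j).card = 1 ∧ (X2 K V w j k).card = 4 ∧
          (Cn V k j (w k) (v j)).card = 0)))) := by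
  have hS := h.toSt
  have hv : v ∈ V ∪ W := Finset.mem_union_left _ D.mv
  have hw : w ∈ V ∪ W := Finset.mem_union_right _ D.mw
  have ej := h.hb_le_eight D.hj hv hw (by rw [D.wj]; exact (flp_ne _).symm) (v j)
  have ek := h.hb_le_eight D.hk hv hw (by rw [D.wk]; exact (flp_ne _).symm) (v k)
  have gj := D.hb_ge
  have gk := D.swap.hb_ge
  have a1 := D.five_le hS
  have a2 := D.symm.five_le hS.symm
  have b1 := D.six_le hS
  have b2 := D.swap.six_le hS
  have b3 := D.symm.six_le hS.symm
  have b4 := D.swap.symm.six_le hS.symm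
  have c1 := D.four_le_X2 hS
  have c2 := D.swap.four_le_X2 hS
  have c3 := D.symm.four_le_X2 hS.symm
  have c4 := D.swap.symm.four_le_X2 hS.symm
  have d1 := D.extra hS
  have d2 := D.swap.extra hS
  have d3 := D.symm.extra hS.symm
  have d4 := D.swap.symm.extra hS.symm
  have f1 := D.four_le_add hS
  have f2 := D.swap.four_le_add hS
  have f3 := D.symm.four_le_add hS.symm
  have f4 := D.swap.symm.four_le_add hS.symm
  rw [X1_comm (j := k) (k := j) (V := V) (w := w), X1_comm (j := k) (k := j) (V := W) (w := v)] at *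
  rw [Cn_comm (j := k) (k := j) (V := W) (s := v k) (t := w j)] at *
  rw [Cn_comm (j := k) (k := j) (V := V) (s := w k) (t := v j)] at *
  generalize hb V W j (v j) = ej at *
  generalize hb V W k (v k) = ek at *
  generalize (X1 K V w j k).card = x1 at *
  generalize (X2 K V w j k).card = x2 at *
  generalize (X2 K V w k j).card = x3 at *
  generalize (X1 K W v j k).card = y1 at *
  generalize (X2 K W v j k).card = y2 at *
  generalize (X2 K W v k j).card = y3 at *
  generalize (Cn W j k (v j) (w k)).card = r1 at *
  generalize (Cn V j k (w j) (v k)).card = q1 at *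
  generalize (Cn W j k (w j) (v k)).card = w1 at *
  generalize (Cn V j k (v j) (w k)).card = v1 at *
  clear hS hv hw h D
  have c1' : x2 = 0 ∨ 4 ≤ x2 ∧ (0 < y3 ∨ 0 < r1) := by clear a1 a2 b1 b2 b3 b4 f1 f2 f3 f4; omega
  have c2' : x3 = 0 ∨ 4 ≤ x3 ∧ (0 < y2 ∨ 0 < w1) := by clear a1 a2 b1 b2 b3 b4 f1 f2 f3 f4; omega
  have c3' : y2 = 0 ∨ 4 ≤ y2 ∧ (0 < x3 ∨ 0 < q1) := by clear a1 a2 b1 b2 b3 b4 f1 f2 f3 f4; omega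
  have c4' : y3 = 0 ∨ 4 ≤ y3 ∧ (0 < x2 ∨ 0 < v1) := by clear a1 a2 b1 b2 b3 b4 f1 f2 f3 f4; omega
  clear c1 c2 c3 c4 d1 d2 d3 d4
  rcases c1' with rfl | ⟨c1, d1⟩ <;> rcases c2' with rfl | ⟨c2, d2⟩ <;>
  rcases c3' with rfl | ⟨c3, d3⟩ <;> rcases c4' with rfl | ⟨c4, d4⟩ <;>
  omega

end

section

variable {K : Set ι} {w v u t t₁ t₂ : ι → C × Bool} {y : ι → C → Bool}
  {A B U V W : Finset (ι → C × Bool)} {σ τ : (ι → C × Bool) → ℤ} {j k l : ι}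

theorem St.cross (h : St K V W) (hj : j ∉ K) {s : C × Bool} (hR : fib W j s = ∅)
    {p r : ι → C × Bool} (hp : p ∈ fib V j s) (hr : r ∈ fib W j (flp s)) :
    Dich (insert j K) p r := by
  by_contra hd
  obtain ⟨y, hpy, hry⟩ := exists_cov_of_not_dich hd
  rw [mem_fib] at hp hr
  obtain ⟨z, hz, hzy⟩ := (h.cov (upd y j s)).1 ⟨p, hp.1, (cov_upd_self hj hp.2).2 hpy⟩
  have := h.cW.letter_eq hr.1 hz hj hr.2 ((cov_upd_self hj hr.2).2 hry) hzy
  have h2 : z ∈ fib W j s := mem_fib.2 ⟨hz, this⟩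
  rw [hR] at h2
  simp at h2

theorem cov_of_upd {s : C × Bool} (h : Cov K w (upd y l s)) : Cov (insert l K) w y :=
  upd_upd_insert.1 (cov_insert_of_cov h)

theorem class_of_cov_upd (hl : l ∉ K) {s : C × Bool} (h : Cov K w (upd y l s)) (hne : w l ≠ s) :
    (w l).1 ≠ s.1 := by
  intro e
  rcases eq_or_eq_flp e with e | e
  · exact hne e
  · exact not_cov_upd hl e h

theorem St.trace_block (h : St K V W) (hj : j ∉ K) {s : C × Bool} (hR : fib W j s = ∅)
    (y : ι → C → Bool) :
    (∃ p ∈ fib V j s ∪ fib W j (flp s), Cov (insert j K) p y) ↔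
      ∃ q ∈ fib V j (flp s), Cov (insert j K) q y := by
  have nR : ∀ z ∈ W, z j ≠ s := by
    intro z hz e
    have h2 : z ∈ fib W j s := mem_fib.2 ⟨hz, e⟩
    rw [hR] at h2
    simp at h2
  constructor
  · rintro ⟨p, hp, hpy⟩
    rcases Finset.mem_union.1 hp with hp | hp
    · rw [mem_fib] at hp
      have hpy' := (cov_upd_self hj hp.2).2 hpy
      obtain ⟨r, hr, hry⟩ := (h.cov _).1 ⟨p, hp.1, hpy'⟩
      have hc := class_of_cov_upd hj hry (nR r hr)
      have hry' : Cov K r (upd y j (flp s)) := (cov_upd_of_ne (s := flp s) hc).2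
        ((cov_upd_of_ne hc).1 hry)
      obtain ⟨q, hq, hqy⟩ := (h.cov _).2 ⟨r, hr, hry'⟩
      refine ⟨q, mem_fib.2 ⟨hq, ?_⟩, cov_of_upd hqy⟩
      exact h.cV.letter_eq hp.1 hq hj (by rw [flp_flp]; exact hp.2) (by rwa [flp_flp]) hqy
    · rw [mem_fib] at hp
      have hpy' := (cov_upd_self hj hp.2).2 hpy
      obtain ⟨q, hq, hqy⟩ := (h.cov _).2 ⟨p, hp.1, hpy'⟩
      refine ⟨q, mem_fib.2 ⟨hq, ?_⟩, cov_of_upd hqy⟩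
      by_contra hne
      have hc := class_of_cov_upd hj hqy hne
      have hqy' : Cov K q (upd y j s) := (cov_upd_of_ne (s := s) hc).2
        ((cov_upd_of_ne (s := flp s) hc).1 hqy)
      obtain ⟨r, hr, hry⟩ := (h.cov _).1 ⟨q, hq, hqy'⟩
      exact nR r hr (h.cW.letter_eq hp.1 hr hj hp.2 hpy' hry)
  · rintro ⟨q, hq, hqy⟩
    rw [mem_fib] at hq
    have hqy' := (cov_upd_self hj hq.2).2 hqy
    obtain ⟨r, hr, hry⟩ := (h.cov _).1 ⟨q, hq.1, hqy'⟩
    by_cases e : r j = flp s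
    · exact ⟨r, Finset.mem_union_right _ (mem_fib.2 ⟨hr, e⟩), cov_of_upd hry⟩
    · have hc := class_of_cov_upd hj hry e
      have hry' : Cov K r (upd y j s) := (cov_upd_of_ne (s := s) hc).2
        ((cov_upd_of_ne (s := flp s) hc).1 hry)
      obtain ⟨p, hp, hpy⟩ := (h.cov _).2 ⟨r, hr, hry'⟩
      refine ⟨p, Finset.mem_union_left _ (mem_fib.2 ⟨hp, ?_⟩), cov_of_upd hpy⟩
      exact h.cV.letter_eq hq.1 hp hj hq.2 hqy' hpy

theorem MSt.not_six [Finite ι] (h : MSt K V W) (D : DT K V W v w j k)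
    (h1 : (X1 K V w j k).card = 0) (h2 : (X2 K V w j k).card = 0)
    (h3 : (X2 K V w k j).card = 6) (e6 : hb V W j (v j) = 6) : False := by
  have hS := h.toSt
  set Q := X2 K V w k j with hQ
  have memQ : ∀ {z}, z ∈ Q ↔ (z ∈ V ∧ ¬ Dich K z w) ∧ z j = w j ∧ (z k).1 ≠ (w k).1 :=
    mem_X2
  have hQm : meet K V w = Q := by
    rw [D.meet_eq hS, Finset.card_eq_zero.1 h1, Finset.card_eq_zero.1 h2]; simp [hQ]
  have hQV : Q ⊆ V := fun z hz => (memQ.1 hz).1.1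
  have hsub : Q ⊆ fib V j (w j) := fun z hz => mem_fib.2 ⟨(memQ.1 hz).1.1, (memQ.1 hz).2.1⟩
  have hcard := Finset.card_le_card hsub
  unfold hb at e6
  rw [← D.wj] at e6
  have hR : fib W j (v j) = ∅ := Finset.card_eq_zero.1 (by omega)
  have hfib : fib V j (w j) = Q := (Finset.eq_of_subset_of_card_le hsub (by omega)).symm
  have htr := hS.trace_block D.hj hR
  rw [← D.wj, hfib] at htr
  have hcov : Covers K Q w := by rw [← hQm]; exact (hS.covers_left D.mw).meet
  have cQ : Code (insert j K) Q := (hS.cV.mono hQV).insert_of_const fun z hz => (memQ.1 hz).2.1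
  have tQ : TwinFree (insert j K) Q :=
    (hS.tV.mono hQV).insert_of_const fun z hz => (memQ.1 hz).2.1
  -- one letter at `k` accounts for five of the six words
  obtain ⟨s, t₀, hs5, ht₀, hag⟩ : ∃ s t₀, (fib Q k s).card = 5 ∧ t₀ ∈ fib Q k (flp s) ∧
      Agr (insert k (insert j K)) t₀ w := by
    obtain ⟨z, hz⟩ := Finset.card_pos.1 (show 0 < Q.card by omega)
    have hk' : k ∉ insert j K := by simp [D.jk.symm, D.hk]
    have hcl : ∀ z ∈ Q, 4 ≤ (cls Q k (z k).1).card := fun z hz =>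
      four_le_card_cls (hS.cV.mono hQV) (hS.tV.mono hQV) (fun a ha => (memQ.1 ha).1.2) hcov D.hk
        hz (memQ.1 hz).2.2
    have hone : ∀ z' ∈ Q, (z' k).1 = (z k).1 := by
      intro z' hz'
      by_contra hne
      have := cls_card_le_of_ne (U := Q) (l := k) hne
      have := hcl z hz
      have := hcl z' hz'
      omega
    have hsum : (fib Q k (z k)).card + (fib Q k (flp (z k))).card = 6 := by
      rw [← card_cls, ← h3]
      congr 1
      ext x
      rw [mem_cls]
      exact ⟨fun hx => hx.1, fun hx => ⟨hx, hone x hx⟩⟩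
    have hcj : Covers (insert j K) Q w := by
      intro y hy
      obtain ⟨a, ha, hay⟩ := hcov (upd y j (w j)) ((cov_upd_self D.hj rfl).2 hy)
      exact ⟨a, ha, cov_of_upd hay⟩
    have hdr : ∀ r : C × Bool, r.1 = (z k).1 → Covers (insert k (insert j K)) (fib Q k r) w := by
      intro r hr
      refine hcj.drop hk' (by rw [hr]; exact (memQ.1 hz).2.2.symm) fun a ha hna => ?_
      rcases eq_or_eq_flp ((hone a ha).trans hr.symm) with e | e
      · exact mem_fib.2 ⟨ha, e⟩
      · exact absurd e hna
    have L := fun r (hr : r.1 = (z k).1) (h4 : (fib Q k r).card ≤ 4) =>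
      exists_agr_of_card_le _ _ _ rfl h4 (cQ.fib k r) (tQ.fib k r) (hdr r hr)
    have p1 := (hdr (z k) rfl).nonempty.card_pos
    have p2 := (hdr (flp (z k)) rfl).nonempty.card_pos
    by_cases c1 : (fib Q k (z k)).card ≤ 4
    · obtain ⟨a, ha, haw⟩ := L _ rfl c1
      by_cases c2 : (fib Q k (flp (z k))).card ≤ 4
      · obtain ⟨b, hb, hbw⟩ := L (flp (z k)) rfl c2
        exact absurd (haw.trans hbw.symm) (fib_no_agr tQ hk' _ a ha b hb)
      · exact ⟨flp (z k), a, by omega, by rwa [flp_flp], haw⟩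
    · obtain ⟨b, hb, hbw⟩ := L (flp (z k)) rfl (by omega)
      exact ⟨z k, b, by omega, hb, hbw⟩
  have memF : ∀ {z}, z ∈ fib Q k s ↔ z ∈ Q ∧ z k = s := mem_fib
  -- all words of the other two parts meet the five words
  have hmeet : ∀ p ∈ fib V j (v j) ∪ fib W j (w j), ∀ t ∈ fib Q k s, ¬ Dich (insert j K) t p := by
    intro p hp t ht
    have htQ := memQ.1 (memF.1 ht).1
    by_cases pv : p = v
    · subst pv
      rintro ⟨i, hi, e⟩
      by_cases hik : i = k
      · subst hik
        refine htQ.2.2 ?_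
        rw [← D.ck, e]; rfl
      · refine htQ.1.2 ⟨i, fun hk => hi (by simp [hk]), ?_⟩
        rw [← e, D.agr i (by simp only [Set.mem_insert_iff, not_or]; exact
          ⟨hik, by simpa using hi⟩)]
    by_cases pw : p = w
    · subst pw
      exact not_dich_insert htQ.1.2
    have dv : Dich (insert j K) p v := by
      rcases Finset.mem_union.1 hp with hp | hp
      · exact hS.cV.fib j (v j) p hp v (mem_fib.2 ⟨D.mv, rfl⟩) pv
      · rw [D.wj] at hp
        exact (hS.cross D.hj hR (mem_fib.2 ⟨D.mv, rfl⟩) hp).symm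
    have dw : Dich (insert j K) p w := by
      rcases Finset.mem_union.1 hp with hp | hp
      · exact hS.cross D.hj hR hp (mem_fib.2 ⟨D.mw, D.wj⟩)
      · exact hS.cW.fib j (w j) p hp w (mem_fib.2 ⟨D.mw, rfl⟩) pw
    have d2 : Dich (insert k (insert j K)) p w := by
      obtain ⟨i, hi, e⟩ := dw
      by_cases hik : i = k
      · obtain ⟨i', hi', e'⟩ := dv
        have hik' : i' ≠ k := by
          rintro rfl
          subst hik
          rw [D.wk, e', flp_flp] at e
          exact flp_ne _ e.symm
        have hm : i' ∉ insert k (insert j K) := by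
          simp only [Set.mem_insert_iff, not_or]; exact ⟨hik', by simpa using hi'⟩
        exact ⟨i', hm, by rw [← D.agr i' hm, e']⟩
      · exact ⟨i, by simp only [Set.mem_insert_iff, not_or]; exact ⟨hik, by simpa using hi⟩, e⟩
    have hpt₀ : Dich (insert j K) t₀ p := by
      obtain ⟨i, hi, e⟩ := d2.symm
      exact ⟨i, fun hk => hi (by simp only [Set.mem_insert_iff] at hk ⊢; exact Or.inr hk),
        by rw [e, hag i hi]⟩
    have h5 : 5 ≤ (meet (insert j K) Q p).card := by
      refine five_le_card_meet cQ tQ (fun y hy => (htr y).1 ⟨p, hp, hy⟩) fun a ha hap => ?_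
      have ha' := memQ.1 ha
      rcases Finset.mem_union.1 hp with hp | hp
      · rw [mem_fib] at hp
        exact hS.tV p hp.1 a ha'.1.1 ⟨j, D.hj, by rw [hp.2, ha'.2.1, D.wj], hap.symm⟩
      · rw [mem_fib] at hp
        exact hS.no a ha'.1.1 p hp.1 (agr_of_insert hap (ha'.2.1.trans hp.2.symm))
    have hsub2 : meet (insert j K) Q p ⊆ Q.erase t₀ := by
      intro z hz
      rw [mem_meet] at hz
      refine Finset.mem_erase.2 ⟨?_, hz.1⟩
      rintro rfl
      exact hz.2 hpt₀
    have heq : meet (insert j K) Q p = Q.erase t₀ := by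
      refine Finset.eq_of_subset_of_card_le hsub2 ?_
      rw [Finset.card_erase_of_mem (fib_subset ht₀)]
      omega
    have : t ∈ meet (insert j K) Q p := by
      rw [heq]
      refine Finset.mem_erase.2 ⟨?_, (memF.1 ht).1⟩
      rintro rfl
      exact flp_ne s ((mem_fib.1 ht₀).2.symm.trans (memF.1 ht).2)
    exact (mem_meet.1 this).2
  obtain ⟨t, ht, t', ht', hne⟩ := Finset.one_lt_card.1 (show 1 < (fib Q k s).card by omega)
  obtain ⟨m, hm, e⟩ := cQ t (memF.1 ht).1 t' (memF.1 ht').1 hne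
  have hcls : ∀ p ∈ fib V j (v j) ∪ fib W j (w j), (p m).1 ≠ (t m).1 := by
    intro p hp hc
    rcases eq_or_eq_flp hc with e' | e'
    · exact hmeet p hp t' ht' ⟨m, hm, by rw [e', e, flp_flp]⟩
    · exact hmeet p hp t ht ⟨m, hm, e'⟩
  have half : ∀ s' : C × Bool, s'.1 = (t m).1 → ∀ y,
      (∃ a ∈ fib Q m s', Cov (insert m (insert j K)) a y) →
      ∃ a ∈ fib Q m (flp s'), Cov (insert m (insert j K)) a y := by
    intro s' hs' y
    rw [cov_insert_fib hm]
    rintro ⟨a, ha, hay⟩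
    rw [mem_fib] at ha
    obtain ⟨p, hp, hpy⟩ := (htr _).2 ⟨a, ha.1, hay⟩
    have hc : (p m).1 ≠ s'.1 := by rw [hs']; exact hcls p hp
    obtain ⟨q, hq, hqy⟩ := (htr (upd y m (flp s'))).1
      ⟨p, hp, (cov_upd_of_ne (s := flp s') hc).2 ((cov_upd_of_ne hc).1 hpy)⟩
    exact ⟨q, mem_fib.2 ⟨hq, cQ.letter_eq ha.1 hq hm (by rw [flp_flp]; exact ha.2)
      (by rwa [flp_flp]) hqy⟩, cov_of_upd hqy⟩
  have hst := st_fib_flp cQ tQ hm (s := t m) fun y => ⟨half _ rfl y, fun hy => by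
    simpa using half (flp (t m)) rfl y hy⟩
  have m1 := h.min _ _ _ hst ⟨t, mem_fib.2 ⟨(memF.1 ht).1, rfl⟩⟩
  have m2 : 0 < (fib Q m (flp (t m))).card :=
    Finset.card_pos.2 ⟨t', mem_fib.2 ⟨(memF.1 ht').1, e⟩⟩
  have m3 : (fib Q m (t m)).card + (fib Q m (flp (t m))).card ≤ Q.card := by
    rw [← card_cls]; exact Finset.card_le_card cls_subset
  have m4 := Finset.card_le_card hQV
  omega

end

section

variable {K : Set ι} {w v u t t₁ t₂ : ι → C × Bool} {y : ι → C → Bool}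
  {A B U V W : Finset (ι → C × Bool)} {σ τ : (ι → C × Bool) → ℤ} {j k l : ι}

/-- Six words of `V` in a special position. -/
structure Tight (K : Set ι) (V : Finset (ι → C × Bool)) (j k l₁ l₂ : ι)
    (v b t₁ t₂ t₃ t₄ : ι → C × Bool) : Prop where
  hj : j ∉ K
  hk : k ∉ K
  hl₁ : l₁ ∉ K
  hl₂ : l₂ ∉ K
  jk : j ≠ k
  jl₁ : j ≠ l₁
  jl₂ : j ≠ l₂
  kl₁ : k ≠ l₁
  kl₂ : k ≠ l₂
  ll : l₁ ≠ l₂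
  mv : v ∈ V
  mb : b ∈ V
  m1 : t₁ ∈ V
  m2 : t₂ ∈ V
  m3 : t₃ ∈ V
  m4 : t₄ ∈ V
  ab : Agr (insert l₂ (insert l₁ (insert k (insert j K)))) v b
  a1 : Agr (insert l₂ (insert l₁ (insert k (insert j K)))) v t₁
  a2 : Agr (insert l₂ (insert l₁ (insert k (insert j K)))) v t₂
  a3 : Agr (insert l₂ (insert l₁ (insert k (insert j K)))) v t₃
  a4 : Agr (insert l₂ (insert l₁ (insert k (insert j K)))) v t₄
  bj : b j = flp (v j)
  bk : b k = flp (v k)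
  bl₁ : (v l₁).1 ≠ (b l₁).1
  bl₂ : (v l₂).1 ≠ (b l₂).1
  j1 : t₁ j = b j
  j2 : t₂ j = b j
  j3 : t₃ j = b j
  j4 : t₄ j = b j
  k1 : (v k).1 ≠ (t₁ k).1
  k2 : t₂ k = t₁ k
  k3 : t₃ k = flp (t₁ k)
  k4 : t₄ k = flp (t₁ k)
  x1 : t₁ l₁ = flp (b l₁)
  x2 : t₂ l₁ = b l₁
  x3 : t₃ l₁ = v l₁
  x4 : t₄ l₁ = flp (b l₁)
  y1 : t₁ l₂ = v l₂
  y2 : t₂ l₂ = flp (b l₂)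
  y3 : t₃ l₂ = flp (b l₂)
  y4 : t₄ l₂ = b l₂
  no : ∀ z ∈ V, z j = b j → z k ≠ v k

theorem MSt.tight [Finite ι] (h : MSt K V W) (D : DT K V W v w j k)
    (h1 : (X1 K V w j k).card = 1) (h2 : (X2 K V w j k).card = 0)
    (h3 : (X2 K V w k j).card = 4) (h0 : (Cn V j k (w j) (v k)).card = 0) :
    ∃ l₁ l₂ b t₁ t₂ t₃ t₄, Tight K V j k l₁ l₂ v b t₁ t₂ t₃ t₄ := by
  have hS := h.toSt
  obtain ⟨b, hX1⟩ := Finset.card_eq_one.1 h1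
  set X := X2 K V w k j with hX
  have hb : b ∈ X1 K V w j k := by rw [hX1]; simp
  obtain ⟨⟨bV, bw⟩, bj, bk⟩ := mem_X1.1 hb
  have memX : ∀ {z}, z ∈ X ↔ (z ∈ V ∧ ¬ Dich K z w) ∧ z j = w j ∧ (z k).1 ≠ (w k).1 :=
    mem_X2
  have hm : meet K V w = insert b X := by
    rw [D.meet_eq hS, Finset.card_eq_zero.1 h2, hX1]
    ext z; simp [hX]
  have memF : ∀ {z s}, z ∈ fib X k s ↔ z ∈ X ∧ z k = s := mem_fib
  have hcov : Covers K (insert b X) w := by rw [← hm]; exact (hS.covers_left D.mw).meet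
  have hk' : k ∉ insert j K := by simp [D.jk.symm, D.hk]
  have hcj : Covers (insert j K) (insert b X) w := by
    intro y hy
    obtain ⟨a, ha, hay⟩ := hcov (upd y j (w j)) ((cov_upd_self D.hj rfl).2 hy)
    exact ⟨a, ha, cov_of_upd hay⟩
  obtain ⟨z, hz⟩ := Finset.card_pos.1 (show 0 < X.card by omega)
  set K₂ : Set ι := insert k (insert j K) with hK₂
  have nK₂ : ∀ {i}, i ∉ K₂ ↔ i ≠ k ∧ i ≠ j ∧ i ∉ K := by
    intro i; simp only [hK₂, Set.mem_insert_iff, not_or]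
  have hcl : ∀ z ∈ X, 4 ≤ (cls X k (z k).1).card := by
    intro z hz
    have hc := four_le_card_cls (hS.cV.mono meet_subset) (hS.tV.mono meet_subset)
      (fun a ha => (mem_meet.1 ha).2) (hS.covers_left D.mw).meet D.hk
      (mem_meet.2 (memX.1 hz).1) (memX.1 hz).2.2
    refine hc.trans (Finset.card_le_card fun x hx => ?_)
    rw [mem_cls, hm] at hx
    rw [mem_cls]
    refine ⟨?_, hx.2⟩
    rcases Finset.mem_insert.1 hx.1 with rfl | e
    · exact absurd (hx.2.symm.trans (by rw [bk])) (memX.1 hz).2.2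
    · exact e
  have hone : ∀ z' ∈ X, (z' k).1 = (z k).1 := by
    intro z' hz'
    by_contra hne
    have := cls_card_le_of_ne (U := X) (l := k) hne
    have := hcl z hz
    have := hcl z' hz'
    omega
  have hsum : ∀ s : C × Bool, s.1 = (z k).1 → (fib X k s).card + (fib X k (flp s)).card = 4 := by
    intro s hs
    rw [← card_cls, ← h3]
    congr 1
    ext x
    rw [mem_cls]
    exact ⟨fun hx => hx.1, fun hx => ⟨hx, (hone x hx).trans hs.symm⟩⟩
  have hdr : ∀ s : C × Bool, s.1 = (z k).1 → Covers K₂ (insert b (fib X k s)) w := by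
    intro s hs
    refine hcj.drop hk' (by rw [hs]; exact (memX.1 hz).2.2.symm) fun a ha hna => ?_
    rcases Finset.mem_insert.1 ha with rfl | ha
    · simp
    · rcases eq_or_eq_flp ((hone a ha).trans hs.symm) with e | e
      · exact Finset.mem_insert_of_mem (mem_fib.2 ⟨ha, e⟩)
      · exact absurd e hna
  have cF : ∀ s, Code K₂ (fib X k s) := fun s =>
    ((hS.cV.mono fun z hz => (memX.1 hz).1.1).insert_of_const fun z hz => (memX.1 hz).2.1).fib k s
  have tF : ∀ s, TwinFree K₂ (fib X k s) := fun s =>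
    ((hS.tV.mono fun z hz => (memX.1 hz).1.1).insert_of_const fun z hz => (memX.1 hz).2.1).fib k s
  have dF : ∀ z ∈ X, ¬ Dich K₂ z w := fun z hz =>
    not_dich_insert (not_dich_insert (memX.1 hz).1.2)
  have db : ¬ Dich K₂ b w := not_dich_insert (not_dich_insert bw)
  have dbX : ∀ z ∈ X, Dich K₂ b z := by
    intro z hz
    have hne : b ≠ z := by
      rintro rfl; exact (memX.1 hz).2.2 (by rw [bk])
    obtain ⟨i, hi, e⟩ := hS.cV b bV z (memX.1 hz).1.1 hne
    refine ⟨i, nK₂.2 ⟨?_, ?_, hi⟩, e⟩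
    · rintro rfl; exact (memX.1 hz).2.2 (by rw [e, bk]; rfl)
    · rintro rfl; rw [(memX.1 hz).2.1, bj] at e; exact flp_ne _ e.symm
  have opp : ∀ {p q : ι → C × Bool} {s}, p ∈ fib X k s → q ∈ fib X k (flp s) →
      ¬ Agr K₂ p q := by
    intro p q s hp hq e
    rw [memF] at hp hq
    have hp' := memX.1 hp.1
    have hq' := memX.1 hq.1
    refine hS.tV p hp'.1.1 q hq'.1.1 ⟨k, D.hk, by rw [hp.2, hq.2], ?_⟩
    rw [hK₂, Set.insert_comm] at e
    exact agr_of_insert e (hp'.2.1.trans hq'.2.1.symm)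
  have h2le : ∀ s : C × Bool, s.1 = (z k).1 → 2 ≤ (fib X k s).card := by
    intro s hs
    by_contra hlt
    rcases Nat.lt_or_ge 0 (fib X k s).card with hpos | h0'
    · obtain ⟨t, ht⟩ := Finset.card_eq_one.1 (show (fib X k s).card = 1 by omega)
      have htF : t ∈ fib X k s := by rw [ht]; simp
      have htX := (memF.1 htF).1
      have hc := hdr s hs
      rw [ht] at hc
      obtain ⟨m, hmK, e, hne, ag1, ag2⟩ := hc.pair (dbX t htX) db (dF t htX)
      have hall : ∀ a ∈ fib X k (flp s), a m = t m := by
        intro a ha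
        obtain ⟨i, hi, e'⟩ := dbX a (memF.1 ha).1
        by_cases him : i = m
        · subst him; rw [e', e]
        · exfalso
          refine dF a (memF.1 ha).1 ⟨i, hi, ?_⟩
          rw [ag1 i (by simp only [Set.mem_insert_iff, not_or]; exact ⟨him, hi⟩), e', flp_flp]
      have hc' : Covers (insert m K₂) (fib X k (flp s)) w := by
        refine (hdr (flp s) hs).drop (s := t m) hmK (by rw [e]; exact hne) fun a ha hna => ?_
        rcases Finset.mem_insert.1 ha with rfl | ha
        · exact absurd (by rw [e, flp_flp]) hna
        · exact ha
      have hsu := hsum s hs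
      obtain ⟨a, ha, hag⟩ := exists_agr_of_card_le _ _ _ rfl (by omega)
        ((cF (flp s)).insert_of_const hall) ((tF (flp s)).insert_of_const hall) hc'
      exact opp htF ha (agr_of_insert (ag2.symm.trans hag.symm) (hall a ha).symm)
    · have hc := hdr s hs
      rw [Finset.card_eq_zero.1 (show (fib X k s).card = 0 by omega)] at hc
      have hag : Agr K₂ w b := hc.agr (by simp)
      exact hS.no b bV w D.mw (agr_of_insert (agr_of_insert hag bk.symm) bj.symm).symm
  have main : ∀ s : C × Bool, s.1 = (z k).1 → ∃ l₁ ∉ K₂, ∃ l₂ ∉ K₂, l₁ ≠ l₂ ∧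
      (w l₁).1 ≠ (b l₁).1 ∧ (w l₂).1 ≠ (b l₂).1 ∧ Agr (insert l₂ (insert l₁ K₂)) w b ∧
      ∃ t ∈ fib X k s, ∃ t' ∈ fib X k s,
      Agr (insert l₁ K₂) w t ∧ t l₁ = flp (b l₁) ∧
      Agr (insert l₂ (insert l₁ K₂)) w t' ∧ t' l₁ = b l₁ ∧ t' l₂ = flp (b l₂) := by
    intro s hs
    have c1 := h2le s hs
    have c2 := h2le (flp s) hs
    have c3 := hsum s hs
    obtain ⟨p, q, hpq, e⟩ := Finset.card_eq_two.1 (show (fib X k s).card = 2 by omega)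
    have hp : p ∈ fib X k s := by rw [e]; simp
    have hq : q ∈ fib X k s := by rw [e]; simp
    have hc := hdr s hs
    rw [e] at hc
    obtain ⟨l₁, q1, l₂, q2, q3, q4, q5, q6, t, t', htt, q7⟩ := hc.triple
      (dbX p (memF.1 hp).1) (dbX q (memF.1 hq).1) (cF s p hp q hq hpq) db (dF p (memF.1 hp).1)
      (dF q (memF.1 hq).1) (tF s p hp q hq)
    refine ⟨l₁, q1, l₂, q2, q3, q4, q5, q6, t, ?_, t', ?_, q7⟩
    · rcases htt with ⟨rfl, -⟩ | ⟨rfl, -⟩ <;> assumption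
    · rcases htt with ⟨-, rfl⟩ | ⟨-, rfl⟩ <;> assumption
  obtain ⟨l₁, n1, l₂, n2, ll, p1, p2, pb, t₁, f1, t₂, f2, r1, r2, r3, r4, r5⟩ := main (z k) rfl
  obtain ⟨l₁', n1', l₂', n2', ll', p1', p2', pb', t₃, f3, t₄, f4, r1', r2', r3', r4', r5'⟩ :=
    main (flp (z k)) rfl
  have in1 : ∀ {i}, i ∉ K₂ → (w i).1 ≠ (b i).1 → i = l₁ ∨ i = l₂ := by
    intro i hi hne
    by_contra hc
    push Not at hc
    refine hne ?_
    rw [pb i (by simp only [Set.mem_insert_iff, not_or]; exact ⟨hc.2, hc.1, hi⟩)]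
  have hsw : l₁' = l₂ ∧ l₂' = l₁ := by
    have d1 : l₁' ≠ l₁ := by
      rintro rfl
      exact opp f1 f3 (agr_of_insert (r1.symm.trans r1') (by rw [r2, r2']))
    rcases in1 n1' p1' with e | e
    · exact absurd e d1
    · refine ⟨e, ?_⟩
      rcases in1 n2' p2' with e' | e'
      · exact e'
      · exact absurd (e.trans e'.symm) ll'
  obtain ⟨rfl, rfl⟩ := hsw
  obtain ⟨F1, k1⟩ := memF.1 f1
  obtain ⟨F2, k2⟩ := memF.1 f2
  obtain ⟨F3, k3⟩ := memF.1 f3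
  obtain ⟨F4, k4⟩ := memF.1 f4
  have G1 := memX.1 F1
  have G2 := memX.1 F2
  have G3 := memX.1 F3
  have G4 := memX.1 F4
  have wv : ∀ {i}, i ∉ K₂ → v i = w i := fun hi => D.agr _ hi
  have av : ∀ {x : ι → C × Bool}, Agr (insert l₁' (insert l₂' K₂)) w x →
      Agr (insert l₁' (insert l₂' K₂)) v x := fun hx => Agr.trans (D.agr.mono
        ((Set.subset_insert _ _).trans (Set.subset_insert _ _))) hx
  have o1 := nK₂.1 n1
  have o2 := nK₂.1 n2
  refine ⟨l₂', l₁', b, t₁, t₂, t₃, t₄, ?_⟩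
  exact
    { hj := D.hj, hk := D.hk, hl₁ := o1.2.2, hl₂ := o2.2.2, jk := D.jk, jl₁ := o1.2.1.symm
      jl₂ := o2.2.1.symm, kl₁ := o1.1.symm, kl₂ := o2.1.symm, ll := ll, mv := D.mv, mb := bV
      m1 := G1.1.1, m2 := G2.1.1, m3 := G3.1.1, m4 := G4.1.1, ab := av pb
      a1 := av (r1.mono (Set.subset_insert _ _)), a2 := av r3
      a3 := av (r1'.mono (Set.insert_subset_insert (Set.subset_insert _ _)))
      a4 := av (by rw [Set.insert_comm]; exact r3')
      bj := bj.trans D.wj, bk := bk.trans D.wk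
      bl₁ := by rw [wv n1]; exact p1
      bl₂ := by rw [wv n2]; exact p2
      j1 := G1.2.1.trans bj.symm, j2 := G2.2.1.trans bj.symm, j3 := G3.2.1.trans bj.symm
      j4 := G4.2.1.trans bj.symm
      k1 := by rw [D.ck]; exact G1.2.2.symm
      k2 := by rw [k1, k2]
      k3 := by rw [k1, k3]
      k4 := by rw [k1, k4]
      x1 := r2, x2 := r4
      x3 := by
        rw [wv n1]
        exact (r1' _ (by simp only [Set.mem_insert_iff, not_or]; exact ⟨ll, n1⟩)).symm
      x4 := r5'
      y1 := by
        rw [wv n2]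
        exact (r1 _ (by simp only [Set.mem_insert_iff, not_or]; exact ⟨ll.symm, n2⟩)).symm
      y2 := r5
      y3 := r2'
      y4 := r4'
      no := fun z hz e1 e2 => by
        have : z ∈ Cn V j k (w j) (v k) := mem_Cn.2 ⟨hz, e1.trans bj, e2⟩
        rw [Finset.card_eq_zero.1 h0] at this
        simp at this }

/-- A double twin whose two blocks are of minimal size leads to a tight configuration. -/
theorem MSt.tight_of_dt [Finite ι] (h : MSt K V W) (D : DT K V W v w j k)
    (ej : hb V W j (v j) = 6) (ek : hb V W k (v k) = 6) :
    ∃ j k l₁ l₂ v b t₁ t₂ t₃ t₄, Tight K V j k l₁ l₂ v b t₁ t₂ t₃ t₄ := by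
  rcases (D.bounds h).2.2 ej ek with ⟨h2, ⟨h1, h3⟩ | ⟨h1, h3, h0⟩⟩ | ⟨h2, ⟨h1, h3⟩ | ⟨h1, h3, h0⟩⟩
  · exact (h.not_six D h1 h2 h3 ej).elim
  · obtain ⟨l₁, l₂, b, t₁, t₂, t₃, t₄, T⟩ := h.tight D h1 h2 h3 h0
    exact ⟨_, _, _, _, _, _, _, _, _, _, T⟩
  · exact (h.not_six D.swap h1 h2 h3 ek).elim
  · obtain ⟨l₁, l₂, b, t₁, t₂, t₃, t₄, T⟩ := h.tight D.swap h1 h2 h3 h0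
    exact ⟨_, _, _, _, _, _, _, _, _, _, T⟩

end

section

variable {K : Set ι} {w v u t t₁ t₂ p q : ι → C × Bool} {y : ι → C → Bool}
  {A B U V W X : Finset (ι → C × Bool)} {σ τ : (ι → C × Bool) → ℤ} {j k l m : ι}

theorem cls_comm {c d : C} : cls (cls U m c) k d = cls (cls U k d) m c := by
  ext z; simp only [mem_cls]; tauto

theorem cls_mono (h : A ⊆ B) {c : C} : cls A k c ⊆ cls B k c := fun z hz => by
  rw [mem_cls] at hz ⊢; exact ⟨h hz.1, hz.2⟩

theorem class_of_card_eq {a g : C} (hag : a ≠ g)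
    (h : (cls B k a).card + (cls B k g).card = B.card) :
    ∀ t ∈ B, (t k).1 = a ∨ (t k).1 = g := by
  have e : cls B k a ∪ cls B k g = B := by
    refine Finset.eq_of_subset_of_card_le (Finset.union_subset cls_subset cls_subset) ?_
    rw [Finset.card_union_of_disjoint (cls_disjoint hag), h]
  intro t ht
  rw [← e, Finset.mem_union, mem_cls, mem_cls] at ht
  exact ht.imp And.right And.right

theorem card_of_classes {a g : C} (hag : a ≠ g) (h : ∀ t ∈ B, (t k).1 = a ∨ (t k).1 = g)
    (hX : X ⊆ B) : X.card = (cls X k a).card + (cls X k g).card := by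
  rw [← Finset.card_union_of_disjoint (cls_disjoint hag)]
  congr 1
  ext z
  simp only [Finset.mem_union, mem_cls]
  constructor
  · intro hz; exact (h z (hX hz)).imp (⟨hz, ·⟩) (⟨hz, ·⟩)
  · rintro (h | h) <;> exact h.1

theorem Rel.quad_agr [Finite ι] (h : Rel K U σ) (hs : Sgn U σ) (hr : Red K U σ) (h4 : U.card = 4)
    (hk : k ∉ K) (hp : p ∈ U) (hq : q ∈ U) (hne : (p k).1 ≠ (q k).1) :
    (∀ x ∈ U, Agr (insert k K) p x) ∧ (cls U k (p k).1).card = 2 := by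
  obtain ⟨m, b, c, d, hU, hab, hcd, e1, e2, Q⟩ := h.quad hs hr h4 hp
  have ha : ∀ x ∈ U, Agr (insert m K) p x := by
    intro x hx
    rw [hU] at hx
    simp only [Finset.mem_insert, Finset.mem_singleton] at hx
    rcases hx with rfl | rfl | rfl | rfl
    exacts [Agr.refl _, Q.ab, Q.ac, Q.ad]
  have hmk : m = k := by
    by_contra hmk
    exact hne (congrArg Prod.fst (ha q hq k (by simp [hk, Ne.symm hmk])))
  subst hmk
  exact ⟨ha, by rw [e1, Finset.card_pair hab]⟩

/-- A subblock with two words. -/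
theorem St.cell_pair [Finite ι] (h : St K V W) (hj : j ∉ K) (hm : m ∉ insert j K)
    (hk : k ∉ insert m (insert j K)) {c s a : C} (n1 : NoDT K V W j m c s)
    (n2 : NoDT K V W j k c a) (h2 : (cls (cls (blk V W j c) m s) k a).card = 2) :
    ∃ p q, p ≠ q ∧ cls (cls (blk V W j c) m s) k a = {p, q} ∧ q m = flp (p m) ∧ q k = flp (p k) ∧
      Agr (insert k (insert m (insert j K))) p q ∧ dsgn (sg V) j q = - dsgn (sg V) j p := by
  have hk' : k ∉ insert j K := fun e => hk (Set.mem_insert_of_mem _ e)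
  have hm' : m ∉ insert k (insert j K) := by
    simp only [Set.mem_insert_iff, not_or] at hm hk ⊢
    exact ⟨fun e => hk.1 e.symm, hm⟩
  obtain ⟨p, hp⟩ := Finset.card_pos.1 (show 0 < (cls (cls (blk V W j c) m s) k a).card by omega)
  obtain ⟨q, hpq, e, fk, sq, ag⟩ := (h.blk_rel₂ hj hm c s).cls_pair (sgn_blk₂)
    (h.blk_red₂ hj hm n1) hk h2 hp
  rw [cls_comm] at h2 hp
  obtain ⟨q', hpq', e', fm, -, -⟩ := (h.blk_rel₂ hj hk' c a).cls_pair (sgn_blk₂)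
    (h.blk_red₂ hj hk' n2) hm' h2 hp
  rw [cls_comm, e] at e'
  have : q' = q := by
    have : q' ∈ ({p, q} : Finset (ι → C × Bool)) := by rw [e']; simp
    simp only [Finset.mem_insert, Finset.mem_singleton] at this
    exact this.resolve_left hpq'.symm
  subst this
  refine ⟨p, q', hpq, e, fm, fk, ag, ?_⟩
  simp only [dsgn, fm, bit_flp] at sq ⊢
  rcases bit_eq (p m) with e | e <;> rw [e] at sq <;> linarith

/-- Two words of a block with opposite signs. -/
theorem side_of_dsgn (hd : Disjoint V W) (hp : p ∈ V ∪ W) (hq : q ∈ V ∪ W)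
    (hc : (q j).1 = (p j).1) (h : dsgn (sg V) j q = - dsgn (sg V) j p) :
    (q j = p j ∧ (p ∈ V ∧ q ∈ W ∨ p ∈ W ∧ q ∈ V)) ∨
      (q j = flp (p j) ∧ (p ∈ V ∧ q ∈ V ∨ p ∈ W ∧ q ∈ W)) := by
  have nV : ∀ {z}, z ∈ W → z ∉ V := fun hz hz' => Finset.disjoint_left.1 hd hz' hz
  have hb := bit_eq (p j)
  rw [Finset.mem_union] at hp hq
  rcases eq_or_eq_flp hc with e | e
  · refine Or.inl ⟨e, ?_⟩
    rcases hp with hp | hp <;> rcases hq with hq | hq <;> simp only [hp, hq, true_and, and_true]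
    · simp [dsgn, sg, hp, hq, e] at h; omega
    · simp
    · simp
    · simp [dsgn, sg, nV hp, nV hq, e] at h; omega
  · refine Or.inr ⟨e, ?_⟩
    rcases hp with hp | hp <;> rcases hq with hq | hq <;> simp only [hp, hq, true_and, and_true]
    · simp
    · simp [dsgn, sg, hp, nV hq, e, bit_flp] at h; omega
    · simp [dsgn, sg, nV hp, hq, e, bit_flp] at h; omega
    · simp

/-- The shape of a block with eight words. -/
structure Oct (K : Set ι) (V W : Finset (ι → C × Bool)) (j m k : ι) (c : C) (M N : Bool → C)
    (p q : Bool → Bool → ι → C × Bool) : Prop where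
  hj : j ∉ K
  hm : m ∉ insert j K
  hk : k ∉ insert m (insert j K)
  M2 : ∀ x, M x ≠ M (!x)
  N2 : ∀ x, N x ≠ N (!x)
  memp : ∀ x y, p x y ∈ blk V W j c
  memq : ∀ x y, q x y ∈ blk V W j c
  all : ∀ t ∈ blk V W j c, ∃ x y, t = p x y ∨ t = q x y
  agr : ∀ x y, Agr (insert k (insert m (insert j K))) (p true true) (p x y)
  agrq : ∀ x y, Agr (insert k (insert m (insert j K))) (p x y) (q x y)
  pm : ∀ x y, (p x y m).1 = M x
  pk : ∀ x y, (p x y k).1 = N y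
  qm : ∀ x y, q x y m = flp (p x y m)
  qk : ∀ x y, q x y k = flp (p x y k)
  sgn : ∀ x y, dsgn (sg V) j (q x y) = - dsgn (sg V) j (p x y)

theorem St.exists_oct [Finite ι] (h : St K V W) (hj : j ∉ K) {c : C}
    (nd : ∀ k d, NoDT K V W j k c d) (h8 : (blk V W j c).card = 8) :
    ∃ m k M N p q, Oct K V W j m k c M N p q := by
  set B := blk V W j c with hB
  have R := h.blk_rel hj c
  have S : Sgn B (dsgn (sg V) j) := sgn_sg.dsgn j
  obtain ⟨k, hk, t, ht, t', ht', htt⟩ := R.exists_ne S (h.blk_red hj c)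
    (Finset.card_pos.1 (show 0 < B.card by omega))
  have four : ∀ {i}, i ∉ insert j K → ∀ {t}, t ∈ B → ∀ {t'}, t' ∈ B → (t i).1 ≠ (t' i).1 →
      (cls B i (t i).1).card = 4 ∧ (cls B i (t' i).1).card = 4 := by
    intro i hi t ht t' ht' hne
    have := h.four_le_cls hj hi (nd i _) ht rfl
    have := h.four_le_cls hj hi (nd i _) ht' rfl
    have := cls_card_le_of_ne (U := B) (l := i) hne
    simp only [← hB] at *
    omega
  obtain ⟨c1, c2⟩ := four hk ht ht' htt
  have clk := class_of_card_eq htt (by rw [c1, c2, h8])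
  obtain ⟨m, hm, z, hz, z', hz', hzz⟩ := (h.blk_rel₂ hj hk c (t k).1).exists_ne sgn_blk₂
    (h.blk_red₂ hj hk (nd _ _)) (Finset.card_pos.1 (by rw [← hB]; omega))
  have hmj : m ∉ insert j K := fun e => hm (Set.mem_insert_of_mem _ e)
  have hkm : k ∉ insert m (insert j K) := by
    simp only [Set.mem_insert_iff, not_or] at hm hk ⊢
    exact ⟨fun e => hm.1 e.symm, hk⟩
  obtain ⟨c3, c4⟩ := four hmj (cls_subset hz) (cls_subset hz') hzz
  have clm := class_of_card_eq hzz (by rw [c3, c4, h8])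
  obtain ⟨ga, n1⟩ := (h.blk_rel₂ hj hk c (t k).1).quad_agr sgn_blk₂
    (h.blk_red₂ hj hk (nd _ _)) c1 hm hz hz' hzz
  obtain ⟨-, n2⟩ := (h.blk_rel₂ hj hk c (t k).1).quad_agr sgn_blk₂
    (h.blk_red₂ hj hk (nd _ _)) c1 hm hz' hz hzz.symm
  simp only [← hB] at n1 n2 ga
  rw [← cls_comm] at n1 n2
  have n3 := card_of_classes htt clk (cls_subset (A := B) (l := m) (c := (z m).1))
  have n4 := card_of_classes htt clk (cls_subset (A := B) (l := m) (c := (z' m).1))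
  set M : Bool → C := fun x => if x then (z m).1 else (z' m).1 with hM
  set N : Bool → C := fun x => if x then (t k).1 else (t' k).1 with hN
  have n2' : ∀ x y, (cls (cls B m (M x)) k (N y)).card = 2 := by
    intro x y
    cases x <;> cases y <;> simp only [hM, hN, if_true, Bool.false_eq_true, if_false] <;> omega
  have cells : ∀ x y, ∃ p q, p ≠ q ∧ cls (cls (blk V W j c) m (M x)) k (N y) = {p, q} ∧
      q m = flp (p m) ∧ q k = flp (p k) ∧
      Agr (insert k (insert m (insert j K))) p q ∧ dsgn (sg V) j q = - dsgn (sg V) j p :=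
    fun x y => h.cell_pair hj hmj hkm (nd _ _) (nd _ _) (n2' x y)
  choose p q hpq e fm fk ag sg' using cells
  have mp : ∀ x y, p x y ∈ cls (cls B m (M x)) k (N y) := fun x y => by rw [e]; simp
  have mq : ∀ x y, q x y ∈ cls (cls B m (M x)) k (N y) := fun x y => by rw [e]; simp
  have pm : ∀ x y, (p x y m).1 = M x := fun x y => (mem_cls.1 (cls_subset (mp x y))).2
  have pk : ∀ x y, (p x y k).1 = N y := fun x y => (mem_cls.1 (mp x y)).2
  have M2 : ∀ x, M x ≠ M (!x) := by intro x; cases x <;> simp [hM, hzz, hzz.symm]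
  have N2 : ∀ x, N x ≠ N (!x) := by intro x; cases x <;> simp [hN, htt, htt.symm]
  have mB : ∀ x y, p x y ∈ B := fun x y => cls_subset (cls_subset (mp x y))
  have col : ∀ y, Agr (insert k (insert m (insert j K))) (p true true) (p y true) := by
    intro y
    have e1 : ∀ x, p x true ∈ cls B k (t k).1 := fun x => mem_cls.2 ⟨mB _ _, pk _ _⟩
    have := (ga _ (e1 true)).symm.trans (ga _ (e1 y))
    rwa [Set.insert_comm] at this
  have row : ∀ x y, Agr (insert k (insert m (insert j K))) (p x true) (p x y) := by
    intro x y
    have e1 : ∀ y, p x y ∈ cls B m (M x) := fun y => cls_subset (mp x y)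
    refine ((h.blk_rel₂ hj hmj c (M x)).quad_agr sgn_blk₂ (h.blk_red₂ hj hmj (nd _ _)) ?_ hkm
      (e1 true) (e1 false) (by rw [pk, pk]; exact N2 true)).1 _ (e1 y)
    cases x <;> assumption
  refine ⟨m, k, M, N, p, q, ⟨hj, hmj, hkm, M2, N2, mB, fun x y => cls_subset (cls_subset (mq x y)),
    ?_, fun x y => (col x).trans (row x y), ag, pm, pk, fm, fk, sg'⟩⟩
  intro t₀ ht₀
  obtain ⟨x, hx⟩ : ∃ x, (t₀ m).1 = M x := by
    rcases clm _ ht₀ with e | e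
    exacts [⟨true, e⟩, ⟨false, e⟩]
  obtain ⟨y, hy⟩ : ∃ y, (t₀ k).1 = N y := by
    rcases clk _ ht₀ with e | e
    exacts [⟨true, e⟩, ⟨false, e⟩]
  refine ⟨x, y, ?_⟩
  have : t₀ ∈ cls (cls B m (M x)) k (N y) := mem_cls.2 ⟨mem_cls.2 ⟨ht₀, hx⟩, hy⟩
  rw [e] at this
  simpa using this

end

section

variable {K : Set ι} {w v u t t₁ t₂ p q z r x : ι → C × Bool} {y : ι → C → Bool}
  {A B U V W X : Finset (ι → C × Bool)} {σ τ : (ι → C × Bool) → ℤ} {j k l m : ι}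

theorem Cov.ne_flp {i : ι} (hi : i ∉ K) (h₁ : Cov K w y) (h₂ : Cov K v y) : v i ≠ flp (w i) := by
  intro e
  have a := h₁ i hi
  have b := h₂ i hi
  rw [e] at b
  simp only [flp_fst, flp_snd, a] at b
  cases (w i).2 <;> simp at b

/-- Two words of a code, one of them covering a point, the other one close to a word covering
that point. -/
theorem Code.dich_in (hW : Code K W) (hz : z ∈ W) (hr : r ∈ W) (hzy : Cov K z y) (hx : Cov K x y)
    {S : Set ι} (ag : Agr S x r) (hne : z ≠ r) : ∃ i ∉ K, i ∈ S ∧ r i = flp (z i) := by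
  obtain ⟨i, hi, e⟩ := hW z hz r hr hne
  refine ⟨i, hi, ?_, e⟩
  by_contra hS
  rw [← ag i hS] at e
  exact hzy.ne_flp hi hx e

theorem Code.dich_in₃ (hW : Code K W) (hz : z ∈ W) (hr : r ∈ W) (hzy : Cov K z y) (hx : Cov K x y)
    (ag : Agr (insert k (insert m (insert j K))) x r) (hne : (z j).1 ≠ (r j).1) :
    r m = flp (z m) ∨ r k = flp (z k) := by
  obtain ⟨i, hi, hS, e⟩ := hW.dich_in hz hr hzy hx ag (fun e => hne (by rw [e]))
  simp only [Set.mem_insert_iff] at hS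
  rcases hS with rfl | rfl | rfl | hS
  · exact Or.inr e
  · exact Or.inl e
  · exact absurd (by rw [e, flp_fst]) hne
  · exact absurd hS hi

theorem exists_avoid (fm : q m = flp (p m)) (fk : q k = flp (p k)) {s : C × Bool}
    (hs : s.1 = (p m).1) : ∃ s', s'.1 = (p k).1 ∧ (p m = flp s ∨ p k = flp s') ∧
      (q m = flp s ∨ q k = flp s') := by
  rcases eq_or_eq_flp hs with rfl | rfl
  · exact ⟨flp (p k), rfl, Or.inr (by simp), Or.inl fm⟩
  · exact ⟨p k, rfl, Or.inl (by simp), Or.inr fk⟩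

theorem class_of_two (fm : q m = flp (p m)) (fk : q k = flp (p k))
    (hp : p m = flp (z m) ∨ p k = flp (z k)) (hq : q m = flp (z m) ∨ q k = flp (z k)) :
    (z m).1 = (p m).1 ∧ (z k).1 = (p k).1 := by
  rcases hp with e | e <;> rcases hq with e' | e'
  · rw [fm, e, flp_flp] at e'; exact absurd e'.symm (flp_ne _)
  · rw [fk, flp_inj] at e'; exact ⟨by rw [e]; rfl, by rw [e']⟩
  · rw [fm, flp_inj] at e'; exact ⟨by rw [e'], by rw [e]; rfl⟩
  · rw [fk, e, flp_flp] at e'; exact absurd e'.symm (flp_ne _)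

/-- Twelve words, six of them in a special position. -/
def HasTight (K : Set ι) (V : Finset (ι → C × Bool)) : Prop :=
  V.card = 12 ∧ ∃ j k l₁ l₂ v b t₁ t₂ t₃ t₄, Tight K V j k l₁ l₂ v b t₁ t₂ t₃ t₄

variable {c : C} {M N : Bool → C} {P Q : Bool → Bool → ι → C × Bool}

theorem Oct.jm (O : Oct K V W j m k c M N P Q) : m ≠ j ∧ m ∉ K ∧ k ≠ m ∧ k ≠ j ∧ k ∉ K := by
  have h1 := O.hm
  have h2 := O.hk
  simp only [Set.mem_insert_iff, not_or] at h1 h2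
  exact ⟨h1.1, h1.2, h2.1, h2.2.1, h2.2.2⟩

theorem Oct.swap (O : Oct K V W j m k c M N P Q) :
    Oct K V W j k m c N M (fun x y => P y x) (fun x y => Q y x) := by
  obtain ⟨h1, h2, h3, h4, h5⟩ := O.jm
  have e : (insert m (insert k (insert j K)) : Set ι) = insert k (insert m (insert j K)) :=
    Set.insert_comm _ _ _
  exact ⟨O.hj, by simp [h4, h5], by simp [h1, h2, h3.symm], O.N2, O.M2, fun x y => O.memp y x,
    fun x y => O.memq y x, fun t ht => by obtain ⟨x, y, h⟩ := O.all t ht; exact ⟨y, x, h⟩,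
    fun x y => by rw [e]; exact O.agr y x, fun x y => by rw [e]; exact O.agrq y x,
    fun x y => O.pk y x, fun x y => O.pm y x, fun x y => O.qk y x, fun x y => O.qm y x,
    fun x y => O.sgn y x⟩

theorem Oct.agr' (O : Oct K V W j m k c M N P Q) {x y x' y' : Bool}
    (hr : r = P x y ∨ r = Q x y) (hz : z = P x' y' ∨ z = Q x' y') :
    Agr (insert k (insert m (insert j K))) r z := by
  have key : ∀ {r x y}, (r = P x y ∨ r = Q x y) →
      Agr (insert k (insert m (insert j K))) (P true true) r := by
    rintro r x y (rfl | rfl)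
    exacts [O.agr _ _, (O.agr _ _).trans (O.agrq _ _)]
  exact (key hr).symm.trans (key hz)

theorem Oct.cl (O : Oct K V W j m k c M N P Q) {x y : Bool} (hr : r = P x y ∨ r = Q x y) :
    (r j).1 = c ∧ (r m).1 = M x ∧ (r k).1 = N y := by
  rcases hr with rfl | rfl
  · exact ⟨(mem_blk.1 (O.memp x y)).2, O.pm x y, O.pk x y⟩
  · exact ⟨(mem_blk.1 (O.memq x y)).2, by rw [O.qm, flp_fst, O.pm], by rw [O.qk, flp_fst, O.pk]⟩

theorem Oct.antipodal (O : Oct K V W j m k c M N P Q) {x y : Bool} (hr : r = P x y ∨ r = Q x y)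
    (hz : z = P (!x) (!y) ∨ z = Q (!x) (!y)) (hA : Code K A) (hrA : r ∈ A) (hzA : z ∈ A) :
    z j = flp (r j) := by
  have c1 := O.cl hr
  have c2 := O.cl hz
  have hM := O.M2 x
  have hN := O.N2 y
  have hne : r ≠ z := by rintro rfl; exact hM (c1.2.1.symm.trans c2.2.1)
  obtain ⟨i, hi, e⟩ := hA r hrA z hzA hne
  by_cases h1 : i = j
  · exact h1 ▸ e
  by_cases h2 : i = m
  · subst h2; exact absurd (by rw [← c1.2.1, ← c2.2.1, e, flp_fst]) hM
  by_cases h3 : i = k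
  · subst h3; exact absurd (by rw [← c1.2.2, ← c2.2.2, e, flp_fst]) hN
  · rw [← O.agr' hr hz i (by simp [h1, h2, h3, hi])] at e
    exact absurd e.symm (flp_ne _)

theorem Oct.not_row (h : St K V W) (O : Oct K V W j m k c M N P Q) (x : Bool)
    (hW : ∀ y, P x y ∈ W ∧ Q x y ∈ W) (hV : ∀ y, P (!x) y ∈ V ∧ Q (!x) y ∈ V) : False := by
  obtain ⟨h1, h2, h3, h4, h5⟩ := O.jm
  set x₁ := P (!x) true with hx₁
  obtain ⟨y, hy⟩ := exists_cov x₁ K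
  have x₁m : (x₁ m).1 = M (!x) := O.pm _ _
  have x₁k : (x₁ k).1 = N true := O.pk _ _
  obtain ⟨s, s1, s2, s3⟩ := exists_avoid (O.qk x true) (O.qm x true) (s := x₁ k)
    (by rw [x₁k, O.pk])
  obtain ⟨s', s1', s2', s3'⟩ := exists_avoid (O.qm x false) (O.qk x false) (s := s)
    (by rw [s1, O.pm, O.pm])
  rw [O.pm] at s1
  rw [O.pk] at s1'
  have hx : Cov K x₁ (pt y m k s s') := hy.mv
    (fun e => (O.M2 x) (by rw [← s1, ← x₁m, e, flp_fst]))
    (fun e => (O.N2 false) (by rw [← s1', Bool.not_false, ← x₁k, e, flp_fst]))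
  obtain ⟨z, hz, hzy⟩ := (h.cov _).1 ⟨x₁, (hV true).1, hx⟩
  have nm : ∀ {r}, Cov K r (pt y m k s s') → r m ≠ flp s := fun hr e => by
    have := hr m h2
    simp [pt, upd, e, h3.symm] at this
  have nk : ∀ {r}, Cov K r (pt y m k s s') → r k ≠ flp s' := fun hr e => by
    have := hr k h5
    simp [pt, upd, e] at this
  have nk' : ∀ {r}, Cov K r (pt y m k s s') → r k ≠ flp (x₁ k) := fun hr => hx.ne_flp h5 hr
  by_cases hc : (z j).1 = c
  · obtain ⟨x', y', hz'⟩ := O.all z (mem_blk.2 ⟨Or.inr hz, hc⟩)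
    by_cases hxx : x' = x
    · subst hxx
      cases y'
      · rcases hz' with rfl | rfl
        · rcases s2' with e | e
          exacts [nm hzy e, nk hzy e]
        · rcases s3' with e | e
          exacts [nm hzy e, nk hzy e]
      · rcases hz' with rfl | rfl
        · rcases s2 with e | e
          exacts [nk' hzy e, nm hzy e]
        · rcases s3 with e | e
          exacts [nk' hzy e, nm hzy e]
    · have : x' = !x := by cases x <;> cases x' <;> simp_all
      subst this
      have : z ∈ V := by
        rcases hz' with rfl | rfl
        exacts [(hV _).1, (hV _).2]
      exact h.not_mem hz this
  · have key : ∀ {y r}, (r = P x y ∨ r = Q x y) → r m = flp (z m) ∨ r k = flp (z k) := by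
      intro y r hr
      refine h.cW.dich_in₃ hz ?_ hzy hx (O.agr' (Or.inl hx₁) hr) (by rw [(O.cl hr).1]; exact hc)
      rcases hr with rfl | rfl
      exacts [(hW _).1, (hW _).2]
    have a := (class_of_two (O.qm x true) (O.qk x true) (key (Or.inl rfl)) (key (Or.inr rfl))).2
    have b := (class_of_two (O.qm x false) (O.qk x false) (key (Or.inl rfl)) (key (Or.inr rfl))).2
    rw [O.pk] at a b
    exact O.N2 true (a.symm.trans b)

theorem Oct.dt (O : Oct K V W j m k c M N P Q) {x y : Bool} (e : Q x y j = P x y j)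
    (hs : P x y ∈ V ∧ Q x y ∈ W ∨ P x y ∈ W ∧ Q x y ∈ V) :
    ∃ v w, DT K V W v w m k ∧ (v m).1 = M x ∧ (v k).1 = N y := by
  obtain ⟨h1, h2, h3, h4, h5⟩ := O.jm
  have ag : Agr (insert k (insert m K)) (P x y) (Q x y) := by
    refine agr_of_insert (l := j) ?_ e.symm
    have := O.agrq x y
    rwa [Set.insert_comm m j, Set.insert_comm k j] at this
  have hp := O.cl (r := P x y) (Or.inl rfl)
  have hq := O.cl (r := Q x y) (Or.inr rfl)
  rcases hs with ⟨a, b⟩ | ⟨a, b⟩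
  · exact ⟨_, _, ⟨h2, h5, h3.symm, a, b, O.qm x y, O.qk x y, ag⟩, hp.2⟩
  · exact ⟨_, _, ⟨h2, h5, h3.symm, b, a, by rw [O.qm x y, flp_flp], by rw [O.qk x y, flp_flp],
      ag.symm⟩, hq.2⟩

theorem MSt.hasTight_of_oct [Finite ι] (h : MSt K V W) (O : Oct K V W j m k c M N P Q) :
    HasTight K V := by
  have hS := h.toSt
  obtain ⟨h1, h2, h3, h4, h5⟩ := O.jm
  have side : ∀ x y, (Q x y j = P x y j ∧ (P x y ∈ V ∧ Q x y ∈ W ∨ P x y ∈ W ∧ Q x y ∈ V)) ∨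
      (Q x y j = flp (P x y j) ∧ (P x y ∈ V ∧ Q x y ∈ V ∨ P x y ∈ W ∧ Q x y ∈ W)) := fun x y =>
    side_of_dsgn hS.disjoint (cls_subset (O.memp x y)) (cls_subset (O.memq x y))
      (by rw [(O.cl (Or.inl rfl)).1, (O.cl (Or.inr rfl)).1]) (O.sgn x y)
  have anti : ∀ {A}, Code K A → ∀ {x y r}, (r = P x y ∨ r = Q x y) → r ∈ A →
      Q (!x) (!y) j = flp (P (!x) (!y) j) → P (!x) (!y) ∈ A → Q (!x) (!y) ∈ A → False := by
    intro A hA x y r hr hrA e m1 m2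
    have e1 := O.antipodal hr (Or.inl rfl) hA hrA m1
    have e2 := O.antipodal hr (Or.inr rfl) hA hrA m2
    rw [e1, flp_flp] at e
    rw [e] at e2
    exact flp_ne _ e2.symm
  by_cases hop : ∃ x y, Q x y j = P x y j ∧ (P x y ∈ V ∧ Q x y ∈ W ∨ P x y ∈ W ∧ Q x y ∈ V)
  · obtain ⟨x, y, e, hs⟩ := hop
    obtain ⟨v, w, D, vm, vk⟩ := O.dt e hs
    have opp : Q (!x) (!y) j = P (!x) (!y) j ∧ (P (!x) (!y) ∈ V ∧ Q (!x) (!y) ∈ W ∨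
        P (!x) (!y) ∈ W ∧ Q (!x) (!y) ∈ V) := by
      refine (side (!x) (!y)).resolve_right ?_
      rintro ⟨e', ⟨a, b⟩ | ⟨a, b⟩⟩
      · rcases hs with ⟨c, d⟩ | ⟨c, d⟩
        exacts [anti hS.cV (Or.inl rfl) c e' a b, anti hS.cV (Or.inr rfl) d e' a b]
      · rcases hs with ⟨c, d⟩ | ⟨c, d⟩
        exacts [anti hS.cW (Or.inr rfl) d e' a b, anti hS.cW (Or.inl rfl) c e' a b]
    obtain ⟨v', w', D', vm', vk'⟩ := O.dt opp.1 opp.2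
    obtain ⟨b1, b2, -⟩ := D.bounds h
    obtain ⟨b3, b4, -⟩ := D'.bounds h
    have s1 := hS.hb_add_le h2 (s := v m) (r := v' m) (by rw [vm, vm']; exact O.M2 x)
    have s2 := hS.hb_add_le h5 (s := v k) (r := v' k) (by rw [vk, vk']; exact O.N2 y)
    have := h.le
    exact ⟨by omega, h.tight_of_dt D (by omega) (by omega)⟩
  · exfalso
    have same : ∀ x y, Q x y j = flp (P x y j) ∧
        (P x y ∈ V ∧ Q x y ∈ V ∨ P x y ∈ W ∧ Q x y ∈ W) := fun x y =>
      (side x y).resolve_left fun e => hop ⟨x, y, e⟩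
    have VW : ∀ x y, P x y ∈ V → P (!x) (!y) ∈ W ∧ Q (!x) (!y) ∈ W := by
      intro x y hp
      refine (same (!x) (!y)).2.resolve_left fun ⟨a, b⟩ => ?_
      exact anti hS.cV (Or.inl rfl) hp (same _ _).1 a b
    have WV : ∀ x y, P x y ∈ W → P (!x) (!y) ∈ V ∧ Q (!x) (!y) ∈ V := by
      intro x y hp
      refine (same (!x) (!y)).2.resolve_right fun ⟨a, b⟩ => ?_
      exact anti hS.cW (Or.inl rfl) hp (same _ _).1 a b
    rcases (same true true).2 with a | a <;> rcases (same true false).2 with b | b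
    · exact O.not_row hS false (fun y => by cases y; exacts [VW _ _ a.1, VW _ _ b.1])
        (fun y => by cases y; exacts [b, a])
    · exact O.swap.not_row hS false (fun y => by cases y; exacts [VW _ _ a.1, b])
        (fun y => by cases y; exacts [WV _ _ b.1, a])
    · exact O.swap.not_row hS true (fun y => by cases y; exacts [VW _ _ b.1, a])
        (fun y => by cases y; exacts [WV _ _ a.1, b])
    · exact O.not_row hS true (fun y => by cases y; exacts [b, a])
        (fun y => by cases y; exacts [WV _ _ a.1, WV _ _ b.1])

end

section

variable {K : Set ι} {w v u t t₁ t₂ p q z r x w₁ w₂ w₃ w₄ w₅ w₆ : ι → C × Bool} {y : ι → C → Bool}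
  {A B U V W X : Finset (ι → C × Bool)} {σ τ : (ι → C × Bool) → ℤ} {j k l m : ι} {a c : C}

theorem Hexa.swap (H : Hexa K σ m l w₁ w₂ w₃ w₄ w₅ w₆) : Hexa K σ l m w₄ w₅ w₆ w₁ w₂ w₃ := by
  have e : (insert l (insert m K) : Set ι) = insert m (insert l K) := Set.insert_comm _ _ _
  exact
    { hm := H.hl, hl := H.hm, hml := H.hml.symm
      s2 := by rw [H.s4, H.s5], s3 := by rw [H.s4, H.s6], s4 := by rw [H.s4, neg_neg]
      s5 := by rw [H.s4, H.s2, neg_neg], s6 := by rw [H.s4, H.s3, neg_neg]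
      a2 := e ▸ H.a4.symm.trans H.a5, a3 := e ▸ H.a4.symm.trans H.a6, a4 := e ▸ H.a4.symm
      a5 := e ▸ H.a4.symm.trans H.a2, a6 := e ▸ H.a4.symm.trans H.a3
      m2 := by rw [H.l4, H.l5], m3 := by rw [H.l4, H.l6], m5 := H.l2, m6 := H.l4.symm
      m4 := by rw [H.l4]; exact H.l3.symm
      l2 := H.m5, l3 := by rw [H.m6]; exact H.m4.symm, l4 := H.m6.symm
      l5 := by rw [H.m2, H.m6], l6 := by rw [H.m3, H.m6] }

theorem Hexa.agr (H : Hexa K σ m l w₁ w₂ w₃ w₄ w₅ w₆) :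
    ∀ x ∈ ({w₁, w₂, w₃, w₄, w₅, w₆} : Finset (ι → C × Bool)),
      Agr (insert m (insert l K)) w₁ x := by
  intro x hx
  simp only [Finset.mem_insert, Finset.mem_singleton] at hx
  rcases hx with rfl | rfl | rfl | rfl | rfl | rfl
  exacts [Agr.refl _, H.a2, H.a3, H.a4, H.a5, H.a6]

theorem Hexa.pair (H : Hexa K σ m l w₁ w₂ w₃ w₄ w₅ w₆) (hs : σ w₁ = 1 ∨ σ w₁ = -1)
    (h2 : (cls ({w₁, w₂, w₃, w₄, w₅, w₆} : Finset (ι → C × Bool)) l a).card = 2) :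
    (w₁ l).1 = a := by
  by_contra hne
  have e1 : (w₂ l).1 = (w₁ l).1 := by rw [H.l2, flp_fst]
  have e4 : (w₄ l).1 = (w₃ l).1 := by rw [H.l4]
  have e5 : (w₅ l).1 = (w₃ l).1 := by rw [H.l5]
  have e6 : (w₆ l).1 = (w₃ l).1 := by rw [H.l6, flp_fst]
  by_cases ha : (w₃ l).1 = a
  · have n34 : w₃ ≠ w₄ := by
      intro e
      have := H.s3.symm.trans ((congrArg σ e).trans H.s4)
      omega
    have n35 : w₃ ≠ w₅ := by
      intro e
      have := H.s3.symm.trans ((congrArg σ e).trans H.s5)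
      omega
    have n45 : w₄ ≠ w₅ := by
      intro e
      have := H.m5
      rw [← e] at this
      exact flp_ne _ this.symm
    have c3 : ({w₃, w₄, w₅} : Finset (ι → C × Bool)).card = 3 :=
      Finset.card_eq_three.2 ⟨_, _, _, n34, n35, n45, rfl⟩
    have : ({w₃, w₄, w₅} : Finset (ι → C × Bool)) ⊆
        cls ({w₁, w₂, w₃, w₄, w₅, w₆} : Finset (ι → C × Bool)) l a := by
      intro x hx
      simp only [Finset.mem_insert, Finset.mem_singleton] at hx
      rcases hx with rfl | rfl | rfl <;> simp [mem_cls, ha, e4, e5]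
    have := Finset.card_le_card this
    omega
  · obtain ⟨x, hx⟩ := Finset.card_pos.1 (show 0 < (cls ({w₁, w₂, w₃, w₄, w₅, w₆} :
        Finset (ι → C × Bool)) l a).card by omega)
    rw [mem_cls] at hx
    obtain ⟨hx, hxa⟩ := hx
    simp only [Finset.mem_insert, Finset.mem_singleton] at hx
    rcases hx with rfl | rfl | rfl | rfl | rfl | rfl
    · exact hne hxa
    · exact hne (e1.symm.trans hxa)
    · exact ha hxa
    · exact ha (e4.symm.trans hxa)
    · exact ha (e5.symm.trans hxa)
    · exact ha (e6.symm.trans hxa)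

theorem Rel.hexa_at [Finite ι] (h : Rel K U σ) (hs : Sgn U σ) (hr : Red K U σ) (h6 : U.card = 6)
    (hk : k ∉ K) (h2 : (cls U k a).card = 2) :
    ∃ m w₁ w₂ w₃ w₄ w₅ w₆, U = {w₁, w₂, w₃, w₄, w₅, w₆} ∧
      Hexa K σ m k w₁ w₂ w₃ w₄ w₅ w₆ ∧ (w₁ k).1 = a := by
  obtain ⟨m, l, w₁, w₂, w₃, w₄, w₅, w₆, rfl, H⟩ := h.hexa hs hr h6
  by_cases hl : k = l
  · subst hl
    exact ⟨m, w₁, w₂, w₃, w₄, w₅, w₆, rfl, H, H.pair (hs _ (by simp)) h2⟩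
  by_cases hm : k = m
  · subst hm
    have e : ({w₁, w₂, w₃, w₄, w₅, w₆} : Finset (ι → C × Bool)) = {w₄, w₅, w₆, w₁, w₂, w₃} := by
      ext z
      simp only [Finset.mem_insert, Finset.mem_singleton]
      constructor <;> (rintro (h | h | h | h | h | h) <;> simp [h])
    rw [e] at h2
    exact ⟨l, w₄, w₅, w₆, w₁, w₂, w₃, e, H.swap, H.swap.pair (hs _ (by simp)) h2⟩
  · exfalso
    set U : Finset (ι → C × Bool) := {w₁, w₂, w₃, w₄, w₅, w₆}
    have all : ∀ x ∈ U, x k = w₁ k := fun x hx =>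
      (H.agr x hx k (by simp [hl, hm, hk])).symm
    obtain ⟨x, hx⟩ := Finset.card_pos.1 (show 0 < (cls U k a).card by omega)
    have : cls U k a = U := by
      ext z
      rw [mem_cls] at hx ⊢
      refine ⟨And.left, fun hz => ⟨hz, ?_⟩⟩
      rw [all z hz, ← all x hx.1, hx.2]
    rw [this] at h2
    omega

theorem St.card_classes [Finite ι] (h : St K V W) (hj : j ∉ K)
    (nd : ∀ k d, NoDT K V W j k c d) (hlt : (blk V W j c).card < 12) (hk : k ∉ insert j K)
    (h1 : t₁ ∈ blk V W j c) (h2 : t₂ ∈ blk V W j c) (hne : (t₁ k).1 ≠ (t₂ k).1) :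
    (cls (blk V W j c) k (t₁ k).1).card + (cls (blk V W j c) k (t₂ k).1).card =
      (blk V W j c).card := by
  set B := blk V W j c with hB
  by_contra hcon
  have f1 := h.four_le_cls hj hk (nd k _) h1 rfl
  have f2 := h.four_le_cls hj hk (nd k _) h2 rfl
  obtain ⟨x, hxB, hx⟩ : ∃ x ∈ B, x ∉ cls B k (t₁ k).1 ∪ cls B k (t₂ k).1 := by
    by_contra! hx
    have := Finset.card_le_card (show B ⊆ _ from hx)
    rw [Finset.card_union_of_disjoint (cls_disjoint hne)] at this
    have := cls_card_le_of_ne (U := B) (l := k) hne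
    omega
  have f3 := h.four_le_cls hj hk (nd k _) hxB rfl
  simp only [Finset.mem_union, mem_cls, hxB, true_and, not_or] at hx
  have : (cls B k (t₁ k).1 ∪ cls B k (t₂ k).1) ∪ cls B k (x k).1 ⊆ B :=
    Finset.union_subset (Finset.union_subset cls_subset cls_subset) cls_subset
  have := Finset.card_le_card this
  rw [Finset.card_union_of_disjoint (Finset.disjoint_union_left.2
    ⟨cls_disjoint fun e => hx.1 e.symm, cls_disjoint fun e => hx.2 e.symm⟩),
    Finset.card_union_of_disjoint (cls_disjoint hne)] at this
  simp only [← hB] at f1 f2 f3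
  omega

theorem St.even_cls_blk [Finite ι] (h : St K V W) (hj : j ∉ K) (hk : k ∉ insert j K) (d : C) :
    (cls (blk V W j c) k d).card % 2 = 0 :=
  Nat.even_iff.1 ((h.blk_rel hj c).even_cls (sgn_sg.dsgn j) hk d)

theorem St.not_ten [Finite ι] (h : St K V W) (hj : j ∉ K) (nd : ∀ k d, NoDT K V W j k c d)
    (h10 : (blk V W j c).card = 10) : False := by
  set B := blk V W j c with hB
  have R := h.blk_rel hj c
  have four : ∀ {i}, i ∉ insert j K → ∀ {t}, t ∈ B → 4 ≤ (cls B i (t i).1).card :=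
    fun hi _ ht => h.four_le_cls hj hi (nd _ _) ht rfl
  have sum : ∀ {i}, i ∉ insert j K → ∀ {t₁ t₂}, t₁ ∈ B → t₂ ∈ B → (t₁ i).1 ≠ (t₂ i).1 →
      (cls B i (t₁ i).1).card + (cls B i (t₂ i).1).card = 10 := fun hi _ _ h1 h2 hne =>
    (h.card_classes hj nd (by rw [← hB, h10]; norm_num) hi h1 h2 hne).trans h10
  have ev : ∀ {i}, i ∉ insert j K → ∀ d, (cls B i d).card % 2 = 0 := fun hi d =>
    h.even_cls_blk hj hi d
  have split : ∀ {i}, i ∉ insert j K → ∀ {t₁ t₂}, t₁ ∈ B → t₂ ∈ B → (t₁ i).1 ≠ (t₂ i).1 →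
      (cls B i (t₁ i).1).card = 4 ∧ (cls B i (t₂ i).1).card = 6 ∨
      (cls B i (t₁ i).1).card = 6 ∧ (cls B i (t₂ i).1).card = 4 := by
    intro i hi t₁ t₂ h1 h2 hne
    have := four hi h1
    have := four hi h2
    have := sum hi h1 h2 hne
    have := ev hi (t₁ i).1
    omega
  obtain ⟨k, hk, t, ht, t', ht', htt, c1, c2⟩ : ∃ k ∉ insert j K, ∃ t ∈ B, ∃ t' ∈ B,
      (t k).1 ≠ (t' k).1 ∧ (cls B k (t k).1).card = 4 ∧ (cls B k (t' k).1).card = 6 := by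
    obtain ⟨k, hk, t, ht, t', ht', htt⟩ := R.exists_ne (sgn_sg.dsgn j) (h.blk_red hj c)
      (Finset.card_pos.1 (show 0 < B.card by omega))
    rcases split hk ht ht' htt with ⟨a, b⟩ | ⟨a, b⟩
    exacts [⟨k, hk, t, ht, t', ht', htt, a, b⟩, ⟨k, hk, t', ht', t, ht, htt.symm, b, a⟩]
  have Rk := h.blk_rel₂ hj hk c (t k).1
  have Dk := h.blk_red₂ hj hk (nd k (t k).1)
  obtain ⟨m, hm, z, hz, c3⟩ : ∃ m ∉ insert k (insert j K), ∃ z ∈ cls B k (t k).1,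
      (cls B m (z m).1).card = 4 ∧ ∃ z' ∈ cls B k (t k).1, (z m).1 ≠ (z' m).1 := by
    obtain ⟨m, hm, z, hz, z', hz', hne⟩ := Rk.exists_ne sgn_blk₂ Dk
      (Finset.card_pos.1 (show 0 < (cls B k (t k).1).card by omega))
    rcases split (fun e => hm (Set.mem_insert_of_mem _ e)) (cls_subset hz) (cls_subset hz') hne
      with ⟨a, b⟩ | ⟨a, b⟩
    exacts [⟨m, hm, z, hz, a, z', hz', hne⟩, ⟨m, hm, z', hz', b, z, hz, hne.symm⟩]
  obtain ⟨c3, z', hz', hne⟩ := c3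
  have hmj : m ∉ insert j K := fun e => hm (Set.mem_insert_of_mem _ e)
  have hkm : k ∉ insert m (insert j K) := by
    simp only [Set.mem_insert_iff, not_or] at hm hk ⊢
    exact ⟨fun e => hm.1 e.symm, hk⟩
  have hmk : m ≠ k := fun e => hm (by simp [e])
  obtain ⟨g1, n1⟩ := Rk.quad_agr sgn_blk₂ Dk c1 hm hz hz' hne
  have n2 := card_of_classes htt (class_of_card_eq htt (by rw [c1, c2, h10]))
    (cls_subset (A := B) (l := m) (c := (z m).1))
  rw [cls_comm] at n1
  simp only [← hB] at n1 g1
  have n3 : (cls (cls B m (z m).1) k (t' k).1).card = 2 := by omega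
  obtain ⟨ξ, hξ⟩ := Finset.card_pos.1 (show 0 < (cls (cls B m (z m).1) k (t' k).1).card by omega)
  have hzk := (mem_cls.1 hz).2
  have hξk := (mem_cls.1 hξ).2
  obtain ⟨g2, -⟩ := (h.blk_rel₂ hj hmj c (z m).1).quad_agr sgn_blk₂
    (h.blk_red₂ hj hmj (nd m (z m).1)) c3 hkm (mem_cls.2 ⟨cls_subset hz, rfl⟩) (cls_subset hξ)
    (by rw [hzk, hξk]; exact htt)
  rw [cls_comm] at n3
  obtain ⟨l, w₁, w₂, w₃, w₄, w₅, w₆, hU, H, e1⟩ := (h.blk_rel₂ hj hk c (t' k).1).hexa_at sgn_blk₂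
    (h.blk_red₂ hj hk (nd k (t' k).1)) c2 hm n3
  have mU : ∀ {x}, x ∈ ({w₁, w₂, w₃, w₄, w₅, w₆} : Finset (ι → C × Bool)) → x ∈ B ∧
      (x k).1 = (t' k).1 := fun hx => by rw [← hU] at hx; exact mem_cls.1 hx
  have hl := H.hm
  have hlm := H.hml
  simp only [Set.mem_insert_iff, not_or] at hl
  have e2 : w₁ l = z l := by
    have : w₁ ∈ cls B m (z m).1 := mem_cls.2 ⟨(mU (by simp)).1, e1⟩
    exact (g2 _ this l (by simp [hl, hlm])).symm
  have e3 : ∀ x ∈ cls B k (t k).1, x l = z l := fun x hx =>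
    (g1 x hx l (by simp [hl, hlm])).symm
  have hsub : cls B l (w₄ l).1 ⊆ {w₄, w₅} := by
    intro x hx
    rw [mem_cls] at hx
    obtain ⟨hx, hxl⟩ := hx
    rcases class_of_card_eq htt (by rw [c1, c2, h10]) x hx with e | e
    · rw [e3 x (mem_cls.2 ⟨hx, e⟩), ← e2] at hxl
      exact absurd hxl.symm H.m4
    · have : x ∈ cls B k (t' k).1 := mem_cls.2 ⟨hx, e⟩
      rw [hB, hU] at this
      simp only [Finset.mem_insert, Finset.mem_singleton] at this ⊢
      rcases this with rfl | rfl | rfl | rfl | rfl | rfl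
      · exact absurd hxl.symm H.m4
      · exact absurd (by rw [← hxl, H.m2]) H.m4
      · exact absurd (by rw [← hxl, H.m3, flp_fst]) H.m4
      · simp
      · simp
      · exact absurd (by rw [← hxl, H.m6]) H.m4
  have := four (i := l) (by simp [hl]) (mU (x := w₄) (by simp)).1
  have := (Finset.card_le_card hsub).trans Finset.card_le_two
  omega

end

section

variable {K : Set ι} {w v u t t₁ t₂ p q z r x w₁ w₂ w₃ w₄ w₅ w₆ : ι → C × Bool} {y : ι → C → Bool}
  {A B U V W X : Finset (ι → C × Bool)} {σ τ : (ι → C × Bool) → ℤ} {j k l m : ι} {a c : C}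

theorem Rel.fib_of_const (h : Rel K U σ) (hl : l ∉ K) {s : C × Bool} (hc : ∀ t ∈ U, (t l).1 = s.1) :
    Rel (insert l K) (fib U l s) σ := by
  intro y
  rw [Polybox.fib, Finset.sum_filter]
  refine Eq.trans (Finset.sum_congr rfl fun w hw => ?_) (h (upd y l s))
  by_cases e : w l = s
  · rw [if_pos e]; simp only [cov_upd_self hl e]
  · rw [if_neg e, if_neg (not_cov_upd hl ((eq_or_eq_flp (hc w hw)).resolve_left e))]

/-- A relation is impossible if one class is a single letter and another is a flipped pair. -/
theorem Rel.not_one_letter (h : Rel K U σ) (hs : Sgn U σ) (hk : k ∉ K) (hp : p ∈ U) (hq : q ∈ U)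
    (fk : q k = flp (p k)) {s : C × Bool} (hU : ∀ t ∈ U, t = p ∨ t = q ∨ t k = s)
    (hps : (p k).1 ≠ s.1) : False := by
  obtain ⟨y, hy⟩ := exists_cov p K
  have h1 := h (upd y k (flp s))
  rw [Finset.sum_eq_single p] at h1
  · rw [if_pos ((cov_upd_of_ne (s := flp s) hps).2 hy)] at h1
    rcases hs p hp with e | e <;> omega
  · intro t ht htp
    rw [if_neg]
    rcases hU t ht with rfl | rfl | e
    · exact absurd rfl htp
    · rw [cov_upd_of_ne (s := flp s) (by rw [fk]; exact hps)]
      exact fun hc => hc.ne_flp hk hy (by rw [fk, flp_flp])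
    · exact not_cov_upd hk (by rw [e, flp_flp])
  · exact fun e => absurd hp e

/-- A minimal structure without double twins in which all coordinates have at most two classes. -/
structure Flat (K : Set ι) (V W : Finset (ι → C × Bool)) : Prop extends MSt K V W where
  c12 : V.card = 12
  nd : ∀ v w j k, ¬ DT K V W v w j k
  b12 : ∀ j ∉ K, ∀ t₁ ∈ V ∪ W, ∀ t₂ ∈ V ∪ W, (t₁ j).1 ≠ (t₂ j).1 →
    (cls (V ∪ W) j (t₁ j).1).card = 12

theorem Flat.noDT (h : Flat K V W) (j k : ι) (c d : C) : NoDT K V W j k c d :=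
  fun v w D => absurd D (h.nd v w j k)

theorem Flat.two [Finite ι] (h : Flat K V W) (hj : j ∉ K) (h1 : t₁ ∈ V ∪ W) (h2 : t₂ ∈ V ∪ W)
    (hne : (t₁ j).1 ≠ (t₂ j).1) : ∀ t ∈ V ∪ W, (t j).1 = (t₁ j).1 ∨ (t j).1 = (t₂ j).1 :=
  class_of_card_eq hne (by
    rw [h.b12 j hj _ h1 _ h2 hne, h.b12 j hj _ h2 _ h1 hne.symm, h.toSt.card_union, h.c12])

theorem blk_subset : blk V W j c ⊆ V ∪ W := cls_subset

theorem Flat.sum [Finite ι] (h : Flat K V W) (hX : X ⊆ V ∪ W) (hk : k ∉ K) (h1 : t₁ ∈ V ∪ W)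
    (h2 : t₂ ∈ V ∪ W) (hne : (t₁ k).1 ≠ (t₂ k).1) :
    X.card = (cls X k (t₁ k).1).card + (cls X k (t₂ k).1).card :=
  card_of_classes hne (h.two hk h1 h2 hne) hX

/-- Subblocks with two words. -/
theorem Flat.cell [Finite ι] (h : Flat K V W) (hj : j ∉ K) (hm : m ∉ insert j K)
    (hk : k ∉ insert m (insert j K)) {c s a : C}
    (h2 : (cls (cls (blk V W j c) m s) k a).card = 2) :
    ∃ p q, p ≠ q ∧ cls (cls (blk V W j c) m s) k a = {p, q} ∧ q j = flp (p j) ∧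
      q m = flp (p m) ∧ q k = flp (p k) ∧ Agr (insert k (insert m (insert j K))) p q ∧
      (p ∈ V ∧ q ∈ V ∨ p ∈ W ∧ q ∈ W) := by
  obtain ⟨p, q, hpq, e, fm, fk, ag, hs⟩ := h.toSt.cell_pair hj hm hk (h.noDT _ _ _ _)
    (h.noDT _ _ _ _) h2
  have hp : p ∈ blk V W j c ∧ q ∈ blk V W j c := by
    constructor
    · exact cls_subset (cls_subset (show p ∈ cls (cls (blk V W j c) m s) k a by rw [e]; simp))
    · exact cls_subset (cls_subset (show q ∈ cls (cls (blk V W j c) m s) k a by rw [e]; simp))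
  rcases side_of_dsgn h.toSt.disjoint (blk_subset hp.1) (blk_subset hp.2)
    (by rw [(mem_cls.1 hp.1).2, (mem_cls.1 hp.2).2]) hs with ⟨ej, hside⟩ | ⟨ej, hside⟩
  · exfalso
    have hm' : m ∉ K := fun e => hm (by simp [e])
    have hk' : k ∉ K := fun e => hk (by simp [e])
    have hmk : m ≠ k := fun e => hk (by simp [e])
    have ag' : Agr (insert k (insert m K)) p q := fun i hi => by
      by_cases hij : i = j
      · rw [hij, ej]
      · exact ag i (by simp_all)
    rcases hside with ⟨a, b⟩ | ⟨a, b⟩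
    · exact h.nd p q m k ⟨hm', hk', hmk, a, b, fm, fk, ag'⟩
    · exact h.nd q p m k ⟨hm', hk', hmk, b, a, by rw [fm, flp_flp], by rw [fk, flp_flp],
        ag'.symm⟩
  · exact ⟨p, q, hpq, e, ej, fm, fk, ag, hside⟩

theorem Flat.four_le [Finite ι] (h : Flat K V W) (hj : j ∉ K) (hk : k ∉ insert j K)
    (ht : t ∈ blk V W j c) : 4 ≤ (cls (blk V W j c) k (t k).1).card :=
  h.toSt.four_le_cls hj hk (h.noDT _ _ _ _) ht rfl

theorem exists_fst_ne (h : (cls A k a).card < A.card) : ∃ t ∈ A, (t k).1 ≠ a := by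
  by_contra! hc
  rw [show cls A k a = A from Finset.filter_true_of_mem hc] at h
  omega

theorem insert_not_mem₃ (hm : m ∉ insert j K) (hk : k ∉ insert m (insert j K)) :
    m ∉ K ∧ k ∉ K ∧ m ≠ k ∧ m ≠ j ∧ k ≠ j ∧ k ∉ insert j K ∧ m ∉ insert k (insert j K) := by
  simp only [Set.mem_insert_iff, not_or] at hm hk ⊢
  exact ⟨hm.2, hk.2.2, fun e => hk.1 e.symm, hm.1, hk.2.1, hk.2, fun e => hk.1 e.symm, hm⟩

theorem Hexa.ne₄₅ (H : Hexa K σ m l w₁ w₂ w₃ w₄ w₅ w₆) : w₄ ≠ w₅ := fun e => by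
  have := H.m5
  rw [← e] at this
  exact flp_ne _ this.symm

theorem Flat.not_four_four [Finite ι] (h : Flat K V W) (hj : j ∉ K) (hm : m ∉ insert j K)
    (hk : k ∉ insert m (insert j K)) (hB : (blk V W j c).card = 12) (hz : z ∈ blk V W j c)
    (ca : (cls (blk V W j c) k (z k).1).card = 4) (cs : (cls (blk V W j c) m (z m).1).card = 4)
    (cz : (cls (cls (blk V W j c) m (z m).1) k (z k).1).card = 2) : False := by
  set B := blk V W j c with hBdef
  have BU : B ⊆ V ∪ W := blk_subset
  obtain ⟨hmK, hkK, hmk, hmj, hkj, hk', hm'⟩ := insert_not_mem₃ hm hk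
  have hS := h.toSt
  obtain ⟨z', hz', hzz'⟩ := exists_fst_ne (A := cls B k (z k).1) (k := m) (a := (z m).1)
    (by rw [cls_comm]; omega)
  obtain ⟨ξ, hξ, hξk⟩ := exists_fst_ne (A := cls B m (z m).1) (k := k) (a := (z k).1) (by omega)
  rw [mem_cls] at hz' hξ
  have ga := ((h.toSt.blk_rel₂ hj hk' c (z k).1).quad_agr sgn_blk₂
    (hS.blk_red₂ hj hk' (h.noDT _ _ _ _)) ca hm' (mem_cls.2 ⟨hz, rfl⟩) (mem_cls.2 hz')
    hzz'.symm).1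
  have gs := ((h.toSt.blk_rel₂ hj hm c (z m).1).quad_agr sgn_blk₂
    (hS.blk_red₂ hj hm (h.noDT _ _ _ _)) cs hk (mem_cls.2 ⟨hz, rfl⟩) (mem_cls.2 hξ)
    hξk.symm).1
  have sums := fun {X} (hX : X ⊆ B) => h.sum (hX.trans BU) hkK (BU hz) (BU hξ.1) hξk.symm
  have sumk := fun {X} (hX : X ⊆ B) => h.sum (hX.trans BU) hmK (BU hz) (BU hz'.1) hzz'.symm
  set s := (z m).1
  set a := (z k).1
  set g := (ξ k).1 with hg
  set r := (z' m).1 with hr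
  have n1 : (cls B k g).card = 8 := by have := sums (subset_refl B); omega
  have n2 : (cls B m r).card = 8 := by have := sumk (subset_refl B); omega
  have n3 : (cls (cls B m r) k a).card = 2 := by
    have := sumk (cls_subset : cls B k a ⊆ B)
    rw [cls_comm (m := k), cls_comm (m := k)] at this
    omega
  have n4 : (cls (cls B m s) k g).card = 2 := by
    have := sums (cls_subset : cls B m s ⊆ B); omega
  have n5 : (cls (cls B m r) k g).card = 6 := by
    have := sums (cls_subset : cls B m r ⊆ B); omega
  set Y := cls (cls B m r) k g with hY
  have YB : Y ⊆ B := cls_subset.trans cls_subset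
  have memY : ∀ t ∈ B, (t k).1 ≠ a → (t m).1 ≠ s → t ∈ Y := fun t ht h1 h2 =>
    mem_cls.2 ⟨mem_cls.2 ⟨ht, (h.two hmK (BU hz) (BU hz'.1) hzz'.symm t (BU ht)).resolve_left h2⟩,
      (h.two hkK (BU hz) (BU hξ.1) hξk.symm t (BU ht)).resolve_left h1⟩
  have hYm : ∀ t ∈ Y, (t m).1 = r := fun t ht => (mem_cls.1 (cls_subset (A := cls B m r) ht)).2
  have hYk : ∀ t ∈ Y, (t k).1 = g := fun t ht => (mem_cls.1 ht).2
  obtain ⟨p, q, hpq, epq, fj, fm, fk, apq, -⟩ := h.cell hj hm hk n3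
  have hp : p ∈ B ∧ (p m).1 = r ∧ (p k).1 = a := by
    have : p ∈ cls (cls B m r) k a := by rw [epq]; simp
    simpa [and_assoc] using this
  have hq : q ∈ B ∧ (q m).1 = r ∧ (q k).1 = a := by
    have : q ∈ cls (cls B m r) k a := by rw [epq]; simp
    simpa [and_assoc] using this
  have one : ∀ b, ∃ t ∈ Y, t k ≠ b := by
    by_contra! hc
    obtain ⟨b, hb⟩ := hc
    obtain ⟨t, ht⟩ := Finset.card_pos.1 (show 0 < Y.card by omega)
    refine (hS.blk_rel₂ hj hm c r).not_one_letter sgn_blk₂ hk (mem_cls.2 ⟨hp.1, hp.2.1⟩)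
      (mem_cls.2 ⟨hq.1, hq.2.1⟩) fk (s := b) (fun t ht => ?_) ?_
    · rcases h.two hkK (BU hz) (BU hξ.1) hξk.symm t (BU (cls_subset ht)) with e | e
      · have : t ∈ cls (cls B m r) k a := mem_cls.2 ⟨ht, e⟩
        rw [epq] at this
        simp only [Finset.mem_insert, Finset.mem_singleton] at this
        exact this.imp_right Or.inl
      · exact Or.inr (Or.inr (hb t (mem_cls.2 ⟨ht, e⟩)))
    · rw [hp.2.2, ← hb t ht, hYk t ht]; exact hξk.symm
  -- a coordinate where a word of `Y` has another class
  have dich : ∀ l ∉ insert k (insert m (insert j K)), ∀ t ∈ Y, (t l).1 ≠ (z l).1 →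
      cls B l (t l).1 ⊆ Y ∧ 4 ≤ (cls B l (t l).1).card ∧ (cls B l (t l).1).card ≠ 6 ∧
        (cls B l (t l).1).card % 2 = 0 := by
    intro l hl t ht htl
    have hl' := hl
    simp only [Set.mem_insert_iff, not_or] at hl'
    have hlj : l ∉ insert j K := by simp [hl']
    have sub : cls B l (t l).1 ⊆ Y := by
      intro x hx
      rw [mem_cls] at hx
      refine memY x hx.1 (fun e => ?_) fun e => ?_
      · rw [← hx.2, ← ga x (mem_cls.2 ⟨hx.1, e⟩) l (by simp [hl'])] at htl
        exact htl rfl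
      · rw [← hx.2, ← gs x (mem_cls.2 ⟨hx.1, e⟩) l (by simp [hl'])] at htl
        exact htl rfl
    refine ⟨sub, h.four_le hj hlj (YB ht), fun h6 => ?_, hS.even_cls_blk hj hlj _⟩
    have eY : cls B l (t l).1 = Y := Finset.eq_of_subset_of_card_le sub (by omega)
    have s1 := h.sum BU hl'.2.2.2 (BU hz) (BU (YB ht)) htl.symm
    have c6 : (cls B l (z l).1).card = 6 := by omega
    have memn : ∀ x ∈ B, x ∉ Y → x ∈ cls B l (z l).1 := fun x hx hxY => mem_cls.2 ⟨hx,
      (h.two hl'.2.2.2 (BU hz) (BU (YB ht)) htl.symm x (BU hx)).resolve_right fun e =>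
        hxY (eY ▸ mem_cls.2 ⟨hx, e⟩)⟩
    have c2 : (cls (cls B l (z l).1) k g).card = 2 := by
      rw [← n4]
      congr 1
      ext x
      simp only [mem_cls]
      constructor
      · rintro ⟨⟨hx, e1⟩, e2⟩
        refine ⟨⟨hx, ?_⟩, e2⟩
        by_contra hn
        have : x ∈ Y := memY x hx (by rw [e2]; exact hξk) hn
        rw [← eY] at this
        exact htl ((mem_cls.1 this).2.symm.trans e1)
      · rintro ⟨⟨hx, e1⟩, e2⟩
        exact ⟨mem_cls.1 (memn x hx fun hxY => hzz' ((hYm x hxY).symm.trans e1)), e2⟩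
    have hkl : k ∉ insert l (insert j K) := by
      simp only [Set.mem_insert_iff, not_or] at hk' ⊢
      exact ⟨fun e => hl'.1 e.symm, hk'⟩
    obtain ⟨i, w₁, w₂, w₃, w₄, w₅, w₆, hU, H, e1⟩ := (hS.blk_rel₂ hj hlj c (z l).1).hexa_at
      sgn_blk₂ (hS.blk_red₂ hj hlj (h.noDT _ _ _ _)) c6 hkl c2
    have mU : ∀ x ∈ ({w₁, w₂, w₃, w₄, w₅, w₆} : Finset (ι → C × Bool)), x ∈ B ∧
        x ∉ Y := fun x hx => by
      rw [← hU] at hx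
      refine ⟨cls_subset hx, fun hxY => ?_⟩
      rw [← eY] at hxY
      exact htl ((mem_cls.1 hxY).2.symm.trans (mem_cls.1 hx).2)
    have a1 : (w₁ m).1 = s := by
      by_contra hn
      exact (mU w₁ (by simp)).2 (memY _ (mU w₁ (by simp)).1 (by rw [e1]; exact hξk) hn)
    have a4 : (w₄ k).1 = a := by
      by_contra hn
      have := (h.two hkK (BU hz) (BU hξ.1) hξk.symm w₄ (BU (mU w₄ (by simp)).1)).resolve_left hn
      exact H.l3 (by rw [← H.l4, this, e1])
    have a5 : (w₅ k).1 = a := by rw [H.l5, ← H.l4, a4]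
    have hi : i = m := by
      by_contra hi
      have hex : ∃ x ∈ ({w₁, w₂, w₃, w₄, w₅, w₆} : Finset (ι → C × Bool)), (x m).1 = r :=
        ⟨p, by
          rw [← hU]
          exact memn p hp.1 fun hpY => hξk ((hYk p hpY).symm.trans hp.2.2), hp.2.1⟩
      obtain ⟨x, hx, hxr⟩ := hex
      have := H.agr x hx m (by
        simp only [Set.mem_insert_iff, not_or] at hm ⊢
        exact ⟨Ne.symm hi, hmk, fun e => hl'.2.1 e.symm, hm⟩)
      exact hzz' (by rw [← hxr, ← this, a1])
    subst hi
    have m4 : (w₄ i).1 = r := (h.two hmK (BU hz) (BU hz'.1) hzz'.symm w₄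
      (BU (mU w₄ (by simp)).1)).resolve_left (by have := H.m4; rw [a1] at this; exact this)
    have m5 : (w₅ i).1 = r := by rw [H.m5, flp_fst, m4]
    have p4 : w₄ ∈ ({p, q} : Finset (ι → C × Bool)) := by
      rw [← epq]; exact mem_cls.2 ⟨mem_cls.2 ⟨(mU w₄ (by simp)).1, m4⟩, a4⟩
    have p5 : w₅ ∈ ({p, q} : Finset (ι → C × Bool)) := by
      rw [← epq]; exact mem_cls.2 ⟨mem_cls.2 ⟨(mU w₅ (by simp)).1, m5⟩, a5⟩
    have e45 : w₄ k = w₅ k := by rw [H.l4, H.l5]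
    have n45 := H.ne₄₅
    simp only [Finset.mem_insert, Finset.mem_singleton] at p4 p5
    rcases p4 with rfl | rfl <;> rcases p5 with rfl | rfl
    · exact n45 rfl
    · rw [fk] at e45; exact flp_ne _ e45.symm
    · rw [fk] at e45; exact flp_ne _ e45
    · exact n45 rfl
  by_cases hex : ∃ l ∉ insert k (insert m (insert j K)), ∃ t ∈ Y, (t l).1 ≠ (z l).1
  · obtain ⟨l, hl, t, ht, htl⟩ := hex
    obtain ⟨sub, d1, d2, d3⟩ := dich l hl t ht htl
    have d4 := Finset.card_le_card sub
    have d5 : (cls B l (t l).1).card = 4 := by omega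
    simp only [Set.mem_insert_iff, not_or] at hl
    have hlj : l ∉ insert j K := by simp [hl]
    obtain ⟨i, hi, x, hx, x', hx', hxx⟩ := (hS.blk_rel₂ hj hlj c (t l).1).exists_ne sgn_blk₂
      (hS.blk_red₂ hj hlj (h.noDT _ _ _ _)) (Finset.card_pos.1 (by rw [← hBdef]; omega))
    have hik : i ≠ k := by
      rintro rfl; exact hxx ((hYk x (sub hx)).trans (hYk x' (sub hx')).symm)
    have him : i ≠ m := by
      rintro rfl; exact hxx ((hYm x (sub hx)).trans (hYm x' (sub hx')).symm)
    have hi' := hi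
    simp only [Set.mem_insert_iff, not_or] at hi'
    obtain ⟨u, hu, u', hu', huu, huz⟩ : ∃ u ∈ cls B l (t l).1, ∃ u' ∈ cls B l (t l).1,
        (u i).1 ≠ (u' i).1 ∧ (u i).1 ≠ (z i).1 := by
      by_cases e : (x i).1 = (z i).1
      · exact ⟨x', hx', x, hx, hxx.symm, by rw [← e]; exact hxx.symm⟩
      · exact ⟨x, hx, x', hx', hxx, e⟩
    obtain ⟨g1, q2⟩ := (hS.blk_rel₂ hj hlj c (t l).1).quad_agr sgn_blk₂
      (hS.blk_red₂ hj hlj (h.noDT _ _ _ _)) d5 hi hu hu' huu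
    obtain ⟨sub', f1, f2, f3⟩ := dich i (by
      simp only [Set.mem_insert_iff, not_or]; exact ⟨hik, him, hi'.2⟩) u (sub hu) huz
    have f4 := Finset.card_le_card sub'
    have f5 : (cls B i (u i).1).card = 4 := by omega
    have hij : i ∉ insert j K := by simp [hi']
    have hul := (mem_cls.1 hu).2
    rw [cls_comm, ← hBdef] at q2
    obtain ⟨u₂, hu₂, hul₂⟩ := exists_fst_ne (A := cls B i (u i).1) (k := l) (a := (t l).1)
      (by omega)
    obtain ⟨g2, -⟩ := (hS.blk_rel₂ hj hij c (u i).1).quad_agr sgn_blk₂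
      (hS.blk_red₂ hj hij (h.noDT _ _ _ _)) f5 (k := l) (by
        simp only [Set.mem_insert_iff, not_or]
        exact ⟨fun e => hi'.1 e.symm, by simp [hl]⟩) (mem_cls.2 ⟨cls_subset hu, rfl⟩) hu₂
      (by rw [hul]; exact hul₂.symm)
    have hinter : cls B l (t l).1 ∩ cls B i (u i).1 = cls (cls B i (u i).1) l (t l).1 := by
      ext x; simp only [Finset.mem_inter, mem_cls]; tauto
    have hun := Finset.card_union_add_card_inter (cls B l (t l).1) (cls B i (u i).1)
    rw [hinter] at hun
    have eY : cls B l (t l).1 ∪ cls B i (u i).1 = Y :=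
      Finset.eq_of_subset_of_card_le (Finset.union_subset sub sub') (by omega)
    obtain ⟨x, hx, hxu⟩ := one (u k)
    rw [← eY, Finset.mem_union] at hx
    refine hxu ?_
    rcases hx with hx | hx
    · exact (g1 x hx k (by simp [hik.symm, Ne.symm hl.1, hkj, hkK])).symm
    · exact (g2 x hx k (by simp [hik.symm, Ne.symm hl.1, hkj, hkK])).symm
  · push Not at hex
    have hZ : ∀ t ∈ B, t ∉ Y → ∀ l ∉ insert k (insert m (insert j K)), t l = z l := by
      intro t ht htY l hl
      by_cases e : (t k).1 = a
      · rw [Set.insert_comm] at hl; exact (ga t (mem_cls.2 ⟨ht, e⟩) l hl).symm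
      · by_cases e' : (t m).1 = s
        · exact (gs t (mem_cls.2 ⟨ht, e'⟩) l hl).symm
        · exact absurd (memY t ht e e') htY
    have hYz : ∀ t ∈ Y, Agr (insert k (insert m (insert j K))) z t := by
      intro t ht l hl
      rcases eq_or_eq_flp (hex l hl t ht) with e | e
      · exact e.symm
      exfalso
      have hl' := hl
      simp only [Set.mem_insert_iff, not_or] at hl'
      have hlj : l ∉ insert j K := by simp [hl']
      have cl : ∀ x ∈ B, (x l).1 = (z l).1 := fun x hx => by
        by_cases hxY : x ∈ Y
        · exact hex l hl x hxY
        · rw [hZ x hx hxY l hl]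
      have R := (hS.blk_rel hj c).fib_of_const hlj (s := flp (z l)) cl
      have D : Red (insert l (insert j K)) (fib (blk V W j c) l (flp (z l))) (dsgn (sg V) j) := by
        intro w hw v hv e
        have : dsgn (sg V) j w * bit (w l) = dsgn (sg V) j v * bit (v l) :=
          hS.blk_red₂ hj hlj (h.noDT j l c (z l).1) w
            (mem_cls.2 ⟨fib_subset hw, by rw [(mem_fib.1 hw).2]; rfl⟩) v
            (mem_cls.2 ⟨fib_subset hv, by rw [(mem_fib.1 hv).2]; rfl⟩) e
        rw [(mem_fib.1 hw).2, (mem_fib.1 hv).2] at this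
        rcases bit_eq (flp (z l)) with e | e <;> rw [e] at this <;> linarith
      obtain ⟨i, hi, x, hx, x', hx', hxx⟩ := R.exists_ne (sgn_sg.dsgn j) D
        ⟨t, mem_fib.2 ⟨YB ht, e⟩⟩
      have inY : ∀ x ∈ fib (blk V W j c) l (flp (z l)), x ∈ Y := fun x hx => by
        by_contra hn
        have := hZ x (fib_subset hx) hn l hl
        rw [(mem_fib.1 hx).2] at this
        exact flp_ne _ this
      have h1 := inY x hx
      have h2 := inY x' hx'
      by_cases hik : i = k
      · subst hik; exact hxx ((hYk x h1).trans (hYk x' h2).symm)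
      by_cases him : i = m
      · subst him; exact hxx ((hYm x h1).trans (hYm x' h2).symm)
      simp only [Set.mem_insert_iff, not_or] at hi
      have hi' : i ∉ insert k (insert m (insert j K)) := by simp [hik, him, hi]
      exact hxx ((hex i hi' x h1).trans (hex i hi' x' h2).symm)
    have hzp : Agr (insert k (insert m (insert j K))) z p := fun l hl =>
      (hZ p hp.1 (fun e => hξk ((hYk p e).symm.trans hp.2.2)) l hl).symm
    have R := hS.blk_rel₂ hj hm c r
    have D := hS.blk_red₂ hj hm (h.noDT j m c r)
    rw [← hBdef] at R D
    have YU : Y ⊆ cls B m r := cls_subset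
    have pU : p ∈ cls B m r := mem_cls.2 ⟨hp.1, hp.2.1⟩
    have count : ∀ b : C × Bool, b.1 = g → (fib Y k b).card ≤ 1 := by
      intro b hb
      by_contra hlt
      obtain ⟨t₀, ht₀⟩ := Finset.card_pos.1 (show 0 < (fib Y k b).card by omega)
      obtain ⟨y, hy⟩ := exists_cov p (insert m (insert j K))
      have h1 := R (upd y k b)
      have pk : (p k).1 ≠ b.1 := by rw [hp.2.2, hb]; exact hξk.symm
      have py := (cov_upd_of_ne (s := b) pk).2 hy
      have pY : p ∉ fib Y k b := fun e => pk (by rw [(mem_fib.1 e).2])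
      rw [← Finset.sum_subset (s₁ := insert p (fib Y k b))
        (Finset.insert_subset pU (fib_subset.trans YU))] at h1
      · have : ∀ t ∈ fib Y k b, (if Cov (insert m (insert j K)) t (upd y k b) then
            dsgn (dsgn (sg V) j) m t else 0) = dsgn (dsgn (sg V) j) m t₀ := by
          intro t ht
          rw [if_pos]
          · rw [mem_fib] at ht ht₀
            refine D t (YU ht.1) t₀ (YU ht₀.1) ?_
            exact agr_of_insert ((hYz t ht.1).symm.trans (hYz t₀ ht₀.1)) (ht.2.trans ht₀.2.symm)
          · rw [cov_upd_self hk (mem_fib.1 ht).2]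
            exact (hzp.symm.trans (hYz t (fib_subset ht))).cov (cov_insert_of_cov hy)
        rw [Finset.sum_insert pY, if_pos py, Finset.sum_congr rfl this, Finset.sum_const,
          nsmul_eq_mul] at h1
        have e1 := sgn_blk₂ (U := B) (V := V) (j := j) (k := m) p hp.1
        have e2 := sgn_blk₂ (U := B) (V := V) (j := j) (k := m) t₀ (YB (fib_subset ht₀))
        rcases e1 with e1 | e1 <;> rcases e2 with e2 | e2 <;> rw [e1, e2] at h1 <;> omega
      · intro t ht htn
        rw [if_neg]
        intro hc
        refine htn ?_
        rcases h.two hkK (BU hz) (BU hξ.1) hξk.symm t (BU (cls_subset ht)) with e | e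
        · have : t ∈ cls (cls B m r) k a := mem_cls.2 ⟨ht, e⟩
          rw [epq] at this
          simp only [Finset.mem_insert, Finset.mem_singleton] at this
          rcases this with rfl | rfl
          · simp
          · rw [cov_upd_of_ne (s := b) (by rw [hq.2.2, hb]; exact hξk.symm)] at hc
            exact absurd (by rw [fk]) (hy.ne_flp hk hc)
        · refine Finset.mem_insert_of_mem (mem_fib.2 ⟨mem_cls.2 ⟨ht, e⟩, ?_⟩)
          rcases eq_or_eq_flp (s := t k) (t := b) (e.trans hb.symm) with e | e
          · exact e
          · exact absurd hc (not_cov_upd hk e)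
    have e6 : cls Y k g = Y := Finset.filter_true_of_mem hYk
    have := card_cls (A := Y) (l := k) (s := ξ k)
    rw [← hg, e6] at this
    have := count (ξ k) hg.symm
    have := count (flp (ξ k)) hg.symm
    omega

end

section

variable {K : Set ι} {w v u t t₁ t₂ p q z r x w₁ w₂ w₃ w₄ w₅ w₆ : ι → C × Bool} {y : ι → C → Bool}
  {A B U V W X : Finset (ι → C × Bool)} {σ τ : (ι → C × Bool) → ℤ} {j k l m : ι} {a c : C}

/-- Six words of class `s` at `m` inside a block. -/
structure Half (K : Set ι) (V W : Finset (ι → C × Bool)) (j m k l : ι) (c s a d : C)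
    (e f : C × Bool) (x : ι → C × Bool) (w : Fin 6 → ι → C × Bool) : Prop where
  hj : j ∉ K
  hm : m ∉ K
  hk : k ∉ K
  hl : l ∉ K
  mem : ∀ i, w i ∈ V ∪ W
  agr : ∀ i, Agr (insert l (insert k (insert m (insert j K)))) x (w i)
  jc : ∀ i, (w i j).1 = c
  ms : ∀ i, (w i m).1 = s
  k0 : (w 0 k).1 = a
  k1 : w 1 k = flp (w 0 k)
  k2 : w 2 k = e
  k3 : w 3 k = e
  k4 : w 4 k = e
  k5 : w 5 k = flp e
  l0 : w 0 l = f
  l1 : w 1 l = f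
  l2 : w 2 l = flp f
  l3 : (w 3 l).1 = d
  l4 : w 4 l = flp (w 3 l)
  l5 : w 5 l = f
  ea : e.1 ≠ a
  df : d ≠ f.1
  j01 : w 1 j = flp (w 0 j)
  m01 : w 1 m = flp (w 0 m)
  j34 : w 4 j = flp (w 3 j)
  m34 : w 4 m = flp (w 3 m)
  s01 : w 0 ∈ V ∧ w 1 ∈ V ∨ w 0 ∈ W ∧ w 1 ∈ W
  s34 : w 3 ∈ V ∧ w 4 ∈ V ∨ w 3 ∈ W ∧ w 4 ∈ W

section Half

variable {s r d : C} {e f : C × Bool} {P Q : Fin 6 → ι → C × Bool}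

theorem Half.symm (H : Half K V W j m k l c s a d e f x P) : Half K W V j m k l c s a d e f x P :=
  { H with
    mem := fun i => by rw [Finset.union_comm]; exact H.mem i
    s01 := H.s01.symm
    s34 := H.s34.symm }

theorem Half.ne_of_flp (H : Half K V W j m k l c s a d e f x P)
    (H' : Half K V W j m k l c r a d e f x Q) (hsr : s ≠ r) {i : ι} {α β : Fin 6}
    (hi : i ∉ K) (h : Q β i = flp (P α i)) (hk : Q β k ≠ flp (P α k))
    (hl : Q β l ≠ flp (P α l)) : i = j := by
  by_contra hij
  by_cases e1 : i = m
  · subst e1; exact hsr (by rw [← H.ms α, ← H'.ms β, h, flp_fst])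
  by_cases e2 : i = k
  · subst e2; exact hk h
  by_cases e3 : i = l
  · subst e3; exact hl h
  have hi' : i ∉ (insert l (insert k (insert m (insert j K))) : Set ι) := by simp_all
  rw [← H.agr α i hi', ← H'.agr β i hi'] at h
  exact flp_ne _ h.symm

theorem Half.opp (H : Half K V W j m k l c s a d e f x P)
    (H' : Half K V W j m k l c r a d e f x Q) (hsr : s ≠ r) (hX : Code K X) {α α' β : Fin 6}
    (h1 : P α ∈ X) (h2 : P α' ∈ X) (h3 : Q β ∈ X) (fj : P α' j = flp (P α j))
    (k1 : Q β k ≠ flp (P α k)) (k2 : Q β k ≠ flp (P α' k)) (l1 : Q β l ≠ flp (P α l))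
    (l2 : Q β l ≠ flp (P α' l)) : False := by
  have ne : ∀ α, P α ≠ Q β := fun α e => hsr (by rw [← H.ms α, ← H'.ms β, e])
  obtain ⟨i, hi, e⟩ := hX _ h1 _ h3 (ne α)
  obtain ⟨i', hi', e'⟩ := hX _ h2 _ h3 (ne α')
  obtain rfl := H.ne_of_flp H' hsr hi e k1 l1
  obtain rfl := H.ne_of_flp H' hsr hi' e' k2 l2
  rw [e, flp_inj, fj] at e'
  exact flp_ne _ e'.symm

theorem Half.opp₀ (H : Half K V W j m k l c s a d e f x P)
    (H' : Half K V W j m k l c r a d e f x Q) (hsr : s ≠ r) (hX : Code K X)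
    (h1 : P 3 ∈ X) (h2 : P 4 ∈ X) (h3 : Q 0 ∈ X) : False := by
  have ea := H.ea
  have df := H.df
  refine H.opp H' hsr hX h1 h2 h3 H.j34 ?_ ?_ ?_ ?_
  · intro e; rw [H.k3] at e; exact ea (by rw [← H'.k0, e]; rfl)
  · intro e; rw [H.k4] at e; exact ea (by rw [← H'.k0, e]; rfl)
  · intro e; rw [H'.l0] at e; exact df (by rw [e, flp_fst, H.l3])
  · intro e; rw [H'.l0] at e; exact df (by rw [e, H.l4, flp_flp, H.l3])

theorem Half.opp₂ (H : Half K V W j m k l c s a d e f x P)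
    (H' : Half K V W j m k l c r a d e f x Q) (hsr : s ≠ r) (hX : Code K X)
    (h1 : P 3 ∈ X) (h2 : P 4 ∈ X) (h3 : Q 2 ∈ X) : False := by
  have df := H.df
  refine H.opp H' hsr hX h1 h2 h3 H.j34 ?_ ?_ ?_ ?_
  · rw [H.k3, H'.k2]; exact (flp_ne _).symm
  · rw [H.k4, H'.k2]; exact (flp_ne _).symm
  · intro e; rw [H'.l2, flp_inj] at e; exact df (by rw [e, H.l3])
  · intro e; rw [H'.l2, flp_inj, H.l4] at e; exact df (by rw [e, flp_fst, H.l3])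

theorem Half.opp₅ (H : Half K V W j m k l c s a d e f x P)
    (H' : Half K V W j m k l c r a d e f x Q) (hsr : s ≠ r) (hX : Code K X)
    (h1 : P 0 ∈ X) (h2 : P 1 ∈ X) (h3 : Q 5 ∈ X) : False := by
  have ea := H.ea
  refine H.opp H' hsr hX h1 h2 h3 H.j01 ?_ ?_ ?_ ?_
  · intro e; rw [H'.k5, flp_inj] at e; exact ea (by rw [e, H.k0])
  · intro e; rw [H'.k5, flp_inj] at e; exact ea (by rw [e, H.k1, flp_fst, H.k0])
  · rw [H.l0, H'.l5]; exact (flp_ne _).symm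
  · rw [H.l1, H'.l5]; exact (flp_ne _).symm

theorem Code.dich_cov (hX : Code K X) (hz : z ∈ X) (hr : t ∈ X) (hzy : Cov K z y) (hne : z ≠ t) :
    ∃ i ∉ K, t i = flp (z i) ∧ y i (t i).1 ≠ (t i).2 := by
  obtain ⟨i, hi, e⟩ := hX z hz t hr hne
  refine ⟨i, hi, e, fun h => ?_⟩
  have := hzy i hi
  rw [e, flp_fst, this, flp_snd] at h
  revert h
  cases (z i).2 <;> decide

/-- A word of another class at `j` is separated from a word of a half only at `k`, `l`, `m`. -/
theorem Half.sep (H : Half K V W j m k l c s a d e f x P) (hX : Code K X) (hz : z ∈ X)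
    (hzy : Cov K z y) (hzj : (z j).1 ≠ c)
    (hx : ∀ i, i ∉ (insert l (insert k (insert m (insert j K))) : Set ι) → y i (x i).1 = (x i).2) {α : Fin 6}
    (hα : P α ∈ X) : ∃ i, (i = m ∨ i = k ∨ i = l) ∧ P α i = flp (z i) ∧
      y i (P α i).1 ≠ (P α i).2 := by
  obtain ⟨i, hi, e, hy⟩ := hX.dich_cov hz hα hzy (fun e => hzj (by rw [e, H.jc]))
  refine ⟨i, ?_, e, hy⟩
  by_contra hn
  by_cases e1 : i = j
  · subst e1; exact hzj (by rw [← H.jc α, e, flp_fst])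
  have hi' : i ∉ (insert l (insert k (insert m (insert j K))) : Set ι) := by
    simp only [not_or] at hn; simp_all
  exact hy (by rw [← H.agr α i hi', hx i hi'])

theorem upd_apply_self {s : C × Bool} : upd y l s l s.1 = s.2 := by simp [upd]

theorem upd_apply_of_ne {s : C × Bool} {i : ι} {c : C} (h : i ≠ l ∨ c ≠ s.1) :
    upd y l s i c = y i c := by
  rw [upd, if_neg]; tauto

/-- Both pairs on the same side. -/
theorem Half.not_same (h : St K V W) (H : Half K V W j m k l c s a d e f x P)
    (H' : Half K V W j m k l c r a d e f x Q) (hsr : s ≠ r) (hd : Disjoint V W)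
    (hmk : m ≠ k) (hml : m ≠ l) (hkl : k ≠ l)
    (all : ∀ t ∈ V ∪ W, (t j).1 = c → ∃ i, t = P i ∨ t = Q i)
    (hP : P 0 ∈ V ∧ P 1 ∈ V) (hQ : Q 0 ∈ V ∧ Q 1 ∈ V) : False := by
  have p34 := H.s34.resolve_left fun e => H.opp₀ H' hsr h.cV e.1 e.2 hQ.1
  have q34 := H'.s34.resolve_left fun e => H'.opp₀ H hsr.symm h.cV e.1 e.2 hP.1
  obtain ⟨s₁, hs₁, e3, e4⟩ := exists_avoid (q := P 4) (p := P 3) H.m34 H.l4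
    (s := P 0 m) (by rw [H.ms, H.ms])
  obtain ⟨s₂, hs₂, e3', e4'⟩ := exists_avoid (q := Q 4) (p := Q 3) H'.l4 H'.m34
    (s := s₁) (by rw [hs₁, H.l3, H'.l3])
  rw [H.l3] at hs₁
  rw [H'.ms] at hs₂
  obtain ⟨y₀, hy₀⟩ := exists_cov (P 0) K
  set y := upd (upd (upd y₀ k e) l s₁) m s₂ with hy
  have c0 : Cov K (P 0) y := by
    rw [hy, cov_upd_of_ne (by rw [H.ms, hs₂]; exact hsr),
      cov_upd_of_ne (by rw [H.l0, hs₁]; exact H.df.symm),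
      cov_upd_of_ne (by rw [H.k0]; exact H.ea.symm)]
    exact hy₀
  have yk : y k e.1 = e.2 := by
    rw [hy, upd_apply_of_ne (Or.inl hmk.symm), upd_apply_of_ne (Or.inl hkl), upd_apply_self]
  have yl : y l s₁.1 = s₁.2 := by
    rw [hy, upd_apply_of_ne (Or.inl hml.symm), upd_apply_self]
  have ym : y m s₂.1 = s₂.2 := upd_apply_self
  have ym0 := c0 m H.hm
  have yf := c0 l H.hl
  rw [H.l0] at yf
  have hx : ∀ i, i ∉ (insert l (insert k (insert m (insert j K))) : Set ι) →
      y i (x i).1 = (x i).2 := fun i hi => by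
    rw [H.agr 0 i hi]
    exact c0 i (fun e => hi (by simp [e]))
  have miss : ∀ {t : ι → C × Bool} {i : ι} {b : C × Bool}, i ∉ K → y i b.1 = b.2 → t i = flp b →
      ¬ Cov K t y := by
    intro t i b hi hb e hc
    have := hc i hi
    rw [e, flp_fst, hb, flp_snd] at this
    revert this
    cases b.2 <;> decide
  obtain ⟨z, hz, hzy⟩ := (h.cov y).1 ⟨_, hP.1, c0⟩
  by_cases hzj : (z j).1 = c
  · obtain ⟨i, hi⟩ := all z (Finset.mem_union_right _ hz) hzj
    have nV := Finset.disjoint_right.1 hd hz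
    fin_cases i <;> rcases hi with rfl | rfl
    · exact nV hP.1
    · exact nV hQ.1
    · exact nV hP.2
    · exact nV hQ.2
    · exact miss H.hl yf H.l2 hzy
    · exact miss H.hl yf H'.l2 hzy
    · exact e3.elim (fun e => miss H.hm ym0 e hzy) fun e => miss H.hl yl e hzy
    · exact e3'.elim (fun e => miss H.hl yl e hzy) fun e => miss H.hm ym e hzy
    · exact e4.elim (fun e => miss H.hm ym0 e hzy) fun e => miss H.hl yl e hzy
    · exact e4'.elim (fun e => miss H.hl yl e hzy) fun e => miss H.hm ym e hzy
    · exact miss H.hk yk H.k5 hzy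
    · exact miss H.hk yk H'.k5 hzy
  · have g : ∀ α, P α ∈ W → P α k = e → P α m = flp (z m) ∨ P α l = flp (z l) := by
      intro α hα hk
      obtain ⟨i, hi, e1, e2⟩ := H.sep h.cW hz hzy hzj hx hα
      rcases hi with rfl | rfl | rfl
      · exact Or.inl e1
      · rw [hk] at e2; exact absurd yk e2
      · exact Or.inr e1
    have g' : ∀ α, Q α ∈ W → Q α k = e → Q α m = flp (z m) ∨ Q α l = flp (z l) := by
      intro α hα hk
      obtain ⟨i, hi, e1, e2⟩ := H'.sep h.cW hz hzy hzj hx hα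
      rcases hi with rfl | rfl | rfl
      · exact Or.inl e1
      · rw [hk] at e2; exact absurd yk e2
      · exact Or.inr e1
    have z1 := (class_of_two H.m34 H.l4 (g 3 p34.1 H.k3) (g 4 p34.2 H.k4)).1
    have z2 := (class_of_two H'.m34 H'.l4 (g' 3 q34.1 H'.k3) (g' 4 q34.2 H'.k4)).1
    rw [H.ms] at z1
    rw [H'.ms] at z2
    exact hsr (z1.symm.trans z2)

/-- The pairs on different sides. -/
theorem Half.not_diff (h : St K V W) (H : Half K V W j m k l c s a d e f x P)
    (H' : Half K V W j m k l c r a d e f x Q) (hsr : s ≠ r) (hd : Disjoint V W)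
    (hmk : m ≠ k) (hml : m ≠ l) (hkl : k ≠ l)
    (all : ∀ t ∈ V ∪ W, (t j).1 = c → ∃ i, t = P i ∨ t = Q i)
    (hP : P 0 ∈ V ∧ P 1 ∈ V) (hQ : Q 0 ∈ W ∧ Q 1 ∈ W) : False := by
  have p34 := H.s34.resolve_right fun e => H.opp₀ H' hsr h.cW e.1 e.2 hQ.1
  have q34 := H'.s34.resolve_left fun e => H'.opp₀ H hsr.symm h.cV e.1 e.2 hP.1
  have q2 : Q 2 ∈ W := (Finset.mem_union.1 (H'.mem 2)).resolve_left fun e =>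
    H.opp₂ H' hsr h.cV p34.1 p34.2 e
  have p2 : P 2 ∈ V := (Finset.mem_union.1 (H.mem 2)).resolve_right fun e =>
    H'.opp₂ H hsr.symm h.cW q34.1 q34.2 e
  have p5 : P 5 ∈ V := (Finset.mem_union.1 (H.mem 5)).resolve_right fun e =>
    H'.opp₅ H hsr.symm h.cW hQ.1 hQ.2 e
  obtain ⟨s₁, hs₁, e3, e4⟩ := exists_avoid (q := Q 4) (p := Q 3) H'.m34 H'.l4
    (s := Q 2 m) (by rw [H'.ms, H'.ms])
  obtain ⟨s₂, hs₂, e3', e4'⟩ := exists_avoid (q := Q 1) (p := Q 0) H'.m01 H'.k1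
    (s := Q 2 m) (by rw [H'.ms, H'.ms])
  rw [H'.l3] at hs₁
  rw [H'.k0] at hs₂
  obtain ⟨α, hα, hαk, hαl⟩ : ∃ α, P α ∈ V ∧ P α k = s₂ ∧ P α l = f := by
    rcases eq_or_eq_flp (hs₂.trans H.k0.symm) with e | e
    · exact ⟨0, hP.1, e.symm, H.l0⟩
    · exact ⟨1, hP.2, by rw [H.k1, e], H.l1⟩
  obtain ⟨y₀, hy₀⟩ := exists_cov (P α) K
  set y := upd (upd (upd y₀ k e) l s₁) m (Q 2 m) with hy
  have c0 : Cov K (P α) y := by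
    rw [hy, cov_upd_of_ne (by rw [H.ms, H'.ms]; exact hsr),
      cov_upd_of_ne (by rw [hαl, hs₁]; exact H.df.symm),
      cov_upd_of_ne (by rw [hαk, hs₂]; exact H.ea.symm)]
    exact hy₀
  have yk : y k e.1 = e.2 := by
    rw [hy, upd_apply_of_ne (Or.inl hmk.symm), upd_apply_of_ne (Or.inl hkl), upd_apply_self]
  have yl : y l s₁.1 = s₁.2 := by
    rw [hy, upd_apply_of_ne (Or.inl hml.symm), upd_apply_self]
  have ym : y m (Q 2 m).1 = (Q 2 m).2 := upd_apply_self
  have ya := c0 k H.hk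
  have yf := c0 l H.hl
  rw [hαk] at ya
  rw [hαl] at yf
  have hx : ∀ i, i ∉ (insert l (insert k (insert m (insert j K))) : Set ι) →
      y i (x i).1 = (x i).2 := fun i hi => by
    rw [H.agr α i hi]
    exact c0 i (fun e => hi (by simp [e]))
  have miss : ∀ {t : ι → C × Bool} {i : ι} {b : C × Bool}, i ∉ K → y i b.1 = b.2 → t i = flp b →
      ¬ Cov K t y := by
    intro t i b hi hb e hc
    have := hc i hi
    rw [e, flp_fst, hb, flp_snd] at this
    revert this
    cases b.2 <;> decide
  obtain ⟨z, hz, hzy⟩ := (h.cov y).1 ⟨_, hα, c0⟩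
  by_cases hzj : (z j).1 = c
  · obtain ⟨i, hi⟩ := all z (Finset.mem_union_right _ hz) hzj
    have nV := Finset.disjoint_right.1 hd hz
    fin_cases i <;> rcases hi with rfl | rfl
    · exact nV hP.1
    · exact e3'.elim (fun e => miss H.hm ym e hzy) fun e => miss H.hk ya e hzy
    · exact nV hP.2
    · exact e4'.elim (fun e => miss H.hm ym e hzy) fun e => miss H.hk ya e hzy
    · exact nV p2
    · exact miss H.hl yf H'.l2 hzy
    · exact nV p34.1
    · exact e3.elim (fun e => miss H.hm ym e hzy) fun e => miss H.hl yl e hzy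
    · exact nV p34.2
    · exact e4.elim (fun e => miss H.hm ym e hzy) fun e => miss H.hl yl e hzy
    · exact nV p5
    · exact miss H.hk yk H'.k5 hzy
  · have g : ∀ α, Q α ∈ W → Q α k = e → Q α m = flp (z m) ∨ Q α l = flp (z l) := by
      intro α hα hk
      obtain ⟨i, hi, e1, e2⟩ := H'.sep h.cW hz hzy hzj hx hα
      rcases hi with rfl | rfl | rfl
      · exact Or.inl e1
      · rw [hk] at e2; exact absurd yk e2
      · exact Or.inr e1
    have g' : ∀ α, Q α ∈ W → Q α l = f → Q α m = flp (z m) ∨ Q α k = flp (z k) := by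
      intro α hα hk
      obtain ⟨i, hi, e1, e2⟩ := H'.sep h.cW hz hzy hzj hx hα
      rcases hi with rfl | rfl | rfl
      · exact Or.inl e1
      · exact Or.inr e1
      · rw [hk] at e2; exact absurd yf e2
    have z1 := (class_of_two H'.m34 H'.l4 (g 3 q34.1 H'.k3) (g 4 q34.2 H'.k4)).2
    obtain ⟨i, hi, e1, e2⟩ := H'.sep h.cW hz hzy hzj hx q2
    rcases hi with rfl | rfl | rfl
    · exact e2 ym
    · rw [H'.k2] at e2; exact e2 yk
    · rw [H'.l2, flp_inj] at e1
      rw [H'.l3, ← e1] at z1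
      exact H.df z1.symm

theorem Half.absurd (h : St K V W) (H : Half K V W j m k l c s a d e f x P)
    (H' : Half K V W j m k l c r a d e f x Q) (hsr : s ≠ r) (hd : Disjoint V W)
    (hmk : m ≠ k) (hml : m ≠ l) (hkl : k ≠ l)
    (all : ∀ t ∈ V ∪ W, (t j).1 = c → ∃ i, t = P i ∨ t = Q i) : False := by
  have all' : ∀ t ∈ W ∪ V, (t j).1 = c → ∃ i, t = P i ∨ t = Q i := by
    rw [Finset.union_comm]; exact all
  rcases H.s01 with hP | hP <;> rcases H'.s01 with hQ | hQ
  · exact H.not_same h H' hsr hd hmk hml hkl all hP hQ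
  · exact H.not_diff h H' hsr hd hmk hml hkl all hP hQ
  · exact H.symm.not_diff h.symm H'.symm hsr hd.symm hmk hml hkl all' hP hQ
  · exact H.symm.not_same h.symm H'.symm hsr hd.symm hmk hml hkl all' hP hQ

end Half

theorem Hexa.card₄ (H : Hexa K σ m l w₁ w₂ w₃ w₄ w₅ w₆) :
    cls {w₁, w₂, w₃, w₄, w₅, w₆} m (w₄ m).1 = {w₄, w₅} := by
  have e2 : (w₂ m).1 = (w₁ m).1 := by rw [H.m2]
  have e3 : (w₃ m).1 = (w₁ m).1 := by rw [H.m3, flp_fst]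
  have e5 : (w₅ m).1 = (w₄ m).1 := by rw [H.m5, flp_fst]
  have e6 : (w₆ m).1 = (w₁ m).1 := by rw [H.m6]
  ext x
  simp only [mem_cls, Finset.mem_insert, Finset.mem_singleton]
  constructor
  · rintro ⟨rfl | rfl | rfl | rfl | rfl | rfl, e⟩
    · exact absurd e.symm H.m4
    · exact absurd (e2.symm.trans e).symm H.m4
    · exact absurd (e3.symm.trans e).symm H.m4
    · simp
    · simp
    · exact absurd (e6.symm.trans e).symm H.m4
  · rintro (rfl | rfl) <;> simp [e5]

theorem Flat.cell_eq [Finite ι] (h : Flat K V W) (hj : j ∉ K) (hm : m ∉ insert j K)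
    (hk : k ∉ insert m (insert j K)) {c s a : C}
    (h2 : cls (cls (blk V W j c) m s) k a = {p, q}) (hpq : p ≠ q) :
    q j = flp (p j) ∧ q m = flp (p m) ∧ (p ∈ V ∧ q ∈ V ∨ p ∈ W ∧ q ∈ W) := by
  obtain ⟨p', q', -, e, fj, fm, -, -, hs⟩ := h.cell hj hm hk (by rw [h2, Finset.card_pair hpq])
  have hp : p ∈ ({p', q'} : Finset (ι → C × Bool)) := by rw [← e, h2]; simp
  have hq : q ∈ ({p', q'} : Finset (ι → C × Bool)) := by rw [← e, h2]; simp
  simp only [Finset.mem_insert, Finset.mem_singleton] at hp hq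
  rcases hp with rfl | rfl <;> rcases hq with rfl | rfl
  · exact absurd rfl hpq
  · exact ⟨fj, fm, hs⟩
  · exact ⟨by rw [fj, flp_flp], by rw [fm, flp_flp], hs.imp And.symm And.symm⟩
  · exact absurd rfl hpq

theorem Flat.exists_half [Finite ι] (h : Flat K V W) (hj : j ∉ K) (hm : m ∉ insert j K)
    (hk : k ∉ insert m (insert j K)) {c s a : C} (h6 : (cls (blk V W j c) m s).card = 6)
    (h2 : (cls (cls (blk V W j c) m s) k a).card = 2) :
    ∃ l e f d P, Half K V W j m k l c s a d e f (P 0) P ∧ l ∉ insert k (insert m (insert j K)) ∧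
      ∀ t ∈ cls (blk V W j c) m s, ∃ i, t = P i := by
  obtain ⟨l, w₁, w₂, w₃, w₄, w₅, w₆, hU, H, ea⟩ := (h.toSt.blk_rel₂ hj hm c s).hexa_at
    sgn_blk₂ (h.toSt.blk_red₂ hj hm (h.noDT _ _ _ _)) h6 hk h2
  obtain ⟨hmK, hkK, hmk, hmj, hkj, hk', hm'⟩ := insert_not_mem₃ hm hk
  have hl : l ∉ insert k (insert m (insert j K)) := by
    have := H.hm; have := H.hml
    simp only [Set.mem_insert_iff, not_or] at *
    tauto
  have mU : ∀ x ∈ ({w₁, w₂, w₃, w₄, w₅, w₆} : Finset (ι → C × Bool)),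
      x ∈ V ∪ W ∧ (x j).1 = c ∧ (x m).1 = s := fun x hx => by
    rw [← hU, mem_cls, mem_blk, ← Finset.mem_union] at hx
    tauto
  have c4 := H.card₄
  have c1 := H.swap.card₄
  have eU : ({w₄, w₅, w₆, w₁, w₂, w₃} : Finset (ι → C × Bool)) = {w₁, w₂, w₃, w₄, w₅, w₆} := by
    ext; simp only [Finset.mem_insert, Finset.mem_singleton]; tauto
  rw [eU, ← hU] at c1
  rw [← hU] at c4
  have x1 := h.cell_eq hj hm hk c1 H.swap.ne₄₅
  have x4 := h.cell_eq hj hm (k := l) (by simp_all) c4 H.ne₄₅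
  refine ⟨l, w₃ k, w₁ l, (w₄ l).1, ![w₁, w₂, w₃, w₄, w₅, w₆], ?_, hl, fun t ht => ?_⟩
  · have ms : ∀ i : Fin 6, ![w₁, w₂, w₃, w₄, w₅, w₆] i ∈
        ({w₁, w₂, w₃, w₄, w₅, w₆} : Finset (ι → C × Bool)) := by
      intro i; fin_cases i <;> simp
    exact
      { hj := hj, hm := hmK, hk := hkK, hl := fun e => hl (by simp [e])
        mem := fun i => (mU _ (ms i)).1
        agr := fun i => (H.agr _ (ms i))
        jc := fun i => (mU _ (ms i)).2.1
        ms := fun i => (mU _ (ms i)).2.2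
        k0 := ea, k1 := H.l2, k2 := rfl, k3 := H.l4, k4 := H.l5, k5 := H.l6
        l0 := rfl, l1 := H.m2, l2 := H.m3, l3 := rfl, l4 := H.m5, l5 := H.m6
        ea := by rw [← ea]; exact H.l3
        df := H.m4
        j01 := x1.1, m01 := x1.2.1, j34 := x4.1, m34 := x4.2.1, s01 := x1.2.2, s34 := x4.2.2 }
  · rw [hU] at ht
    simp only [Finset.mem_insert, Finset.mem_singleton] at ht
    rcases ht with rfl | rfl | rfl | rfl | rfl | rfl
    exacts [⟨0, rfl⟩, ⟨1, rfl⟩, ⟨2, rfl⟩, ⟨3, rfl⟩, ⟨4, rfl⟩, ⟨5, rfl⟩]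

theorem Flat.not_four_six [Finite ι] (h : Flat K V W) (hj : j ∉ K) (hm : m ∉ insert j K)
    (hk : k ∉ insert m (insert j K)) (hz : z ∈ blk V W j c) (hv : v ∈ blk V W j c)
    (hzm : (z m).1 ≠ (v m).1) (hzk : (v k).1 = (z k).1)
    (ca : (cls (blk V W j c) k (z k).1).card = 4) (cs : (cls (blk V W j c) m (z m).1).card = 6)
    (cr : (cls (blk V W j c) m (v m).1).card = 6) : False := by
  set B := blk V W j c with hBdef
  have BU : B ⊆ V ∪ W := blk_subset
  obtain ⟨hmK, hkK, hmk, hmj, hkj, hk', hm'⟩ := insert_not_mem₃ hm hk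
  have hS := h.toSt
  obtain ⟨ga, n1⟩ := (hS.blk_rel₂ hj hk' c (z k).1).quad_agr sgn_blk₂
    (hS.blk_red₂ hj hk' (h.noDT _ _ _ _)) ca hm' (mem_cls.2 ⟨hz, rfl⟩) (mem_cls.2 ⟨hv, hzk⟩)
    hzm
  have n2 := ((hS.blk_rel₂ hj hk' c (z k).1).quad_agr sgn_blk₂
    (hS.blk_red₂ hj hk' (h.noDT _ _ _ _)) ca hm' (mem_cls.2 ⟨hv, hzk⟩) (mem_cls.2 ⟨hz, rfl⟩)
    hzm.symm).2
  rw [cls_comm] at n1 n2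
  obtain ⟨l, e, f, d, P, H, hl, hP⟩ := h.exists_half hj hm hk cs n1
  obtain ⟨l', e', f', d', Q, H', hl', hQ⟩ := h.exists_half hj hm hk cr n2
  have mP : ∀ i, P i ∈ B := fun i => mem_blk.2 ⟨Finset.mem_union.1 (H.mem i), H.jc i⟩
  have mQ : ∀ i, Q i ∈ B := fun i => mem_blk.2 ⟨Finset.mem_union.1 (H'.mem i), H'.jc i⟩
  have ag : Agr (insert k (insert m (insert j K))) (P 0) (Q 0) := by
    rw [Set.insert_comm]
    exact (ga _ (mem_cls.2 ⟨mP 0, H.k0⟩)).symm.trans (ga _ (mem_cls.2 ⟨mQ 0, H'.k0⟩))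
  have all : ∀ t ∈ B, ∃ i, t = P i ∨ t = Q i := fun t ht => by
    rcases h.two hmK (BU hz) (BU hv) hzm t (BU ht) with e | e
    · obtain ⟨i, hi⟩ := hP t (mem_cls.2 ⟨ht, e⟩); exact ⟨i, Or.inl hi⟩
    · obtain ⟨i, hi⟩ := hQ t (mem_cls.2 ⟨ht, e⟩); exact ⟨i, Or.inr hi⟩
  have hl₂ := hl
  simp only [Set.mem_insert_iff, not_or] at hl₂
  obtain rfl : l' = l := by
    by_contra hll
    have sub : cls B l d ⊆ {P 3, P 4} := by
      intro t ht
      rw [mem_cls] at ht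
      obtain ⟨i, rfl | rfl⟩ := all t ht.1
      · have := ht.2
        have df := H.df
        fin_cases i
        · exact absurd (this.symm.trans (by simp [H.l0])) df
        · exact absurd (this.symm.trans (by simp [H.l1])) df
        · exact absurd (this.symm.trans (by simp [H.l2])) df
        · simp
        · simp
        · exact absurd (this.symm.trans (by simp [H.l5])) df
      · refine absurd ?_ H.df
        rw [← ht.2, ← H'.agr i l (by simp [hl₂, Ne.symm hll]), ← ag l hl, H.l0]
    have c4 := h.four_le hj (by simp [hl₂]) (mP 3) (k := l)
    rw [H.l3] at c4
    have := Finset.card_le_card sub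
    have := Finset.card_le_two (a := P 3) (b := P 4)
    rw [← hBdef] at c4
    omega
  obtain rfl : f = f' := by rw [← H.l0, ← H'.l0, ag _ hl]
  obtain rfl : d = d' := by
    have := h.two H.hl (H.mem 0) (H.mem 3) (by rw [H.l0, H.l3]; exact H.df.symm) _ (H'.mem 3)
    rw [H.l0, H.l3, H'.l3] at this
    exact (this.resolve_left H'.df).symm
  have ee : e'.1 = e.1 := by
    have := h.two H.hk (H.mem 0) (H.mem 3) (by rw [H.k0, H.k3]; exact H.ea.symm) _ (H'.mem 3)
    rw [H.k0, H.k3, H'.k3] at this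
    exact this.resolve_left H'.ea
  have kl : k ≠ l' := fun e => hl (by simp [e])
  have ml : m ≠ l' := fun e => hl (by simp [e])
  rcases eq_or_eq_flp ee with rfl | ee
  · have H'' : Half K V W j m k l' c (v m).1 (z k).1 d e' f (P 0) Q :=
      { H' with
        agr := fun i => (ag.mono fun _ h => Set.mem_insert_of_mem _ h).trans (H'.agr i)
        k0 := by rw [H'.k0] }
    exact H.absurd hS H'' hzm hS.disjoint hmk ml kl
      fun t ht hc => all t (mem_blk.2 ⟨Finset.mem_union.1 ht, hc⟩)
  · obtain ⟨α, β, hα, hβ, hαβ⟩ : ∃ α β : Fin 6, P α m = flp (P 2 m) ∧ P β m = P 2 m ∧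
        ((α = 3 ∧ β = 4) ∨ (α = 4 ∧ β = 3)) := by
      rcases eq_or_eq_flp (s := P 3 m) (t := P 2 m) (by rw [H.ms, H.ms]) with e | e
      · exact ⟨4, 3, by rw [H.m34, e], e, Or.inr ⟨rfl, rfl⟩⟩
      · exact ⟨3, 4, e, by rw [H.m34, e, flp_flp], Or.inl ⟨rfl, rfl⟩⟩
    have αk : P α k = e := by rcases hαβ with ⟨rfl, rfl⟩ | ⟨rfl, rfl⟩; exacts [H.k3, H.k4]
    have αl : (P α l').1 = d := by
      rcases hαβ with ⟨rfl, rfl⟩ | ⟨rfl, rfl⟩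
      · exact H.l3
      · rw [H.l4, flp_fst, H.l3]
    obtain ⟨y₀, hy₀⟩ := exists_cov (P α) (insert j K)
    set y := upd y₀ l' (flp f) with hy
    have c0 : Cov (insert j K) (P α) y :=
      (cov_upd_of_ne (s := flp f) (by rw [αl]; exact H.df)).2 hy₀
    have hlj : l' ∉ insert j K := by simp [hl₂]
    have rel := hS.blk_rel hj c y
    rw [Finset.sum_eq_single (P α), if_pos c0] at rel
    · have sg1 : dsgn (sg V) j (P α) = 1 ∨ dsgn (sg V) j (P α) = -1 := sgn_sg.dsgn j (P α) (mP α)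
      rcases sg1 with e | e <;> rw [e] at rel <;> norm_num at rel
    · intro t ht hne
      rw [if_neg]
      intro hc
      have l_ne : t l' ≠ f := fun e => not_cov_upd (s := flp f) hlj (by rw [e, flp_flp]) hc
      have k_ne : t k ≠ flp e := fun e => c0.ne_flp hk' hc (by rw [e, αk])
      have m_ne : t m ≠ P 2 m := fun e => hc.ne_flp hm c0 (by rw [hα, e])
      obtain ⟨i, rfl | rfl⟩ := all t ht
      · fin_cases i
        · exact l_ne H.l0
        · exact l_ne H.l1
        · exact m_ne rfl
        · rcases hαβ with ⟨rfl, rfl⟩ | ⟨rfl, rfl⟩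
          · exact hne rfl
          · exact m_ne hβ
        · rcases hαβ with ⟨rfl, rfl⟩ | ⟨rfl, rfl⟩
          · exact m_ne hβ
          · exact hne rfl
        · exact l_ne H.l5
      · fin_cases i
        · exact l_ne H'.l0
        · exact l_ne H'.l1
        · exact k_ne (H'.k2.trans ee)
        · exact k_ne (H'.k3.trans ee)
        · exact k_ne (H'.k4.trans ee)
        · exact l_ne H'.l5
    · exact fun e => absurd (mP α) e

/-- No class of a block consists of four words. -/
theorem Flat.not_four [Finite ι] (h : Flat K V W) (hj : j ∉ K) (hk : k ∉ insert j K)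
    (hB : (blk V W j c).card = 12) (hz : z ∈ blk V W j c) :
    (cls (blk V W j c) k (z k).1).card ≠ 4 := by
  intro ca
  have hS := h.toSt
  have BU : blk V W j c ⊆ V ∪ W := blk_subset
  obtain ⟨m, hm, p, hp, q, hq, hpq⟩ := (hS.blk_rel₂ hj hk c (z k).1).exists_ne sgn_blk₂
    (hS.blk_red₂ hj hk (h.noDT _ _ _ _)) ⟨z, mem_cls.2 ⟨hz, rfl⟩⟩
  rw [mem_cls] at hp hq
  have hm' : m ∉ insert j K ∧ k ∉ insert m (insert j K) ∧ m ∉ K := by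
    simp only [Set.mem_insert_iff, not_or] at *
    exact ⟨hm.2, ⟨fun e => hm.1 e.symm, hk⟩, hm.2.2⟩
  have cell : ∀ p q, p ∈ blk V W j c ∧ (p k).1 = (z k).1 → q ∈ blk V W j c ∧ (q k).1 = (z k).1 →
      (p m).1 ≠ (q m).1 → (cls (cls (blk V W j c) m (p m).1) k (p k).1).card = 2 := by
    intro p q hp hq hpq
    rw [cls_comm, hp.2]
    exact ((hS.blk_rel₂ hj hk c (z k).1).quad_agr sgn_blk₂
      (hS.blk_red₂ hj hk (h.noDT _ _ _ _)) ca hm (mem_cls.2 hp) (mem_cls.2 hq) hpq).2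
  have p4 := h.four_le hj hm'.1 hp.1
  have q4 := h.four_le hj hm'.1 hq.1
  have pe := hS.even_cls_blk hj hm'.1 (c := c) (p m).1
  have qe := hS.even_cls_blk hj hm'.1 (c := c) (q m).1
  have sum := h.sum BU hm'.2.2 (BU hp.1) (BU hq.1) hpq
  by_cases e1 : (cls (blk V W j c) m (p m).1).card = 4
  · exact h.not_four_four hj hm'.1 hm'.2.1 hB hp.1 (by rw [hp.2]; exact ca) e1
      (cell p q hp hq hpq)
  by_cases e2 : (cls (blk V W j c) m (q m).1).card = 4
  · exact h.not_four_four hj hm'.1 hm'.2.1 hB hq.1 (by rw [hq.2]; exact ca) e2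
      (cell q p hq hp hpq.symm)
  exact h.not_four_six hj hm'.1 hm'.2.1 hp.1 hq.1 hpq (hq.2.trans hp.2.symm)
    (by rw [hp.2]; exact ca) (by omega) (by omega)

end

section

variable {K : Set ι} {w v u t t₁ t₂ p q z r x w₁ w₂ w₃ w₄ w₅ w₆ : ι → C × Bool} {y : ι → C → Bool}
  {A B U V W X : Finset (ι → C × Bool)} {σ τ : (ι → C × Bool) → ℤ} {j k l m : ι} {a c : C}

theorem St.red (h : St K V W) : Red K (V ∪ W) (sg V) := by
  have nV : ∀ {t}, t ∈ W → t ∉ V := fun ht => Finset.disjoint_right.1 h.disjoint ht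
  intro w hw v hv e
  rw [Finset.mem_union] at hw hv
  rcases hw with hw | hw <;> rcases hv with hv | hv
  · simp [sg, hw, hv]
  · exact absurd e (h.no _ hw _ hv)
  · exact absurd e.symm (h.no _ hv _ hw)
  · simp [sg, nV hw, nV hv]

theorem Flat.no_flip (h : Flat K V W) (hj : j ∉ K) (hm : m ∉ insert j K) (hp : p ∈ blk V W j c)
    (hq : q ∈ blk V W j c) (e : q m = flp (p m)) (ag : Agr (insert m (insert j K)) p q)
    (hs : dsgn (sg V) j q = dsgn (sg V) j p) : False := by
  have : dsgn (sg V) j p * bit (p m) = dsgn (sg V) j q * bit (q m) :=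
    h.toSt.blk_red₂ hj hm (h.noDT j m c (p m).1) p (mem_cls.2 ⟨hp, rfl⟩) q
      (mem_cls.2 ⟨hq, by rw [e]; rfl⟩) ag
  rw [hs, e, bit_flp] at this
  have s1 : dsgn (sg V) j p = 1 ∨ dsgn (sg V) j p = -1 := sgn_sg.dsgn j p hp
  have s2 := bit_eq (p m)
  rcases s1 with s1 | s1 <;> rcases s2 with s2 | s2 <;> rw [s1, s2] at this <;> norm_num at this

/-- A single class at `k` in a block forces a single letter. -/
theorem Flat.fib_card [Finite ι] (h : Flat K V W) (hj : j ∉ K) (hk : k ∉ insert j K)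
    {s : C × Bool} (hc : ∀ t ∈ blk V W j c, (t k).1 = s.1)
    (hne : (fib (blk V W j c) k s).Nonempty) : 6 < (fib (blk V W j c) k s).card := by
  set F := fib (blk V W j c) k s with hF
  have R := (h.toSt.blk_rel hj c).fib_of_const hk hc
  rw [← hF] at R
  have S : Sgn F (dsgn (sg V) j) := sgn_sg.dsgn j
  have FB : ∀ {t}, t ∈ F → t ∈ blk V W j c := fun ht => fib_subset ht
  have Fk : ∀ {t}, t ∈ F → t k = s := fun ht => (mem_fib.1 ht).2
  have D : Red (insert k (insert j K)) F (dsgn (sg V) j) := fun w hw v hv e =>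
    h.toSt.blk_red hj c w (FB hw) v (FB hv) (agr_of_insert e ((Fk hw).trans (Fk hv).symm))
  have nf : ∀ {p q m}, p ∈ F → q ∈ F → m ∉ insert k (insert j K) → q m = flp (p m) →
      Agr (insert m (insert k (insert j K))) p q → dsgn (sg V) j q = dsgn (sg V) j p → False := by
    intro p q m hp hq hm e ag hs
    refine h.no_flip hj (fun e => hm (Set.mem_insert_of_mem _ e)) (FB hp) (FB hq) e ?_ hs
    rw [Set.insert_comm] at ag
    exact agr_of_insert ag ((Fk hp).trans (Fk hq).symm)
  have ev := Nat.even_iff.1 (R.even S)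
  have pos := hne.card_pos
  by_contra hlt
  obtain h2 | h4 | h6 : F.card = 2 ∨ F.card = 4 ∨ F.card = 6 := by omega
  · obtain ⟨a, b, hab, e⟩ := Finset.card_eq_two.1 h2
    rw [e] at R S D
    obtain ⟨ag, hs⟩ := R.pair hab S
    have e1 := D a (by simp) b (by simp) ag
    have := S a (by simp)
    omega
  · obtain ⟨t, ht⟩ := hne
    obtain ⟨m, b, x, d, e, -, -, -, -, Q⟩ := R.quad S D h4 ht
    exact nf ht (by rw [e]; simp) Q.hm Q.mb Q.ab Q.sb
  · obtain ⟨m, l, w₁, w₂, w₃, w₄, w₅, w₆, e, H⟩ := R.hexa S D h6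
    refine nf (p := w₁) (q := w₂) (by rw [e]; simp) (by rw [e]; simp) H.hl H.l2 ?_ H.s2
    exact agr_of_insert H.a2 H.m2.symm

theorem Flat.not_const [Finite ι] (h : Flat K V W) (hj : j ∉ K) (hk : k ∉ insert j K)
    (hB : (blk V W j c).card = 12) (hz : z ∈ blk V W j c)
    (hc : ∀ t ∈ V ∪ W, (t j).1 = c ↔ (t k).1 = (z k).1) : False := by
  set B := blk V W j c with hBdef
  have mB : ∀ {t}, t ∈ B ↔ t ∈ V ∪ W ∧ (t j).1 = c := by
    intro t; rw [mem_blk, Finset.mem_union]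
  have BU : B ⊆ V ∪ W := blk_subset
  have hkK : k ∉ K := fun e => hk (Set.mem_insert_of_mem _ e)
  have hck : ∀ t ∈ B, (t k).1 = (z k).1 := fun t ht => (hc t (BU ht)).1 (mB.1 ht).2
  have c1 := h.fib_card hj hk hck ⟨z, mem_fib.2 ⟨hz, rfl⟩⟩
  have c2 := card_cls (A := B) (l := k) (s := z k)
  rw [show cls B k (z k).1 = B from Finset.filter_true_of_mem hck] at c2
  have e0 : fib B k (flp (z k)) = ∅ := by
    by_contra hne
    have := h.fib_card hj hk (s := flp (z k)) hck (Finset.nonempty_iff_ne_empty.2 hne)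
    rw [← hBdef] at this c1
    omega
  have nf : ∀ t ∈ V ∪ W, t k ≠ flp (z k) := by
    intro t ht e
    have : t ∈ fib B k (flp (z k)) := mem_fib.2 ⟨mB.2 ⟨ht, (hc t ht).2 (by rw [e]; rfl)⟩, e⟩
    rw [e0] at this
    simp at this
  have key : ∀ {V W : Finset (ι → C × Bool)}, St K V W → (∀ t ∈ V, t k ≠ flp (z k)) →
      (∀ t ∈ W, t k ≠ flp (z k)) → ∀ y, (∃ t ∈ fib V k (z k), Cov (insert k K) t y) →
        ∃ t ∈ fib W k (z k), Cov (insert k K) t y := by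
    rintro V W h nV nW y ⟨v, hv, hvy⟩
    rw [mem_fib] at hv
    have v1 : Cov K v (upd y k (z k)) := (cov_upd_self hkK hv.2).2 hvy
    obtain ⟨w, hw, w1⟩ := (h.cov _).1 ⟨v, hv.1, v1⟩
    by_cases e : (w k).1 = (z k).1
    · have ek := (eq_or_eq_flp e).resolve_right (nW w hw)
      exact ⟨w, mem_fib.2 ⟨hw, ek⟩, (cov_upd_self hkK ek).1 w1⟩
    · rw [cov_upd_of_ne e] at w1
      obtain ⟨v', hv', w2⟩ := (h.cov (upd y k (flp (z k)))).2
        ⟨w, hw, (cov_upd_of_ne (s := flp (z k)) e).2 w1⟩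
      have e' : (v' k).1 ≠ (z k).1 := fun e' => by
        rcases eq_or_eq_flp e' with e' | e'
        · exact not_cov_upd (s := flp (z k)) hkK (by rw [e', flp_flp]) w2
        · exact nV v' hv' e'
      rw [cov_upd_of_ne (s := flp (z k)) e', ← cov_upd_of_ne (s := z k) e'] at w2
      have := h.cV.eq_of_cov hv.1 hv' v1 w2
      exact absurd (by rw [← this, hv.2]) e'
  have nV : ∀ t ∈ V, t k ≠ flp (z k) := fun t ht => nf t (Finset.mem_union_left _ ht)
  have nW : ∀ t ∈ W, t k ≠ flp (z k) := fun t ht => nf t (Finset.mem_union_right _ ht)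
  have hS : St (insert k K) (fib V k (z k)) (fib W k (z k)) :=
    { cV := h.cV.fib _ _, cW := h.cW.fib _ _, tV := h.tV.fib _ _, tW := h.tW.fib _ _
      no := by
        intro v hv w hw e
        rw [mem_fib] at hv hw
        exact h.no v hv.1 w hw.1 (agr_of_insert e (hv.2.trans hw.2.symm))
      cov := fun y => ⟨key h.toSt nV nW y, key h.toSt.symm nW nV y⟩ }
  have eB : fib V k (z k) ∪ fib W k (z k) = B := by
    ext t
    simp only [Finset.mem_union, mem_fib, mB]
    constructor
    · rintro (⟨ht, e⟩ | ⟨ht, e⟩)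
      · exact ⟨Or.inl ht, (hc t (by simp [ht])).2 (by rw [e])⟩
      · exact ⟨Or.inr ht, (hc t (by simp [ht])).2 (by rw [e])⟩
    · rintro ⟨ht, e⟩
      have e' := (eq_or_eq_flp ((hc t (by simpa using ht)).1 e)).resolve_right
        (nf t (by simpa using ht))
      exact ht.imp (fun a => ⟨a, e'⟩) fun a => ⟨a, e'⟩
  have c3 := hS.card_union
  rw [eB, hB] at c3
  have := h.min _ _ _ hS (Finset.card_pos.1 (by omega))
  have := h.c12
  omega

theorem Flat.six [Finite ι] (h : Flat K V W) (hj : j ∉ K) (hk : k ∉ insert j K)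
    (h1 : t₁ ∈ V ∪ W) (h2 : t₂ ∈ V ∪ W) (hne : (t₁ j).1 ≠ (t₂ j).1) (hp : p ∈ V ∪ W)
    (hq : q ∈ V ∪ W) (hpq : (p k).1 ≠ (q k).1) :
    (cls (cls (V ∪ W) j (t₁ j).1) k (p k).1).card = 6 := by
  have hkK : k ∉ K := fun e => hk (Set.mem_insert_of_mem _ e)
  have hB := h.b12 j hj _ h1 _ h2 hne
  change (blk V W j (t₁ j).1).card = 12 at hB
  change (cls (blk V W j (t₁ j).1) k (p k).1).card = 6
  set B := blk V W j (t₁ j).1 with hBdef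
  have BU : B ⊆ V ∪ W := blk_subset
  have not4 : ∀ t ∈ B, (cls B k (t k).1).card ≠ 4 := fun t ht => h.not_four hj hk hB ht
  have le4 : ∀ t ∈ B, 4 ≤ (cls B k (t k).1).card := fun t ht => h.four_le hj hk ht
  have not12 : ∀ {p q}, p ∈ V ∪ W → q ∈ V ∪ W → (p k).1 ≠ (q k).1 →
      (cls B k (p k).1).card ≠ 12 := by
    intro p q hp hq hpq e12
    have e1 : cls B k (p k).1 = B := Finset.eq_of_subset_of_card_le cls_subset (by omega)
    have e2 : cls B k (p k).1 = cls (V ∪ W) k (p k).1 :=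
      Finset.eq_of_subset_of_card_le (cls_mono BU) (by rw [h.b12 k hkK _ hp _ hq hpq, e12])
    obtain ⟨z, hz⟩ := Finset.card_pos.1 (show 0 < B.card by omega)
    have hzk : (z k).1 = (p k).1 := by rw [← e1] at hz; exact (mem_cls.1 hz).2
    refine h.not_const hj hk hB hz fun t ht => ?_
    rw [hzk]
    constructor
    · intro e
      have : t ∈ cls B k (p k).1 := by
        rw [e1]; exact mem_blk.2 ⟨Finset.mem_union.1 ht, e⟩
      exact (mem_cls.1 this).2
    · intro e
      have : t ∈ B := by rw [← e1, e2]; exact mem_cls.2 ⟨ht, e⟩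
      exact (mem_blk.1 this).2
  have sum := h.sum BU hkK hp hq hpq
  have ev : ∀ d, (cls B k d).card % 2 = 0 := h.toSt.even_cls_blk hj hk
  have alt : ∀ p : ι → C × Bool, (cls B k (p k).1).card = 0 ∨ (4 ≤ (cls B k (p k).1).card ∧
      (cls B k (p k).1).card ≠ 4) := by
    intro p
    rcases (cls B k (p k).1).eq_empty_or_nonempty with e | ⟨t, ht⟩
    · left; rw [e]; rfl
    · right
      have e := (mem_cls.1 ht).2
      rw [← e]
      exact ⟨le4 t (cls_subset ht), not4 t (cls_subset ht)⟩
  have a1 := alt p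
  have a2 := alt q
  have a3 := not12 hp hq hpq
  have a4 := not12 hq hp hpq.symm
  have := ev (p k).1
  have := ev (q k).1
  omega

theorem Rel.cls_cls_eq_empty [Finite ι] {b d : C} (h : Rel K U σ) (hs : Sgn U σ) (hr : Red K U σ)
    (h6 : U.card = 6) (hm : m ∉ K) (hl : l ∉ K) (hml : m ≠ l) (h2 : (cls U m b).card = 2)
    (h2' : (cls U l d).card = 2) : cls (cls U m b) l d = ∅ := by
  obtain ⟨m', w₁, w₂, w₃, w₄, w₅, w₆, e, H, e1⟩ := h.hexa_at hs hr h6 hl h2'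
  by_cases hmm : m' = m
  · subst hmm
    have eU : ({w₄, w₅, w₆, w₁, w₂, w₃} : Finset (ι → C × Bool)) =
        {w₁, w₂, w₃, w₄, w₅, w₆} := by
      ext z
      simp only [Finset.mem_insert, Finset.mem_singleton]
      tauto
    have e4 : (w₄ m').1 = b :=
      H.swap.pair (hs _ (by rw [e]; simp)) (by rw [eU, ← e]; exact h2)
    have c4 := H.card₄
    rw [e4, ← e] at c4
    rw [c4]
    have e3 : (w₃ l).1 ≠ d := by
      rw [← e1]
      exact H.l3
    refine Finset.eq_empty_of_forall_notMem fun z hz => ?_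
    simp only [mem_cls, Finset.mem_insert, Finset.mem_singleton] at hz
    rcases hz with ⟨rfl | rfl, hz⟩
    · exact e3 (by rw [← H.l4]; exact hz)
    · exact e3 (by rw [← H.l5]; exact hz)
  · exfalso
    have ha := H.agr
    rw [← e] at ha
    have ha' : ∀ t ∈ U, (t m).1 = (w₁ m).1 := fun t ht => by
      rw [ha t ht m (by simp [hm, hml, Ne.symm hmm])]
    by_cases eb : (w₁ m).1 = b
    · have : cls U m b = U := Finset.filter_true_of_mem fun t ht => (ha' t ht).trans eb
      rw [this] at h2
      omega
    · have : cls U m b = ∅ := Finset.filter_false_of_mem fun t ht hb =>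
        eb ((ha' t ht).symm.trans hb)
      rw [this] at h2
      simp at h2

theorem Flat.false [Finite ι] (h : Flat K V W) : False := by
  have ne : (V ∪ W).Nonempty := by
    rw [← Finset.card_pos]
    have := Finset.card_le_card (Finset.subset_union_left (s₁ := V) (s₂ := W))
    have := h.c12
    omega
  obtain ⟨j, hj, t₁, h1, t₂, h2, h12⟩ := h.toSt.rel.exists_ne sgn_sg h.toSt.red ne
  have hB := h.b12 j hj _ h1 _ h2 h12
  obtain ⟨k, hk, p, hp, q, hq, hpq⟩ := (h.toSt.blk_rel hj (t₁ j).1).exists_ne (sgn_sg.dsgn j)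
    (h.toSt.blk_red hj _) (Finset.card_pos.1 (show 0 < (blk V W j (t₁ j).1).card by
      change (blk V W j (t₁ j).1).card = 12 at hB; omega))
  replace hp := blk_subset hp
  replace hq := blk_subset hq
  have hkK : k ∉ K := fun e => hk (Set.mem_insert_of_mem _ e)
  have n6 : ∀ {t₁ t₂ p q j k}, t₁ ∈ V ∪ W → t₂ ∈ V ∪ W → p ∈ V ∪ W → q ∈ V ∪ W → j ∉ K →
      k ∉ insert j K → (t₁ j).1 ≠ (t₂ j).1 → (p k).1 ≠ (q k).1 →
      (cls (cls (V ∪ W) j (t₁ j).1) k (p k).1).card = 6 :=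
    fun h1 h2 hp hq hj hk => fun h12 hpq => h.six hj hk h1 h2 h12 hp hq hpq
  have c6 := n6 h1 h2 hp hq hj hk h12 hpq
  obtain ⟨m, l, w₁, w₂, w₃, w₄, w₅, w₆, e, H⟩ := (h.toSt.blk_rel₂ hj hk (t₁ j).1 (p k).1).hexa
    sgn_blk₂ (h.toSt.blk_red₂ hj hk (h.noDT _ _ _ _)) c6
  have hm := H.hm
  have hl := H.hl
  have hml := H.hml
  have mU : ∀ x ∈ ({w₁, w₂, w₃, w₄, w₅, w₆} : Finset (ι → C × Bool)), x ∈ V ∪ W :=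
    fun x hx => by
      rw [← e] at hx
      exact blk_subset (cls_subset hx)
  simp only [Set.mem_insert_iff, not_or] at hm hl
  have u1 := mU w₁ (by simp)
  have u3 := mU w₃ (by simp)
  have u4 := mU w₄ (by simp)
  have hjk : ¬ k = j := fun e => hk (by simp [e])
  have pr2 : ∀ {a b : ι → C × Bool}, a ≠ b → ({a, b} : Finset (ι → C × Bool)).card = 2 :=
    fun e => Finset.card_pair e
  have cm : (cls (cls (cls (V ∪ W) j (t₁ j).1) k (p k).1) m (w₄ m).1).card = 2 := by
    have := H.card₄
    rw [← e] at this
    exact (congrArg Finset.card this).trans (pr2 H.ne₄₅)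
  have cl : (cls (cls (cls (V ∪ W) j (t₁ j).1) k (p k).1) l (w₁ l).1).card = 2 := by
    have eU : ({w₄, w₅, w₆, w₁, w₂, w₃} : Finset (ι → C × Bool)) =
        {w₁, w₂, w₃, w₄, w₅, w₆} := by
      ext z
      simp only [Finset.mem_insert, Finset.mem_singleton]
      tauto
    have := H.swap.card₄
    rw [eU, ← e] at this
    exact (congrArg Finset.card this).trans (pr2 H.swap.ne₄₅)
  have cA : ∀ {X : Finset (ι → C × Bool)} {j k : ι} {c a : C},
      cls (cls X j c) k a = cls (cls X k a) j c := cls_comm ..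
  have U3 : ∀ {j k : ι} {c a : C}, cls (cls (V ∪ W) j c) k a ⊆ V ∪ W :=
    fun {_ _ _ _} => cls_subset.trans cls_subset
  have marg : ∀ {m x z}, m ∉ insert j K → m ∉ insert k K → x ∈ V ∪ W → z ∈ V ∪ W →
      (x m).1 ≠ (z m).1 →
      (cls (cls (cls (V ∪ W) j (t₁ j).1) k (p k).1) m (x m).1).card = 2 →
      (cls (cls (cls (V ∪ W) j (t₁ j).1) k (q k).1) m (z m).1).card = 2 ∧
      (cls (cls (cls (V ∪ W) j (t₂ j).1) k (p k).1) m (z m).1).card = 2 ∧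
      (cls (cls (cls (V ∪ W) j (t₂ j).1) k (q k).1) m (x m).1).card = 2 ∧
      (cls (cls (cls (V ∪ W) j (t₁ j).1) k (q k).1) m (x m).1).card = 4 ∧
      (cls (cls (cls (V ∪ W) j (t₂ j).1) k (p k).1) m (x m).1).card = 4 := by
    intro m x z mj mk hx hz hxz hc
    have hmK : m ∉ K := fun e => mj (Set.mem_insert_of_mem _ e)
    have a1 := n6 h1 h2 hx hz hj mj h12 hxz
    have a2 := n6 h2 h1 hx hz hj mj h12.symm hxz
    have a3 := n6 hp hq hx hz hkK mk hpq hxz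
    have b1 := n6 h1 h2 hq hp hj hk h12 hpq.symm
    have b2 := n6 h2 h1 hp hq hj hk h12.symm hpq
    have b3 := n6 h2 h1 hq hp hj hk h12.symm hpq.symm
    have s1 := h.sum (U3 (j := j) (c := (t₁ j).1) (k := m) (a := (x m).1)) hkK hp hq hpq
    have s2 := h.sum (U3 (j := j) (c := (t₂ j).1) (k := m) (a := (x m).1)) hkK hp hq hpq
    have s3 := h.sum (U3 (j := k) (c := (p k).1) (k := m) (a := (x m).1)) hj h1 h2 h12
    have s4 := h.sum (U3 (j := j) (c := (t₁ j).1) (k := k) (a := (q k).1)) hmK hx hz hxz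
    have s5 := h.sum (U3 (j := j) (c := (t₂ j).1) (k := k) (a := (p k).1)) hmK hx hz hxz
    rw [cA (j := m) (k := k), cA (j := m) (k := k)] at s1 s2
    rw [cA (j := m) (k := j), cA (j := m) (k := j), cA (X := V ∪ W) (j := k) (k := j),
      cA (X := V ∪ W) (j := k) (k := j)] at s3
    omega
  have hmj : m ∉ insert j K := by simp [hm]
  have hmk : m ∉ insert k K := by simp [hm]
  have hlj : l ∉ insert j K := by simp [hl]
  have hlk : l ∉ insert k K := by simp [hl]
  have hmK := hm.2.2
  have hlK := hl.2.2
  obtain ⟨m1, m2, m3, m4, m5⟩ := marg hmj hmk u4 u1 H.m4 cm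
  obtain ⟨l1, l2, l3, l4, l5⟩ := marg hlj hlk u1 u3 H.l3.symm cl
  have emp : ∀ {t₁ t₂ p q : ι → C × Bool} {b d : C}, t₁ ∈ V ∪ W → t₂ ∈ V ∪ W →
      (t₁ j).1 ≠ (t₂ j).1 → p ∈ V ∪ W → q ∈ V ∪ W → (p k).1 ≠ (q k).1 →
      (cls (cls (cls (V ∪ W) j (t₁ j).1) k (p k).1) m b).card = 2 →
      (cls (cls (cls (V ∪ W) j (t₁ j).1) k (p k).1) l d).card = 2 →
      cls (cls (cls (cls (V ∪ W) j (t₁ j).1) k (p k).1) m b) l d = ∅ :=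
    fun {t₁ _ p _ _ _} h1 h2 h12 hp hq hpq cm cl =>
      (h.toSt.blk_rel₂ hj hk (t₁ j).1 (p k).1).cls_cls_eq_empty sgn_blk₂
        (h.toSt.blk_red₂ hj hk (h.noDT _ _ _ _)) (n6 h1 h2 hp hq hj hk h12 hpq) H.hm H.hl H.hml
        cm cl
  have e1 := congrArg Finset.card (emp h1 h2 h12 hp hq hpq cm cl)
  have e2 := congrArg Finset.card (emp h1 h2 h12 hq hp hpq.symm m1 l1)
  have e3 := congrArg Finset.card (emp h2 h1 h12.symm hp hq hpq m2 l2)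
  have e4 := congrArg Finset.card (emp h2 h1 h12.symm hq hp hpq.symm m3 l3)
  rw [Finset.card_empty] at e1 e2 e3 e4
  have lm : l ∉ insert m K := by simp [hlK, Ne.symm hml]
  have tot := n6 u4 u1 u1 u3 hmK lm H.m4 H.l3.symm
  have U4 : ∀ {j k m : ι} {c a b : C}, cls (cls (cls (V ∪ W) j c) k a) m b ⊆ V ∪ W :=
    fun {_ _ _ _ _ _} => cls_subset.trans U3
  have s0 := h.sum (U3 (j := m) (c := (w₄ m).1) (k := l) (a := (w₁ l).1)) hj h1 h2 h12
  have s1 := fun t : ι → C × Bool => h.sum (U4 (j := m) (c := (w₄ m).1) (k := l) (a := (w₁ l).1)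
    (m := j) (b := (t j).1)) hkK hp hq hpq
  have s2 := fun t p : ι → C × Bool => h.sum (U4 (j := j) (c := (t j).1) (k := k) (a := (p k).1)
    (m := l) (b := (w₁ l).1)) hmK u4 u1 H.m4
  have s3 := fun t p : ι → C × Bool => h.sum (U4 (j := j) (c := (t j).1) (k := k) (a := (p k).1)
    (m := m) (b := (w₁ m).1)) hlK u1 u3 H.l3.symm
  have co : ∀ {c a b d : C}, cls (cls (cls (cls (V ∪ W) m b) l d) j c) k a =
      cls (cls (cls (cls (V ∪ W) j c) k a) m b) l d := by
    intro c a b d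
    ext z
    simp only [mem_cls]
    tauto
  have co' : ∀ {c a b d : C}, cls (cls (cls (cls (V ∪ W) j c) k a) l d) m b =
      cls (cls (cls (cls (V ∪ W) j c) k a) m b) l d := by
    intro c a b d
    ext z
    simp only [mem_cls]
    tauto
  simp only [co, co'] at s0 s1 s2 s3
  have := s1 t₁
  have := s1 t₂
  have := s2 t₁ q
  have := s2 t₂ p
  have := s3 t₁ q
  have := s3 t₂ p
  omega

end

section

variable {K : Set ι} {w v u t t₁ t₂ p q z r x w₁ w₂ w₃ w₄ w₅ w₆ : ι → C × Bool} {y : ι → C → Bool}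
  {A B U V W X : Finset (ι → C × Bool)} {σ τ : (ι → C × Bool) → ℤ} {j k l m : ι} {a c : C}

theorem MSt.hasTight [Finite ι] (h : MSt K V W) (hne : V.Nonempty) : HasTight K V := by
  have ne : (V ∪ W).Nonempty := hne.mono Finset.subset_union_left
  by_cases hlt : ∃ j ∉ K, ∃ t ∈ V ∪ W, hb V W j (t j) ≤ 5
  · obtain ⟨j, hj, t, ht, h5⟩ := hlt
    have hc := h.toSt.card_blk hj (t j)
    have h4 := h.toSt.four_le_hb hj ht
    have nd : ∀ k d, NoDT K V W j k (t j).1 d := by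
      intro k d v w D e
      have h6 := (D.bounds h).1
      have := h.toSt.card_blk hj (v j)
      rw [e] at this
      omega
    have : hb V W j (t j) ≠ 5 := fun e => h.toSt.not_ten hj nd (by omega)
    obtain ⟨m, k, M, N, p, q, O⟩ := h.toSt.exists_oct hj nd (by omega)
    exact h.hasTight_of_oct O
  push Not at hlt
  have six : ∀ {j t s}, j ∉ K → t ∈ V ∪ W → s ∈ V ∪ W → (t j).1 ≠ (s j).1 →
      hb V W j (t j) = 6 ∧ V.card = 12 := by
    intro j t s hj ht hs e
    have := hlt j hj t ht
    have := hlt j hj s hs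
    have := h.toSt.hb_add_le hj e
    have := h.le
    omega
  have six' : ∀ {j t s}, j ∉ K → t ∈ V ∪ W → s ∈ V ∪ W → s j = flp (t j) →
      hb V W j (t j) = 6 ∧ V.card = 12 := by
    intro j t s hj ht hs e
    by_cases hc : ∀ r ∈ V ∪ W, (r j).1 = (t j).1
    · exact absurd ((e.symm.trans (h.letter_const hj hc ⟨t, ht, rfl⟩ s hs))) (flp_ne _)
    · push Not at hc
      obtain ⟨r, hr, e⟩ := hc
      exact six hj ht hr e.symm
  by_cases hD : ∃ v w j k, DT K V W v w j k
  · obtain ⟨v, w, j, k, D⟩ := hD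
    have hv : v ∈ V ∪ W := Finset.mem_union_left _ D.mv
    have hw : w ∈ V ∪ W := Finset.mem_union_right _ D.mw
    have e1 := six' D.hj hv hw D.wj
    have e2 := six' D.hk hv hw D.wk
    exact ⟨e1.2, h.tight_of_dt D e1.1 e2.1⟩
  · push Not at hD
    obtain ⟨j, hj, t, ht, s, hs, e⟩ := h.toSt.rel.exists_ne sgn_sg h.toSt.red ne
    refine (Flat.false { toMSt := h, c12 := (six hj ht hs e).2, nd := hD, b12 := ?_ }).elim
    intro j hj t ht s hs e
    have := h.toSt.card_blk hj (t j)
    rw [(six hj ht hs e).1] at this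
    exact this

theorem St.hasTight [Finite ι] (h : St K V W) (hne : V.Nonempty) (hle : V.card ≤ 12) :
    HasTight K V := by
  have ex : ∃ n K' V' W', St (ι := ι) (C := C) K' V' W' ∧ V'.Nonempty ∧ V'.card = n :=
    ⟨_, K, V, W, h, hne, rfl⟩
  obtain ⟨K', V', W', h', hne', e'⟩ := Nat.find_spec ex
  have hmin : ∀ (K₁ : Set ι) (V₁ W₁ : Finset (ι → C × Bool)), St K₁ V₁ W₁ → V₁.Nonempty →
      V'.card ≤ V₁.card := fun K₁ V₁ W₁ h₁ hne₁ => by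
    rw [e']
    exact Nat.find_min' ex ⟨K₁, V₁, W₁, h₁, hne₁, rfl⟩
  have h1 := hmin _ _ _ h hne
  have h2 := (MSt.hasTight ⟨h', by omega, hmin⟩ hne').1
  exact MSt.hasTight ⟨h, hle, fun K₁ V₁ W₁ h₁ hne₁ => by
    have := hmin _ _ _ h₁ hne₁; omega⟩ hne

end

section

variable {K : Set ι} {w v u t t₁ t₂ p q z r x w₁ w₂ w₃ w₄ w₅ w₆ : ι → C × Bool} {y : ι → C → Bool}
  {A B U V W X : Finset (ι → C × Bool)} {σ τ : (ι → C × Bool) → ℤ} {j k l m : ι} {a c : C}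

theorem Tight.agr {i : ι} {b t₃ t₄ h : ι → C × Bool}
    (T : Tight (insert i ∅) V j k l m v b t₁ t₂ t₃ t₄)
    (hj : h j = b j) (hk : h k = v k) (hl : h l = b l) (hm : h m = b m)
    (ho : Agr (insert m (insert l (insert k (insert j (insert i ∅))))) h v)
    (nz : ¬ Dich (insert i ∅) z h) (dv : Dich (insert i ∅) z v) (db : Dich (insert i ∅) z b)
    (d1 : Dich (insert i ∅) z t₁) (d2 : Dich (insert i ∅) z t₂) :
    z j = h j ∧ z k = h k ∧ z l = h l ∧ z m = h m := by
  have nf : ∀ n, n ∉ insert i (∅ : Set ι) → h n ≠ flp (z n) := fun n hn e => nz ⟨n, hn, e⟩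
  have out : ∀ {x}, Agr (insert m (insert l (insert k (insert j (insert i ∅))))) v x →
      Dich (insert i ∅) z x → x j = flp (z j) ∨ x k = flp (z k) ∨ x l = flp (z l) ∨
        x m = flp (z m) := by
    rintro x ha ⟨n, hn, e⟩
    by_cases nj : n = j
    · exact Or.inl (nj ▸ e)
    by_cases nk : n = k
    · exact Or.inr (Or.inl (nk ▸ e))
    by_cases nl : n = l
    · exact Or.inr (Or.inr (Or.inl (nl ▸ e)))
    by_cases nm : n = m
    · exact Or.inr (Or.inr (Or.inr (nm ▸ e)))
    have hn' : n ∉ insert m (insert l (insert k (insert j (insert i (∅ : Set ι))))) := by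
      simp only [Set.mem_insert_iff, not_or] at hn ⊢
      exact ⟨nm, nl, nk, nj, hn⟩
    exact absurd ((ho.trans ha n hn').trans e) (nf n hn)
  have nj := nf j T.hj
  have nk := nf k T.hk
  have nl := nf l T.hl₁
  have nm := nf m T.hl₂
  rw [hj] at nj
  rw [hk] at nk
  rw [hl] at nl
  rw [hm] at nm
  have zk : z k = v k := by
    rcases out T.ab db with e | e | e | e
    · exact absurd e nj
    · rw [T.bk, flp_inj] at e; exact e.symm
    · exact absurd e nl
    · exact absurd e nm
  have n1 : ∀ {x : C × Bool}, x = t₁ k → x ≠ flp (z k) := by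
    rintro x rfl e
    rw [zk] at e
    exact T.k1 (by rw [e]; rfl)
  have zm : z m = b m := by
    rcases out T.a2 d2 with e | e | e | e
    · exact absurd (T.j2.symm.trans e) nj
    · exact absurd e (n1 T.k2)
    · exact absurd (T.x2.symm.trans e) nl
    · rw [T.y2, flp_inj] at e; exact e.symm
  have nv : v m ≠ flp (z m) := fun e => T.bl₂ (by rw [e, zm]; rfl)
  have zl : z l = b l := by
    rcases out T.a1 d1 with e | e | e | e
    · exact absurd (T.j1.symm.trans e) nj
    · exact absurd e (n1 rfl)
    · rw [T.x1, flp_inj] at e; exact e.symm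
    · exact absurd (T.y1.symm.trans e) nv
  have zj : z j = b j := by
    rcases out (Agr.refl _) dv with e | e | e | e
    · rw [T.bj, e, flp_flp]
    · exact absurd e nk
    · exact absurd (by rw [e, zl]; rfl) T.bl₁
    · exact absurd e nv
  exact ⟨zj.trans hj.symm, zk.trans hk.symm, zl.trans hl.symm, zm.trans hm.symm⟩

theorem dich_two (hw : Dich K w v) (ag : Agr (insert m (insert l K)) w v) :
    v l = flp (w l) ∨ v m = flp (w m) := by
  obtain ⟨n, hn, e⟩ := hw
  by_cases nl : n = l
  · exact Or.inl (nl ▸ e)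
  by_cases nm : n = m
  · exact Or.inr (nm ▸ e)
  exact absurd (e.symm.trans (ag n (by simp [nl, nm, hn])).symm) (flp_ne _)

theorem not_twin_left (hl : l ∉ K) (nt : ¬ Twin K w v) (ag : Agr (insert m (insert l K)) w v)
    (e : v l = flp (w l)) : w m ≠ v m := fun e' => nt ⟨l, hl, e, agr_of_insert ag e'⟩

theorem not_twin_right (hm : m ∉ K) (nt : ¬ Twin K w v) (ag : Agr (insert m (insert l K)) w v)
    (e : v m = flp (w m)) : w l ≠ v l := fun e' =>
  nt ⟨m, hm, e, agr_of_insert (by rw [Set.insert_comm]; exact ag) e'⟩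

theorem card_le_two_of_agr (hA : Code K A) (tA : TwinFree K A) (hl : l ∉ K) (hm : m ∉ K)
    (ag : ∀ w ∈ A, ∀ v ∈ A, Agr (insert m (insert l K)) w v) : A.card ≤ 2 := by
  by_contra hlt
  obtain ⟨a, ha, b, hb, c, hc, ab, ac, bc⟩ := Finset.two_lt_card.1 (not_le.1 hlt)
  have d : ∀ {w v}, w ∈ A → v ∈ A → w ≠ v → v l = flp (w l) ∧ w m ≠ v m ∨
      v m = flp (w m) ∧ w l ≠ v l := fun {w v} hw hv ne =>
    (dich_two (hA w hw v hv ne) (ag w hw v hv)).imp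
      (fun e => ⟨e, not_twin_left hl (tA w hw v hv) (ag w hw v hv) e⟩)
      (fun e => ⟨e, not_twin_right hm (tA w hw v hv) (ag w hw v hv) e⟩)
  have nl : ∀ {x y z : ι → C × Bool}, y ∈ A → z ∈ A → y ≠ z →
      y l = flp (x l) → z l = flp (x l) → False := by
    intro x y z hy hz ne e1 e2
    rcases d hy hz ne with e | e
    · exact flp_ne (y l) (by rw [← e.1, e1, e2])
    · exact e.2 (e1.trans e2.symm)
  have nm : ∀ {x y z : ι → C × Bool}, y ∈ A → z ∈ A → y ≠ z →
      y m = flp (x m) → z m = flp (x m) → False := by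
    intro x y z hy hz ne e1 e2
    rcases d hy hz ne with e | e
    · exact e.2 (e1.trans e2.symm)
    · exact flp_ne (y m) (by rw [← e.1, e1, e2])
  have sy : ∀ {x y : C × Bool}, y = flp x → x = flp y := fun h => by rw [h, flp_flp]
  rcases d ha hb ab with d1 | d1 <;> rcases d ha hc ac with d2 | d2 <;>
    rcases d hb hc bc with d3 | d3
  · exact nl hb hc bc d1.1 d2.1
  · exact nl hb hc bc d1.1 d2.1
  · exact nl ha hc ac (sy d1.1) d3.1
  · exact nm ha hb ab (sy d2.1) (sy d3.1)
  · exact nl ha hb ab (sy d2.1) (sy d3.1)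
  · exact nm ha hc ac (sy d1.1) d3.1
  · exact nm hb hc bc d1.1 d2.1
  · exact nm hb hc bc d1.1 d2.1

/-- At most two words, up to agreement, are dichotomous to both words of a non-twin pair
in two coordinates. -/
theorem eq_or_of_dich_two (hl : l ∉ K) (hm : m ∉ K) (hwv : Dich K w v) (nt : ¬ Twin K w v)
    (ag : Agr (insert m (insert l K)) w v) :
    ∃ x₁ x₂ : (C × Bool) × (C × Bool), ∀ z, Agr (insert m (insert l K)) w z → Dich K w z →
      Dich K v z → (z l, z m) = x₁ ∨ (z l, z m) = x₂ := by
  rcases dich_two hwv ag with e | e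
  · have n := not_twin_left hl nt ag e
    refine ⟨(flp (w l), flp (v m)), (w l, flp (w m)), fun z az d1 d2 => ?_⟩
    rcases dich_two d1 az with e1 | e1 <;> rcases dich_two d2 (ag.symm.trans az) with e2 | e2
    · rw [e1, e, flp_flp] at e2
      exact absurd e2 (flp_ne _)
    · exact Or.inl (by rw [e1, e2])
    · exact Or.inr (by rw [e1, e2, e, flp_flp])
    · exact absurd (flp_inj.1 (e1.symm.trans e2)) n
  · have n := not_twin_right hm nt ag e
    refine ⟨(flp (v l), flp (w m)), (flp (w l), w m), fun z az d1 d2 => ?_⟩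
    rcases dich_two d1 az with e1 | e1 <;> rcases dich_two d2 (ag.symm.trans az) with e2 | e2
    · exact absurd (flp_inj.1 (e1.symm.trans e2)) n
    · exact Or.inr (by rw [e1, e2, e, flp_flp])
    · exact Or.inl (by rw [e1, e2])
    · rw [e1, e, flp_flp] at e2
      exact absurd e2 (flp_ne _)

theorem Tight.false [Fintype ι] (hι : Fintype.card ι = 7) {F : Finset (ι → C × Bool)} {i : ι}
    {s : C × Bool} {b t₃ t₄ : ι → C × Bool} (cF : Code ∅ F) (tF : TwinFree ∅ F)
    (hF : ∀ y, ∃ w ∈ F, Cov ∅ w y)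
    (T : Tight (insert i ∅) (fib F i s) j k l m v b t₁ t₂ t₃ t₄) : False := by
  have hj := T.hj
  have hk := T.hk
  have hl := T.hl₁
  have hm := T.hl₂
  simp only [Set.mem_insert_iff, Set.mem_empty_iff_false, or_false] at hj hk hl hm
  have jk := T.jk; have jl := T.jl₁; have jm := T.jl₂
  have kl := T.kl₁; have km := T.kl₂; have lm := T.ll
  obtain ⟨o₁, o₂, -, ho⟩ : ∃ o₁ o₂, o₁ ≠ o₂ ∧
      (Finset.univ \ {i, j, k, l, m} : Finset ι) = {o₁, o₂} := by
    refine Finset.card_eq_two.1 ?_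
    rw [Finset.card_sdiff_of_subset (Finset.subset_univ _), Finset.card_univ, hι]
    have : ({i, j, k, l, m} : Finset ι).card = 5 := by
      rw [Finset.card_insert_of_notMem, Finset.card_insert_of_notMem,
        Finset.card_insert_of_notMem, Finset.card_insert_of_notMem, Finset.card_singleton] <;>
      simp [Ne.symm hj, Ne.symm hk, Ne.symm hl, Ne.symm hm, *]
    omega
  have mo : ∀ n, n = o₁ ∨ n = o₂ ∨ n = i ∨ n = j ∨ n = k ∨ n = l ∨ n = m := by
    intro n
    by_cases hn : n ∈ (Finset.univ \ {i, j, k, l, m} : Finset ι)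
    · rw [ho] at hn
      simp at hn
      tauto
    · simp at hn
      tauto
  have no : (o₁ ≠ i ∧ o₁ ≠ j ∧ o₁ ≠ k ∧ o₁ ≠ l ∧ o₁ ≠ m) ∧
      (o₂ ≠ i ∧ o₂ ≠ j ∧ o₂ ≠ k ∧ o₂ ≠ l ∧ o₂ ≠ m) := by
    have h1 : o₁ ∈ (Finset.univ \ {i, j, k, l, m} : Finset ι) := by rw [ho]; simp
    have h2 : o₂ ∈ (Finset.univ \ {i, j, k, l, m} : Finset ι) := by rw [ho]; simp
    simp at h1 h2
    tauto
  set h : ι → C × Bool := fun n => if n = j ∨ n = l ∨ n = m then b n else v n with hdef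
  have hhj : h j = b j := by simp [hdef]
  have hhl : h l = b l := by simp [hdef]
  have hhm : h m = b m := by simp [hdef]
  have hhk : h k = v k := by simp [hdef, jk.symm, kl, km]
  have hhi : h i = s := by
    simp only [hdef, Ne.symm hj, Ne.symm hl, Ne.symm hm, or_self, if_false]
    exact (mem_fib.1 T.mv).2
  have hho : Agr (insert m (insert l (insert k (insert j (insert i ∅))))) h v := by
    intro n hn
    simp only [Set.mem_insert_iff, not_or] at hn
    simp [hdef, hn]
  have agr : ∀ z, ¬ Dich ∅ z h → (∀ x ∈ fib F i s, z ≠ x → Dich (insert i ∅) z x) →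
      z j = h j ∧ z k = h k ∧ z l = h l ∧ z m = h m := by
    intro z nz dz
    refine T.agr hhj hhk hhl hhm hho (not_dich_insert nz) (dz _ T.mv ?_) (dz _ T.mb ?_)
      (dz _ T.m1 ?_) (dz _ T.m2 ?_) <;> rintro rfl <;> apply nz
    · exact ⟨j, by simp, by rw [hhj, T.bj]⟩
    · exact ⟨k, by simp, by rw [hhk, T.bk, flp_flp]⟩
    · exact ⟨l, by simp, by rw [hhl, T.x1, flp_flp]⟩
    · exact ⟨m, by simp, by rw [hhm, T.y2, flp_flp]⟩
  set M := meet ∅ F h with hM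
  have MF : ∀ {z}, z ∈ M → z ∈ F := fun hz => meet_subset hz
  have nM : ∀ {z}, z ∈ M → ¬ Dich ∅ z h := fun hz => (mem_meet.1 hz).2
  have dF : ∀ {z x}, z ∈ F → x ∈ F → z ≠ x → x i ≠ flp (z i) → Dich (insert i ∅) z x := by
    intro z x hz hx ne e
    obtain ⟨n, -, hn⟩ := cF z hz x hx ne
    refine ⟨n, ?_, hn⟩
    simp only [Set.mem_insert_iff, Set.mem_empty_iff_false, or_false]
    rintro rfl
    exact e hn
  have ci : ∀ z ∈ M, (z i).1 ≠ s.1 := by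
    intro z hz e
    rcases eq_or_eq_flp e with e | e
    · have := agr z (nM hz) fun x hx ne => dF (MF hz) (mem_fib.1 hx).1 ne
        (by rw [(mem_fib.1 hx).2, e]; exact (flp_ne _).symm)
      exact T.no z (mem_fib.2 ⟨MF hz, e⟩) (this.1.trans hhj) (this.2.1.trans hhk)
    · exact nM hz ⟨i, by simp, by rw [hhi, e, flp_flp]⟩
  have ag : ∀ z ∈ M, Agr (insert o₂ (insert o₁ (insert i ∅))) z h := by
    intro z hz n hn
    obtain ⟨a1, a2, a3, a4⟩ := agr z (nM hz) fun x hx ne => dF (MF hz) (mem_fib.1 hx).1 ne (by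
      rw [(mem_fib.1 hx).2]
      exact fun e => ci z hz (by rw [e]; rfl))
    simp only [Set.mem_insert_iff, Set.mem_empty_iff_false, or_false, not_or] at hn
    rcases mo n with e | e | e | e | e | e | e
    · exact absurd e hn.2.1
    · exact absurd e hn.1
    · exact absurd e hn.2.2
    all_goals rw [e]; assumption
  have cov : Covers ∅ F h := fun y _ => hF y
  have cM : Code ∅ M := cF.mono meet_subset
  have tM : TwinFree ∅ M := tF.mono meet_subset
  have hu : ∀ z ∈ M, (z i).1 ≠ (h i).1 := fun z hz => by rw [hhi]; exact ci z hz
  have c6 := six_le_card_meet cF tF cov (Set.notMem_empty i) hu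
  rw [← hM] at c6
  have ni : i ∉ (∅ : Set ι) := Set.notMem_empty i
  have n1 : o₁ ∉ insert i (∅ : Set ι) := by simp [no]
  have n2 : o₂ ∉ insert i (∅ : Set ι) := by simp [no]
  have le2 : ∀ r, (fib M i r).card ≤ 2 := fun r =>
    card_le_two_of_agr (cM.fib i r) (tM.fib i r) n1 n2 fun w hw v hv =>
      (ag w (fib_subset hw)).trans (ag v (fib_subset hv)).symm
  have c4 : ∀ z ∈ M, (cls M i (z i).1).card = 4 ∧ (fib M i (z i)).card = 2 ∧
      (fib M i (flp (z i))).card = 2 := by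
    intro z hz
    have h1 := four_le_card_cls cM tM (fun a ha => nM ha) cov.meet ni hz (hu z hz)
    have h2 := card_cls (A := M) (l := i) (s := z i)
    have h3 := le2 (z i)
    have h4 := le2 (flp (z i))
    omega
  obtain ⟨z, hz⟩ : M.Nonempty := Finset.card_pos.1 (by omega)
  obtain ⟨z', hz', ne⟩ := exists_fst_ne (A := M) (k := i) (a := (z i).1)
    (by rw [(c4 z hz).1]; omega)
  obtain ⟨w₁, w₂, h12, e12⟩ := Finset.card_eq_two.1 (c4 z' hz').2.1
  have g1 : w₁ ∈ fib M i (z' i) := by rw [e12]; simp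
  have g2 : w₂ ∈ fib M i (z' i) := by rw [e12]; simp
  obtain ⟨x₁, x₂, hx⟩ := eq_or_of_dich_two n1 n2 ((cM.fib i _) _ g1 _ g2 h12)
    (tM.fib i _ _ g1 _ g2) ((ag _ (fib_subset g1)).trans (ag _ (fib_subset g2)).symm)
  have hx' : ∀ u ∈ M, (u i).1 = (z i).1 → (u o₁, u o₂) = x₁ ∨ (u o₁, u o₂) = x₂ := by
    intro u hu e
    have d : ∀ {w}, w ∈ fib M i (z' i) → Dich (insert i ∅) w u := by
      intro w hw
      rw [mem_fib] at hw
      refine dF (MF hw.1) (MF hu) ?_ ?_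
      · rintro rfl
        exact ne (by rw [← e, hw.2])
      · intro e'
        exact ne (by rw [← e, e', hw.2]; rfl)
    exact hx u ((ag _ (fib_subset g1)).trans (ag _ hu).symm) (d g1) (d g2)
  have ag' : ∀ {u u'}, u ∈ M → u' ∈ M → (u o₁, u o₂) = (u' o₁, u' o₂) →
      Agr (insert i ∅) u u' := by
    intro u u' hu hu' e
    rw [Prod.mk.injEq] at e
    exact agr_of_insert (agr_of_insert ((ag u hu).trans (ag u' hu').symm) e.2) e.1
  obtain ⟨u₁, u₂, f12, e⟩ := Finset.card_eq_two.1 (c4 z hz).2.1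
  have q1 : u₁ ∈ fib M i (z i) := by rw [e]; simp
  have q2 : u₂ ∈ fib M i (z i) := by rw [e]; simp
  obtain ⟨u₃, q3⟩ : (fib M i (flp (z i))).Nonempty :=
    Finset.card_pos.1 (by rw [(c4 z hz).2.2]; omega)
  have r12 : ¬ Agr (insert i ∅) u₁ u₂ := fun h =>
    h.not_dich (cM.fib i _ _ q1 _ q2 f12)
  have r13 := fib_no_agr tM ni _ _ q1 _ q3
  have r23 := fib_no_agr tM ni _ _ q2 _ q3
  rw [mem_fib] at q1 q2 q3
  have p1 := hx' _ q1.1 (by rw [q1.2])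
  have p2 := hx' _ q2.1 (by rw [q2.2])
  have p3 := hx' _ q3.1 (by rw [q3.2]; rfl)
  have s12 := fun e => r12 (ag' q1.1 q2.1 e)
  have s13 := fun e => r13 (ag' q1.1 q3.1 e)
  have s23 := fun e => r23 (ag' q2.1 q3.1 e)
  rcases p1 with p1 | p1 <;> rcases p2 with p2 | p2 <;> rcases p3 with p3 | p3 <;>
    first
    | exact s12 (p1.trans p2.symm)
    | exact s13 (p1.trans p3.symm)
    | exact s23 (p2.trans p3.symm)

end

section

variable {K : Set ι} {w v u t t₁ t₂ p q z r x w₁ w₂ w₃ w₄ w₅ w₆ : ι → C × Bool} {y : ι → C → Bool}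
  {A B U V W X : Finset (ι → C × Bool)} {σ τ : (ι → C × Bool) → ℤ} {j k l m : ι} {a c : C}

/-- A pairwise dichotomous set of words has at most `2 ^ n` members, `n` being the number of
coordinates. -/
theorem card_le_two_pow (S : Finset ι) : ∀ {A : Finset (ι → C × Bool)}, Code (S : Set ι)ᶜ A →
    A.card ≤ 2 ^ S.card := by
  induction S using Finset.induction_on with
  | empty =>
    intro A hA
    rw [Finset.card_empty, pow_zero, Finset.card_le_one]
    intro w hw v hv
    by_contra hne
    obtain ⟨i, hi, -⟩ := hA w hw v hv hne
    simp at hi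
  | insert l S hl ih =>
    intro A hA
    set g : C → Bool := fun c => decide ((fib A l (c, false)).card ≤ (fib A l (c, true)).card)
      with hg
    set A' := A.filter (fun w => (w l).2 = g (w l).1) with hA'
    have c1 : Code (S : Set ι)ᶜ A' := by
      intro w hw v hv hne
      rw [hA', Finset.mem_filter] at hw hv
      obtain ⟨i, hi, e⟩ := hA w hw.1 v hv.1 hne
      refine ⟨i, ?_, e⟩
      simp only [Finset.coe_insert, Set.mem_compl_iff, Set.mem_insert_iff, not_not] at hi ⊢
      refine hi.resolve_left ?_
      rintro rfl
      have h1 := hv.2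
      rw [e, flp_fst, flp_snd, hw.2] at h1
      revert h1
      cases g (w i).1 <;> simp
    have h2 : A.card ≤ 2 * A'.card := by
      rw [Finset.card_eq_sum_card_fiberwise (f := fun w => (w l).1) (t := A.image fun w => (w l).1)
        (fun w hw => Finset.mem_image_of_mem _ hw),
        Finset.card_eq_sum_card_fiberwise (s := A') (f := fun w => (w l).1)
        (t := A.image fun w => (w l).1)
        (fun w hw => Finset.mem_image_of_mem _ (Finset.filter_subset _ _ hw)), Finset.mul_sum]
      refine Finset.sum_le_sum fun c _ => ?_
      have e1 := card_cls (A := A) (l := l) (s := (c, true))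
      have e2 : A'.filter (fun w => (w l).1 = c) = fib A l (c, g c) := by
        ext w
        simp only [hA', Finset.mem_filter, mem_fib, Prod.ext_iff]
        constructor
        · rintro ⟨⟨h1, h2⟩, rfl⟩
          exact ⟨h1, rfl, h2⟩
        · rintro ⟨h1, rfl, h2⟩
          exact ⟨⟨h1, h2⟩, rfl⟩
      rw [e2]
      change (cls A l c).card ≤ _
      change (cls A l c).card = (fib A l (c, true)).card + (fib A l (c, false)).card at e1
      by_cases h : (fib A l (c, false)).card ≤ (fib A l (c, true)).card
      · rw [show g c = true by simp [hg, h]]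
        omega
      · rw [show g c = false by simp [hg, h]]
        omega
    have := ih c1
    rw [Finset.card_insert_of_notMem hl, pow_succ]
    omega

theorem st_of_covers (cF : Code ∅ A) (tF : TwinFree ∅ A) (hF : ∀ y, ∃ w ∈ A, Cov ∅ w y) {i : ι}
    {s : C × Bool} {d : C} (hd : d ≠ s.1) :
    St (insert i ∅) (fib A i s) (fib A i (flp s)) where
  cV := cF.fib i s
  cW := cF.fib i _
  tV := tF.fib i s
  tW := tF.fib i _
  no := fib_no_agr tF (Set.notMem_empty i) s
  cov y := fib_trace_iff (u := fun n => (d, y n d)) cF (Set.notMem_empty i) hd (fun y _ => hF y) y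
    fun _ _ => rfl

theorem exists_twin [Fintype ι] (hι : Fintype.card ι = 7) (cF : Code ∅ A)
    (hF : ∀ y, ∃ w ∈ A, Cov ∅ w y) (i : ι) (h5 : 5 ≤ (A.image fun w => (w i).1).card) :
    ∃ w ∈ A, ∃ v ∈ A, Twin ∅ w v := by
  by_contra hno
  have tF : TwinFree ∅ A := fun w hw v hv ht => hno ⟨w, hw, v, hv, ht⟩
  have hc : A.card ≤ 2 ^ 7 := by
    rw [← hι]
    exact card_le_two_pow Finset.univ (by simpa using cF)
  have hsum := Finset.card_eq_sum_card_fiberwise (s := A) (f := fun w => (w i).1)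
    (t := A.image fun w => (w i).1) (fun w hw => Finset.mem_image_of_mem _ hw)
  obtain ⟨c, hcA, hc12⟩ : ∃ c ∈ A.image fun w => (w i).1, (cls A i c).card ≤ 25 := by
    by_contra hcon
    push Not at hcon
    have := Finset.sum_le_sum (s := A.image fun w => (w i).1) fun c hc =>
      Nat.succ_le_of_lt (hcon c hc)
    rw [Finset.sum_const, smul_eq_mul] at this
    change A.card = ∑ c ∈ A.image fun w => (w i).1, (cls A i c).card at hsum
    omega
  obtain ⟨d, -, hd⟩ : ∃ d ∈ A.image fun w => (w i).1, d ≠ c :=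
    Finset.exists_mem_ne (by omega) c
  have hS := st_of_covers cF tF hF (i := i) (s := (c, true)) hd
  have e1 := hS.card_eq
  have e2 := card_cls (A := A) (l := i) (s := (c, true))
  change (cls A i c).card = _ at e2
  have pos : 0 < (cls A i c).card := by
    obtain ⟨w, hw, e⟩ := Finset.mem_image.1 hcA
    exact Finset.card_pos.2 ⟨w, mem_cls.2 ⟨hw, e⟩⟩
  obtain ⟨-, j, k, l, m, v, b, t₁, t₂, t₃, t₄, T⟩ := hS.hasTight
    (Finset.card_pos.1 (by omega)) (by omega)
  exact T.false hι cF tF hF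

end

end Polybox

/-- `A` contains exactly one representative of each class of `ℝ` modulo `ℤ`. -/
def IsTransversal (A : Set ℝ) : Prop := ∀ r : ℝ, ∃! n : ℤ, r + n ∈ A

theorem existsUnique_int_window (a r : ℝ) : ∃! n : ℤ, a - 1 < r + n ∧ r + n ≤ a := by
  refine ⟨⌊a - r⌋, ⟨?_, ?_⟩, ?_⟩
  · have := Int.lt_floor_add_one (a - r)
    linarith
  · have := Int.floor_le (a - r)
    linarith
  · rintro n ⟨h1, h2⟩
    exact (Int.floor_eq_iff.2 ⟨by linarith, by linarith⟩).symm

/-- A transversal through two prescribed points. -/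
theorem exists_isTransversal_of_pair {a b : ℝ} (h : ∀ n : ℤ, a = b + n → n = 0) :
    ∃ A, IsTransversal A ∧ a ∈ A ∧ b ∈ A := by
  refine ⟨{r | r = b ∨ ((a - 1 < r ∧ r ≤ a) ∧ ¬ ∃ n : ℤ, r = b + n)}, fun r => ?_, ?_, Or.inl rfl⟩
  · by_cases hr : ∃ m : ℤ, r = b + m
    · obtain ⟨m, rfl⟩ := hr
      refine ⟨-m, Or.inl (by push_cast; ring), ?_⟩
      rintro n (hn | ⟨-, hn⟩)
      · have : ((m + n : ℤ) : ℝ) = 0 := by push_cast; linarith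
        have := Int.cast_eq_zero.1 this
        omega
      · exact absurd ⟨m + n, by push_cast; ring⟩ hn
    · obtain ⟨n, hn, hu⟩ := existsUnique_int_window a r
      have key : ∀ n : ℤ, ¬ ∃ m : ℤ, r + n = b + m := by
        rintro n ⟨m, e⟩
        exact hr ⟨m - n, by push_cast; linarith⟩
      refine ⟨n, Or.inr ⟨hn, key n⟩, ?_⟩
      rintro n' (hn' | ⟨hn', -⟩)
      · exact absurd ⟨0, by simpa using hn'⟩ (key n')
      · exact hu _ hn'
  · by_cases ha : ∃ n : ℤ, a = b + n
    · obtain ⟨n, e⟩ := ha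
      refine Or.inl ?_
      simpa [h n e] using e
    · exact Or.inr ⟨⟨by linarith, le_rfl⟩, ha⟩

/-- The transversal in `(a - 1, a + 1]` picking from each class the representative prescribed
by `f`. -/
theorem isTransversal_choice (a : ℝ) (f : ℝ → Bool) : IsTransversal
    {r | (a - 1 < r ∧ r ≤ a ∧ f r = true) ∨ (a < r ∧ r ≤ a + 1 ∧ f (r - 1) = false)} := by
  intro r
  obtain ⟨n, ⟨h1, h2⟩, hu⟩ := existsUnique_int_window a r
  have up : ∀ m : ℤ, a < r + m → r + m ≤ a + 1 → m = n + 1 := by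
    intro m h3 h4
    have := hu (m - 1) ⟨by push_cast; linarith, by push_cast; linarith⟩
    omega
  cases hf : f (r + n)
  · refine ⟨n + 1, Or.inr ⟨by push_cast; linarith, by push_cast; linarith, ?_⟩, ?_⟩
    · rw [← hf]
      congr 1
      push_cast
      ring
    · rintro m (⟨h3, h4, h5⟩ | ⟨h3, h4, -⟩)
      · rw [hu m ⟨h3, h4⟩, hf] at h5
        cases h5
      · exact up m h3 h4
  · refine ⟨n, Or.inl ⟨h1, h2, hf⟩, ?_⟩
    rintro m (⟨h3, h4, -⟩ | ⟨h3, h4, h5⟩)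
    · exact hu m ⟨h3, h4⟩
    · rw [up m h3 h4, show r + ((n + 1 : ℤ) : ℝ) - 1 = r + n by push_cast; ring, hf] at h5
      cases h5

/-- A tiling of the line by unit intervals meets each transversal exactly once. -/
theorem existsUnique_mem_transversal {α : Type*} {P : α → Prop} {f : α → ℝ}
    (h : ∀ q, ∃! t, P t ∧ f t ≤ q ∧ q < f t + 1) {A : Set ℝ} (hA : IsTransversal A) :
    ∃! t, P t ∧ f t ∈ A := by
  have uniq : ∀ t s q, P t → P s → f t ≤ q → q < f t + 1 → f s ≤ q → q < f s + 1 → t = s :=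
    fun t s q ht hs h1 h2 h3 h4 => (h q).unique ⟨ht, h1, h2⟩ ⟨hs, h3, h4⟩
  have succ : ∀ t, P t → ∃ s, P s ∧ f s = f t + 1 := by
    intro t ht
    obtain ⟨s, ⟨hs, h1, h2⟩, -⟩ := h (f t + 1)
    refine ⟨s, hs, le_antisymm h1 (not_lt.1 fun h3 => ?_)⟩
    have := uniq t s (f s) ht hs (by linarith) h3 le_rfl (by linarith)
    subst this
    linarith
  have pred : ∀ t, P t → ∃ s, P s ∧ f s = f t - 1 := by
    intro t ht
    obtain ⟨s, ⟨hs, h1, h2⟩, -⟩ := h (f t - 1)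
    refine ⟨s, hs, le_antisymm h1 (not_lt.1 fun h3 => ?_)⟩
    obtain ⟨u, hu, e⟩ := succ s hs
    have := uniq t u (f t) ht hu le_rfl (by linarith) (by linarith) (by linarith)
    subst this
    linarith
  have shift : ∀ t, P t → ∀ n : ℤ, ∃ s, P s ∧ f s = f t + n := by
    intro t ht n
    induction n using Int.induction_on with
    | zero => exact ⟨t, ht, by simp⟩
    | succ n ih =>
      obtain ⟨s, hs, e⟩ := ih
      obtain ⟨u, hu, e'⟩ := succ s hs
      exact ⟨u, hu, by rw [e', e]; push_cast; ring⟩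
    | pred n ih =>
      obtain ⟨s, hs, e⟩ := ih
      obtain ⟨u, hu, e'⟩ := pred s hs
      exact ⟨u, hu, by rw [e', e]; push_cast; ring⟩
  obtain ⟨t₀, ⟨ht₀, -⟩, -⟩ := h 0
  obtain ⟨n, hn, -⟩ := hA (f t₀)
  obtain ⟨t, ht, e⟩ := shift t₀ ht₀ n
  refine ⟨t, ⟨ht, by rwa [e]⟩, ?_⟩
  rintro s ⟨hs, hsA⟩
  have htA : f t ∈ A := by rwa [e]
  obtain ⟨u, hu, e'⟩ := shift s hs ⌊f t - f s⌋
  have h1 := Int.floor_le (f t - f s)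
  have h2 := Int.lt_floor_add_one (f t - f s)
  have := uniq u t (f t) hu ht (by linarith) (by linarith) le_rfl (by linarith)
  subst this
  have h0 : ⌊f u - f s⌋ = 0 :=
    (hA (f s)).unique (by simpa only [← e'] using htA) (by simpa using hsA)
  rw [h0, Int.cast_zero, add_zero] at e'
  exact uniq s u (f u) hs hu (by linarith) (by linarith) le_rfl (by linarith)

/-- In a cube tiling, for any choice of transversals exactly one cube has all its coordinates in
the chosen transversals. The coordinates outside `S` are still read off from a point. -/
theorem existsUnique_mem_transversals {ι : Type*} [DecidableEq ι] {T : Set (ι → ℝ)}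
    (hT : ∀ p : ι → ℝ, ∃! t, t ∈ T ∧ ∀ j, t j ≤ p j ∧ p j < t j + 1) (A : ι → Set ℝ)
    (hA : ∀ j, IsTransversal (A j)) (S : Finset ι) : ∀ p : ι → ℝ,
    ∃! t, (t ∈ T ∧ ∀ j ∈ S, t j ∈ A j) ∧ ∀ j ∉ S, t j ≤ p j ∧ p j < t j + 1 := by
  induction S using Finset.induction_on with
  | empty => simpa using hT
  | insert l S hl ih =>
    intro p
    have := existsUnique_mem_transversal (f := fun t : ι → ℝ => t l)
      (P := fun t => (t ∈ T ∧ ∀ j ∈ S, t j ∈ A j) ∧ ∀ j ∉ insert l S, t j ≤ p j ∧ p j < t j + 1)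
      (fun q => ?_) (hA l)
    · refine (existsUnique_congr fun t => ?_).1 this
      simp only [Finset.forall_mem_insert]
      tauto
    · refine (existsUnique_congr fun t => ?_).1 (ih (Function.update p l q))
      constructor
      · rintro ⟨h1, h2⟩
        refine ⟨⟨h1, fun j hj => ?_⟩, by simpa using h2 l hl⟩
        rw [Finset.mem_insert, not_or] at hj
        simpa [hj.1] using h2 j hj.2
      · rintro ⟨⟨h1, h2⟩, h3⟩
        refine ⟨h1, fun j hj => ?_⟩
        rcases eq_or_ne j l with rfl | hjl
        · simpa using h3
        · simpa [hjl] using h2 j (by simp [hjl, hj])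

theorem IsCubeTiling.existsUnique_mem {T : Set (Fin 7 → ℝ)} (hT : IsCubeTiling T)
    (p : Fin 7 → ℝ) : ∃! t, t ∈ T ∧ ∀ j, t j ≤ p j ∧ p j < t j + 1 := by
  obtain ⟨t, ht, hp⟩ := Set.mem_iUnion₂.1 (hT.2 ▸ Set.mem_univ p)
  refine ⟨t, ⟨ht, hp⟩, ?_⟩
  rintro s ⟨hs, hsp⟩
  by_contra hne
  exact Set.disjoint_left.1 (hT.1 hs ht hne) hsp hp

theorem IsCubeTiling.existsUnique_transversal {T : Set (Fin 7 → ℝ)} (hT : IsCubeTiling T)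
    {A : Fin 7 → Set ℝ} (hA : ∀ j, IsTransversal (A j)) : ∃! t, t ∈ T ∧ ∀ j, t j ∈ A j := by
  simpa using existsUnique_mem_transversals hT.existsUnique_mem A hA Finset.univ 0

/-- Keller's lemma. -/
theorem IsCubeTiling.exists_sub_int {T : Set (Fin 7 → ℝ)} (hT : IsCubeTiling T)
    {t s : Fin 7 → ℝ} (ht : t ∈ T) (hs : s ∈ T) (hne : t ≠ s) :
    ∃ (j : Fin 7) (n : ℤ), t j = s j + n ∧ n ≠ 0 := by
  by_contra hcon
  push Not at hcon
  choose A hA htA hsA using fun j => exists_isTransversal_of_pair (hcon j)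
  exact hne ((hT.existsUnique_transversal hA).unique ⟨ht, htA⟩ ⟨hs, hsA⟩)

/-- The class of `t j` modulo `ℤ`, represented in `(x j - 1, x j]`, together with the side of
`x j` on which `t j` lies. -/
noncomputable def cubeWord (x t : Fin 7 → ℝ) (j : Fin 7) : ℝ × Bool :=
  if t j ≤ x j then (t j, true) else (t j - 1, false)

theorem cubeWord_flp {x t s : Fin 7 → ℝ} {j : Fin 7}
    (h : cubeWord x s j = Polybox.flp (cubeWord x t j)) : |t j - s j| = 1 := by
  unfold cubeWord Polybox.flp at h
  split_ifs at h with h1 h2 h2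
  · simp at h
  · rw [show t j - s j = 1 by have := congrArg Prod.fst h; simp at this; linarith, abs_one]
  · rw [show t j - s j = -1 by have := congrArg Prod.fst h; simp at this; linarith, abs_neg,
      abs_one]
  · simp at h

theorem cubeWord_inj {x t s : Fin 7 → ℝ} {j : Fin 7}
    (h : cubeWord x s j = cubeWord x t j) : t j = s j := by
  unfold cubeWord at h
  split_ifs at h with h1 h2 h2 <;> simp at h <;> exact h.symm

theorem cubeWord_flp_of_add_one {x t s : Fin 7 → ℝ} {j : Fin 7} (h : t j = s j + 1)
    (h1 : t j ≤ x j + 1) (h2 : x j - 1 < s j) :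
    cubeWord x t j = Polybox.flp (cubeWord x s j) := by
  rw [cubeWord, cubeWord, if_neg (by linarith), if_pos (by linarith), h]
  simp [Polybox.flp]

theorem twin_pair_of_L_eq_five (T : Set (Fin 7 → ℝ)) (hT : IsCubeTiling T)
    (x : Fin 7 → ℝ) (i : Fin 7) (h : (LSet T x i).ncard = 5) :
    HasTwinPair T := by
  classical
  set F : Set (Fin 7 → ℝ) := {t | t ∈ T ∧ ∀ j, x j - 1 < t j ∧ t j ≤ x j + 1}
  have code : ∀ A : Finset (Fin 7 → ℝ × Bool), (A : Set (Fin 7 → ℝ × Bool)) ⊆ cubeWord x '' F →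
      Polybox.Code ∅ A := by
    intro A hA w hw v hv hne
    obtain ⟨t, ⟨ht, htx⟩, rfl⟩ := hA hw
    obtain ⟨s, ⟨hs, hsx⟩, rfl⟩ := hA hv
    obtain ⟨j, n, e, hn⟩ := hT.exists_sub_int ht hs (by rintro rfl; exact hne rfl)
    refine ⟨j, Set.notMem_empty j, ?_⟩
    have h1 : ((-2 : ℤ) : ℝ) < n := by push_cast; linarith [(htx j).1, (hsx j).2]
    have h2 : (n : ℝ) < (2 : ℤ) := by push_cast; linarith [(htx j).2, (hsx j).1]
    have h1 := Int.cast_lt.1 h1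
    have h2 := Int.cast_lt.1 h2
    obtain rfl | rfl : n = 1 ∨ n = -1 := by omega
    · rw [cubeWord_flp_of_add_one (by simpa using e) (htx j).2 (hsx j).1, Polybox.flp_flp]
    · exact cubeWord_flp_of_add_one (by rw [e]; simp) (hsx j).2 (htx j).1
  have fin : (cubeWord x '' F).Finite := by
    by_contra hinf
    obtain ⟨A, hA, hc⟩ := Set.Infinite.exists_subset_card_eq hinf (2 ^ 7 + 1)
    have := Polybox.card_le_two_pow Finset.univ (A := A) (by simpa using code A hA)
    rw [hc, Finset.card_univ, Fintype.card_fin] at this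
    omega
  have covers : ∀ y, ∃ w ∈ fin.toFinset, Polybox.Cov ∅ w y := by
    intro y
    obtain ⟨t, ⟨ht, hty⟩, -⟩ :=
      hT.existsUnique_transversal fun j => isTransversal_choice (x j) (y j)
    refine ⟨cubeWord x t, fin.mem_toFinset.2 ⟨t, ⟨ht, fun j => ?_⟩, rfl⟩, fun j _ => ?_⟩
    · rcases hty j with ⟨h1, h2, -⟩ | ⟨h1, h2, -⟩ <;> constructor <;> linarith
    · rcases hty j with ⟨h1, h2, h3⟩ | ⟨h1, h2, h3⟩
      · rw [cubeWord, if_pos h2]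
        exact h3
      · rw [cubeWord, if_neg (by linarith)]
        exact h3
  have five : 5 ≤ (fin.toFinset.image fun w => (w i).1).card := by
    rw [← h, ← Set.ncard_coe_finset]
    refine Set.ncard_le_ncard ?_ (Finset.finite_toSet _)
    rintro r ⟨t, ht, ⟨z, hz, hzx⟩, hle, rfl⟩
    refine Finset.mem_coe.2 (Finset.mem_image.2 ⟨cubeWord x t, fin.mem_toFinset.2
      ⟨t, ⟨ht, fun j => ?_⟩, rfl⟩, ?_⟩)
    · have h1 := hz j
      have h2 := hzx j
      constructor <;> linarith
    · rw [cubeWord, if_pos hle]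
  obtain ⟨w, hw, v, hv, l, -, hl, hag⟩ :=
    Polybox.exists_twin (Fintype.card_fin 7) (code _ (by simp)) covers i (by convert five)
  obtain ⟨t, ⟨ht, -⟩, rfl⟩ := fin.mem_toFinset.1 hw
  obtain ⟨s, ⟨hs, -⟩, rfl⟩ := fin.mem_toFinset.1 hv
  exact ⟨t, ht, s, hs, l, cubeWord_flp hl,
    fun j hj => cubeWord_inj (hag j (by simpa using hj)).symm⟩
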